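/- There exist universal constants c, C > 0 with the following property. Let n ≥ 20 and let S ⊆ ℝ^n be a Borel set with S ∩ (−S) = ∅ and 0 < λ = Vol_n(S) ≤ n/200. Let μ be any SL_n(ℝ)-invariant Borel probability measure on the space 𝒳_n of covolume-one lattices in ℝ^n. Then for every integer k with 0 ≤ k ≤ n/10 and every Borel collection 𝒜_k of finite subsets of S, all of cardinality exactly k, μ({L ∈ 𝒳_n : L ∩ S is finite and L ∩ S ∈ 𝒜_k}) − P_λ(𝒜_k) ≤ C·e^{−c·n}. -/

import Mathlib

open MeasureTheory Pointwise
open scoped ENNReal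

noncomputable section

/-- `SL(n, ℝ)`, the special linear group of `n × n` real matrices of determinant one. -/
abbrev SLR (n : ℕ) := Matrix.SpecialLinearGroup (Fin n) ℝ

/-- The topology on `SL(n, ℝ)` induced from the space of matrices. -/
instance (n : ℕ) : TopologicalSpace (SLR n) :=
  TopologicalSpace.induced (fun g => (g : Matrix (Fin n) (Fin n) ℝ)) inferInstance

/-- The subgroup `SL(n, ℤ)` of `SL(n, ℝ)` (the range of the coefficient-wise
integer-to-real map on special linear groups). -/
def SLZ (n : ℕ) : Subgroup (SLR n) :=
  MonoidHom.range (Matrix.SpecialLinearGroup.map (n := Fin n) (Int.castRingHom ℝ))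

/-- The space `𝒳ₙ = SL(n, ℝ) / SL(n, ℤ)` of lattices of covolume one in `ℝⁿ`. -/
def LatticeSpace (n : ℕ) := SLR n ⧸ SLZ n

instance (n : ℕ) : TopologicalSpace (LatticeSpace n) :=
  inferInstanceAs (TopologicalSpace (SLR n ⧸ SLZ n))

/-- The Borel σ-algebra on the space of lattices. -/
instance (n : ℕ) : MeasurableSpace (LatticeSpace n) := borel _

/-- The action of `SL(n, ℝ)` on the space of lattices, `g.L = {g x : x ∈ L}`. -/
instance (n : ℕ) : MulAction (SLR n) (LatticeSpace n) :=
  inferInstanceAs (MulAction (SLR n) (SLR n ⧸ SLZ n))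

/-- The lattice `{g v : v ∈ ℤⁿ} ⊆ ℝⁿ` associated to a point of `LatticeSpace n`,
computed via a representative `g` of the coset (the resulting set of vectors does not
depend on the choice of representative, since `SL(n, ℤ)` preserves `ℤⁿ`). -/
def latticeOf {n : ℕ} (L : LatticeSpace n) : Set (Fin n → ℝ) :=
  {y | ∃ v : Fin n → ℤ,
    y = (Quotient.out (α := SLR n) L).1.mulVec (fun i => (v i : ℝ))}

/-- The law of the restriction to `S` of the Poisson point process of intensity one:
the probability that the (finite) point configuration in `S` belongs to the
collection `𝒜` of finite subsets of `S`. -/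
def poissonLaw (n : ℕ) (S : Set (Fin n → ℝ)) (𝒜 : Set (Set (Fin n → ℝ))) : ℝ :=
  ∑' m : ℕ,
    (Real.exp (-(volume S).toReal) * (volume S).toReal ^ m / (Nat.factorial m) *
      ((volume S).toReal ^ m)⁻¹) *
    ∫ x in Set.univ.pi (fun _ : Fin m => S),
      Set.indicator 𝒜 (fun _ => (1 : ℝ)) (Set.range x)

instance SLR.isTopologicalGroup (n : ℕ) : IsTopologicalGroup (SLR n) :=
  Matrix.SpecialLinearGroup.topologicalGroup

instance SLR.secondCountableTopology (n : ℕ) : SecondCountableTopology (SLR n) :=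
  haveI : SecondCountableTopology (Matrix (Fin n) (Fin n) ℝ) :=
    inferInstanceAs (SecondCountableTopology (Fin n → Fin n → ℝ))
  TopologicalSpace.secondCountableTopology_induced _ _ _

theorem exists_isOpen_inv_mul_mem {G : Type*} [Group G] [TopologicalSpace G]
    [IsTopologicalGroup G] {W : Set G} (hW : IsOpen W) (h1W : 1 ∈ W) :
    ∃ V : Set G, IsOpen V ∧ 1 ∈ V ∧ ∀ x ∈ V, ∀ y ∈ V, x⁻¹ * y ∈ W := by
  have hc : Continuous (fun p : G × G => p.1⁻¹ * p.2) := by fun_prop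
  have hnh : (fun p : G × G => p.1⁻¹ * p.2) ⁻¹' W ∈ nhds ((1 : G), (1 : G)) :=
    (hW.preimage hc).mem_nhds (by simpa using h1W)
  rw [nhds_prod_eq] at hnh
  obtain ⟨U, hU, U', hU', hUU⟩ := Filter.mem_prod_iff.1 hnh
  obtain ⟨V, hVU, hVo, h1V⟩ := mem_nhds_iff.1 (Filter.inter_mem hU hU')
  exact ⟨V, hVo, h1V, fun x hx y hy => hUU (Set.mk_mem_prod (hVU hx).1 (hVU hy).2)⟩

/-- `SL(n, ℤ)` is discrete in `SL(n, ℝ)`, in the form used to build a local section. -/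
theorem exists_isOpen_SLR_inv_mul_eq_one (n : ℕ) :
    ∃ V : Set (SLR n), IsOpen V ∧ 1 ∈ V ∧
      ∀ x ∈ V, ∀ y ∈ V, x⁻¹ * y ∈ SLZ n → x⁻¹ * y = 1 := by
  have hcoe : Continuous (fun g : SLR n => (g : Matrix (Fin n) (Fin n) ℝ)) :=
    continuous_induced_dom
  let W : Set (SLR n) := {g | ∀ i j, |g.1 i j - (1 : Matrix (Fin n) (Fin n) ℝ) i j| < 1}
  have hW : IsOpen W := by
    have : W = ⋂ i, ⋂ j, {g : SLR n | |g.1 i j - (1 : Matrix (Fin n) (Fin n) ℝ) i j| < 1} := by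
      ext g; simp [W]
    rw [this]
    refine isOpen_iInter_of_finite fun i => isOpen_iInter_of_finite fun j => ?_
    refine isOpen_lt ?_ continuous_const
    exact ((hcoe.matrix_elem i j).sub continuous_const).abs
  have h1W : (1 : SLR n) ∈ W := by intro i j; simp
  obtain ⟨V, hVo, h1V, hV⟩ := exists_isOpen_inv_mul_mem hW h1W
  refine ⟨V, hVo, h1V, fun x hx y hy hz => ?_⟩
  have hg := hV x hx y hy
  generalize x⁻¹ * y = g at hz hg
  obtain ⟨γ, rfl⟩ := hz
  ext i j
  have h := hg i j
  by_cases hij : i = j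
  · subst hij
    simp at h ⊢
    have h2 : |(γ.1 i i - 1 : ℤ)| < 1 := by exact_mod_cast h
    have := Int.abs_lt_one_iff.mp h2
    have h3 : γ.1 i i = 1 := by omega
    exact_mod_cast h3
  · simp [Matrix.one_apply_ne hij] at h ⊢
    have h2 : |(γ.1 i j : ℤ)| < 1 := by exact_mod_cast h
    have := Int.abs_lt_one_iff.mp h2
    exact_mod_cast this

/-- There is a Borel section of the projection `SL(n, ℝ) → SL(n, ℝ) / SL(n, ℤ)`. -/
theorem exists_borel_section (n : ℕ) :
    ∃ σ : LatticeSpace n → SLR n, (∀ L, (QuotientGroup.mk (s := SLZ n) (σ L)) = L) ∧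
      ∀ B : Set (SLR n), IsOpen B → MeasurableSet (σ ⁻¹' B) := by
  classical
  obtain ⟨V, hVo, h1V, hV⟩ := exists_isOpen_SLR_inv_mul_eq_one n
  let π : SLR n → LatticeSpace n := fun g => QuotientGroup.mk (s := SLZ n) g
  have hπo : IsOpenMap π := QuotientGroup.isOpenMap_coe
  have hπs : Function.Surjective π := QuotientGroup.mk_surjective
  have hopen : ∀ g : SLR n, IsOpen ((fun x => g⁻¹ * x) ⁻¹' V) := fun g =>
    hVo.preimage (continuous_const.mul continuous_id)
  obtain ⟨s, hs, hsU⟩ := TopologicalSpace.countable_cover_nhds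
    (f := fun g : SLR n => (fun x => g⁻¹ * x) ⁻¹' V)
    (fun g => (hopen g).mem_nhds (by simpa using h1V))
  have hsne : s.Nonempty := by
    by_contra h
    rw [Set.not_nonempty_iff_eq_empty] at h
    subst h
    have : (1 : SLR n) ∈ (∅ : Set (SLR n)) := by
      have h2 : (1 : SLR n) ∈ (Set.univ : Set (SLR n)) := trivial
      rw [← hsU] at h2; simp at h2
    exact this
  obtain ⟨g, hg⟩ := hs.exists_eq_range hsne
  let U : ℕ → Set (SLR n) := fun i => (fun x => (g i)⁻¹ * x) ⁻¹' V
  have hUo : ∀ i, IsOpen (U i) := fun i => hopen (g i)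
  have hcov : ∀ x, ∃ i, x ∈ U i := by
    intro x
    have h2 : x ∈ (Set.univ : Set (SLR n)) := trivial
    rw [← hsU, hg] at h2
    simpa [U] using h2
  have hinj : ∀ i, ∀ x ∈ U i, ∀ y ∈ U i, π x = π y → x = y := by
    intro i x hx y hy hxy
    have h1 : x⁻¹ * y ∈ SLZ n := QuotientGroup.eq.1 hxy
    have h2 := hV _ hx _ hy (by simpa [mul_assoc] using h1)
    have h3 : x⁻¹ * y = 1 := by simpa [mul_assoc] using h2
    exact (inv_mul_eq_one.1 h3)
  have hex : ∀ L : LatticeSpace n, ∃ i, ∃ x ∈ U i, π x = L := by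
    intro L
    obtain ⟨x, rfl⟩ := hπs L
    obtain ⟨i, hi⟩ := hcov x
    exact ⟨i, x, hi, rfl⟩
  let idx : LatticeSpace n → ℕ := fun L => Nat.find (hex L)
  have hidx : ∀ L, ∃ x ∈ U (idx L), π x = L := fun L => Nat.find_spec (hex L)
  choose σ hσU hσ using hidx
  refine ⟨σ, hσ, fun B hB => ?_⟩
  have hmeas : ∀ i, ∀ B : Set (SLR n), IsOpen B → MeasurableSet (π '' (U i ∩ B)) := by
    intro i B hB
    have : IsOpen (π '' (U i ∩ B)) := hπo _ ((hUo i).inter hB)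
    exact MeasurableSpace.measurableSet_generateFrom this
  have hidxm : ∀ i, MeasurableSet {L | idx L = i} := by
    intro i
    have : {L | idx L = i} = (π '' (U i ∩ Set.univ)) \ ⋃ j ∈ Set.Iio i, π '' (U j ∩ Set.univ) := by
      ext L
      simp only [Set.mem_ofPred_eq, idx, Nat.find_eq_iff, Set.inter_univ, Set.mem_sdiff,
        Set.mem_image,
        Set.mem_iUnion, Set.mem_Iio, not_exists, exists_prop]
      constructor
      · rintro ⟨h1, h2⟩
        exact ⟨h1, fun j ⟨hj, x, hx⟩ => h2 j hj x hx⟩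
      · rintro ⟨h1, h2⟩
        exact ⟨h1, fun j hj x hx => h2 j ⟨hj, x, hx⟩⟩
    rw [this]
    exact (hmeas i _ isOpen_univ).diff
      (MeasurableSet.biUnion (Set.to_countable _) fun j _ => hmeas j _ isOpen_univ)
  have : σ ⁻¹' B = ⋃ i, {L | idx L = i} ∩ π '' (U i ∩ B) := by
    ext L
    simp only [Set.mem_preimage, Set.mem_iUnion, Set.mem_inter_iff, Set.mem_ofPred_eq]
    constructor
    · intro h
      exact ⟨idx L, rfl, σ L, ⟨hσU L, h⟩, hσ L⟩
    · rintro ⟨i, rfl, x, ⟨hx, hxB⟩, hxL⟩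
      have : σ L = x := hinj _ _ (hσU L) _ hx ((hσ L).trans hxL.symm)
      rwa [this]
  rw [this]
  exact MeasurableSet.iUnion fun i => (hidxm i).inter (hmeas i B hB)

/-- A matrix acts on a tuple of vectors componentwise. -/
def act {m n : ℕ} (M : Matrix (Fin n) (Fin n) ℝ) (x : Fin m → Fin n → ℝ) : Fin m → Fin n → ℝ :=
  fun i => M.mulVec (x i)

theorem continuous_act_uncurry {m n : ℕ} :
    Continuous fun p : (Matrix (Fin n) (Fin n) ℝ) × (Fin m → Fin n → ℝ) => act p.1 p.2 := by
  unfold act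
  refine continuous_pi fun i => ?_
  exact Continuous.matrix_mulVec continuous_fst ((continuous_apply i).comp continuous_snd)

theorem measurable_act {m n : ℕ} (M : Matrix (Fin n) (Fin n) ℝ) :
    Measurable (act (m := m) M) :=
  (continuous_act_uncurry.comp (Continuous.prodMk_right M)).measurable

theorem act_act {m n : ℕ} (M N : Matrix (Fin n) (Fin n) ℝ) (x : Fin m → Fin n → ℝ) :
    act M (act N x) = act (M * N) x := by
  funext i; simp [act]

theorem measurableSet_linearIndependent (m n : ℕ) :
    MeasurableSet {x : Fin m → Fin n → ℝ | LinearIndependent ℝ x} :=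
  (isOpen_setOfPred_linearIndependent).measurableSet

theorem continuous_finCons {m n : ℕ} (e : Fin n → ℝ) :
    Continuous fun x : Fin m → Fin n → ℝ => (Fin.cons e x : Fin (m + 1) → Fin n → ℝ) := by
  refine continuous_pi fun i => ?_
  refine Fin.cases ?_ (fun j => ?_) i
  · simpa using continuous_const
  · simpa using continuous_apply j

section InvariantMeasure

variable {m n : ℕ} {ν : Measure (Fin m → Fin n → ℝ)}

/-- The measure `ν` is invariant under the diagonal action of `SL(n, ℝ)`. -/
def SLInvariant (ν : Measure (Fin m → Fin n → ℝ)) : Prop :=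
  ∀ h : Matrix (Fin n) (Fin n) ℝ, h.det = 1 → ∀ f : (Fin m → Fin n → ℝ) → ℝ≥0∞, Measurable f →
    ∫⁻ x, f (act h x) ∂ν = ∫⁻ x, f x ∂ν

/-- The transformation `1 + e tᵀ`. -/
def transv (e t : Fin n → ℝ) : Matrix (Fin n) (Fin n) ℝ := 1 + Matrix.vecMulVec e t

theorem transv_det (e t : Fin n → ℝ) (h : t ⬝ᵥ e = 0) : (transv e t).det = 1 := by
  have := Matrix.det_one_add_replicateCol_mul_replicateRow (ι := Unit) e t
  rw [h, add_zero] at this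
  rw [transv, Matrix.vecMulVec_eq Unit, this]

theorem transv_mulVec (e t x : Fin n → ℝ) : (transv e t).mulVec x = x + (t ⬝ᵥ x) • e := by
  rw [transv, Matrix.add_mulVec, Matrix.one_mulVec, Matrix.vecMulVec_mulVec]
  simp

theorem transv_act (e t : Fin n → ℝ) (x : Fin m → Fin n → ℝ) :
    act (transv e t) x = fun i => x i + (t ⬝ᵥ x i) • e := by
  funext i; simp [act, transv_mulVec]

theorem measurable_transv_act (e : Fin n → ℝ) :
    Measurable fun p : (Fin n → ℝ) × (Fin m → Fin n → ℝ) => act (transv e p.1) p.2 := by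
  refine Continuous.measurable ?_
  simp only [transv_act]
  refine continuous_pi fun i => ?_
  have h1 : Continuous fun p : (Fin n → ℝ) × (Fin m → Fin n → ℝ) => p.2 i :=
    (continuous_apply i).comp continuous_snd
  exact h1.add ((continuous_fst.dotProduct h1).smul continuous_const)

theorem measurable_transv_single_act (p q : Fin n) :
    Measurable fun z : ℝ × (Fin m → Fin n → ℝ) =>
      act (transv (Pi.single q 1) (Pi.single p z.1)) z.2 := by
  simp only [transv_act, single_dotProduct]
  refine Continuous.measurable (continuous_pi fun i => ?_)
  fun_prop

/-- Almost every tuple has a span not containing a given coordinate vector. -/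
theorem ae_linearIndependent_cons_single [SFinite ν] (hmn : m < n) (hν : SLInvariant ν)
    (hind : ∀ᵐ x ∂ν, LinearIndependent ℝ x) (p : Fin n) :
    ∀ᵐ x ∂ν, LinearIndependent ℝ (Fin.cons (Pi.single p (1 : ℝ)) x : Fin (m + 1) → Fin n → ℝ) := by
  let G : Fin n → Set (Fin m → Fin n → ℝ) := fun q =>
    {x | LinearIndependent ℝ (Fin.cons (Pi.single q (1 : ℝ)) x : Fin (m + 1) → Fin n → ℝ)}
  have hG : ∀ q, MeasurableSet (G q) := fun q =>
    ((isOpen_setOfPred_linearIndependent).preimage (continuous_finCons _)).measurableSet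
  have hGiff : ∀ q x, x ∈ G q ↔ LinearIndependent ℝ x ∧
      Pi.single q (1 : ℝ) ∉ Submodule.span ℝ (Set.range x) := fun q x => by
    simp only [G, Set.mem_ofPred_eq]; exact linearIndependent_finCons
  let Z : Fin n → Set (Fin m → Fin n → ℝ) := fun q => (G p)ᶜ ∩ G q
  have hZ : ∀ q, ν (Z q) = 0 := by
    intro q
    by_cases hpq : q = p
    · subst hpq; simp [Z]
    have hZm : MeasurableSet (Z q) := (hG p).compl.inter (hG q)
    let u : ℝ → (Fin m → Fin n → ℝ) → (Fin m → Fin n → ℝ) := fun s =>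
      act (transv (Pi.single q 1) (Pi.single p s))
    have hum : Measurable fun z : ℝ × (Fin m → Fin n → ℝ) => u z.1 z.2 :=
      measurable_transv_single_act p q
    have h1 : ∀ s, ∫⁻ x, (Z q).indicator 1 (u s x) ∂ν = ν (Z q) := by
      intro s
      have h2 := hν (transv (Pi.single q 1) (Pi.single p s))
        (transv_det _ _ (by simp [hpq]))
        ((Z q).indicator 1) (measurable_one.indicator hZm)
      rw [lintegral_indicator_one hZm] at h2
      exact h2
    have h2 : ∫⁻ s : ℝ, ∫⁻ x, (Z q).indicator 1 (u s x) ∂ν = ∫⁻ x, (∫⁻ s : ℝ,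
        (Z q).indicator 1 (u s x)) ∂ν := by
      refine lintegral_lintegral_swap ?_
      exact ((measurable_one.indicator hZm).comp hum).aemeasurable
    have h3 : ∀ x, ∫⁻ s : ℝ, (Z q).indicator (1 : (Fin m → Fin n → ℝ) → ℝ≥0∞) (u s x) = 0 := by
      intro x
      have hux : ∀ s i, u s x i = x i + (s * x i p) • Pi.single q 1 := by
        intro s i
        simp only [u, transv_act, single_dotProduct]
      have h4 : ({s | u s x ∈ Z q} : Set ℝ).Subsingleton := by
        intro s hs s' hs'
        by_contra hne
        obtain ⟨hs1, hs2⟩ := hs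
        obtain ⟨hs1', hs2'⟩ := hs'
        rw [hGiff] at hs2 hs2'
        rw [Set.mem_compl_iff, hGiff] at hs1 hs1'
        simp only [hs2.1, hs2'.1, true_and, not_not] at hs1 hs1'
        obtain ⟨c, hc⟩ := (Submodule.mem_span_range_iff_exists_fun ℝ).1 hs1
        obtain ⟨c', hc'⟩ := (Submodule.mem_span_range_iff_exists_fun ℝ).1 hs1'
        have hp : (∑ i, c i * x i p) = 1 := by
          have := congrFun hc p
          simpa [hux, Finset.sum_apply, hpq, Ne.symm hpq] using this
        have key : Pi.single q (1 : ℝ) = (s' - s)⁻¹ • (∑ i, c i • u s' x i - Pi.single p 1) := by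
          rw [← hc]
          simp only [hux, ← Finset.sum_sub_distrib, ← smul_sub]
          have : ∀ i, c i • ((x i + (s' * x i p) • (Pi.single q 1 : Fin n → ℝ))
              - (x i + (s * x i p) • Pi.single q 1)) =
              ((s' - s) * (c i * x i p)) • Pi.single q 1 := by
            intro i
            rw [add_sub_add_left_eq_sub, ← sub_smul, smul_smul]
            congr 1; ring
          simp only [this]
          rw [← Finset.sum_smul, ← Finset.mul_sum, hp, smul_smul, mul_one,
            inv_mul_cancel₀ (sub_ne_zero.2 (Ne.symm hne)), one_smul]
        apply hs2'.2
        rw [key]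
        refine Submodule.smul_mem _ _ (Submodule.sub_mem _ ?_ hs1')
        exact Submodule.sum_mem _ fun i _ => Submodule.smul_mem _ _
          (Submodule.subset_span (Set.mem_range_self i))
      have h5 : (fun s : ℝ => (Z q).indicator (1 : (Fin m → Fin n → ℝ) → ℝ≥0∞) (u s x))
          = ({s | u s x ∈ Z q} : Set ℝ).indicator 1 := by
        funext s; simp [Set.indicator]
      rw [h5, lintegral_indicator_one h4.measurableSet]
      exact h4.measure_zero _
    simp only [h1, h3, lintegral_const] at h2
    simpa using h2
  have hsub : ∀ x, LinearIndependent ℝ x → (∀ q, x ∉ Z q) → x ∈ G p := by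
    intro x hx hq
    by_contra hp
    have hall : ∀ q, Pi.single q (1 : ℝ) ∈ Submodule.span ℝ (Set.range x) := by
      intro q
      by_contra h
      exact hq q ⟨hp, (hGiff q x).2 ⟨hx, h⟩⟩
    have htop : Submodule.span ℝ (Set.range x) = ⊤ := by
      rw [eq_top_iff]
      intro y _
      rw [pi_eq_sum_univ' y]
      exact Submodule.sum_mem _ fun q _ => Submodule.smul_mem _ _
        (by convert hall q using 1)
    have h1 := finrank_span_eq_card hx
    rw [htop, finrank_top] at h1
    simp at h1
    omega
  have hae : ∀ᵐ x ∂ν, ∀ q, x ∉ Z q := ae_all_iff.2 fun q => measure_eq_zero_iff_ae_notMem.1 (hZ q)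
  filter_upwards [hind, hae] with x h1 h2 using hsub x h1 h2

/-- The projection of all vectors along the coordinate direction `p`. -/
def dropCoord (p : Fin n) (x : Fin m → Fin n → ℝ) : Matrix (Fin m) (Fin n) ℝ :=
  Matrix.of fun i j => if j = p then 0 else x i j

/-- A vector `t`, depending only on the projection of `x` along `p`, with `t ⬝ᵥ z i = c i`
for the projected vectors `z i`. -/
def dualVec (p : Fin n) (c : Fin m → ℝ) (x : Fin m → Fin n → ℝ) : Fin n → ℝ :=
  Matrix.vecMul (((dropCoord p x) * (dropCoord p x).transpose)⁻¹.mulVec c) (dropCoord p x)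

theorem measurable_dualVec (p : Fin n) (c : Fin m → ℝ) : Measurable (dualVec p c) := by
  have hd : Continuous (dropCoord (m := m) p) := by
    refine continuous_matrix fun i j => ?_
    by_cases h : j = p
    · simp [dropCoord, h, continuous_const]
    · simp only [dropCoord, Matrix.of_apply, h, if_false]; fun_prop
  have hK : Continuous fun x : Fin m → Fin n → ℝ =>
      (dropCoord p x) * (dropCoord p x).transpose := hd.matrix_mul hd.matrix_transpose
  have he : dualVec p c = fun x : Fin m → Fin n → ℝ =>
      Ring.inverse ((dropCoord p x) * (dropCoord p x).transpose).det •
      Matrix.vecMul ((((dropCoord p x) * (dropCoord p x).transpose).adjugate).mulVec c)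
        (dropCoord p x) := by
    funext x
    rw [dualVec, Matrix.inv_def, Matrix.smul_mulVec, Matrix.smul_vecMul]
  rw [he]
  simp only [Ring.inverse_eq_inv']
  refine Measurable.smul (hK.matrix_det.measurable.inv) (Continuous.measurable ?_)
  exact Continuous.matrix_vecMul (hK.matrix_adjugate.matrix_mulVec continuous_const) hd

theorem dualVec_apply_self (p : Fin n) (c : Fin m → ℝ) (x : Fin m → Fin n → ℝ) :
    dualVec p c x p = 0 := by
  simp [dualVec, Matrix.vecMul, dotProduct, dropCoord]

theorem dropCoord_mulVec_dualVec (p : Fin n) (c : Fin m → ℝ) (x : Fin m → Fin n → ℝ)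
    (hx : LinearIndependent ℝ (Fin.cons (Pi.single p (1 : ℝ)) x : Fin (m + 1) → Fin n → ℝ)) :
    (dropCoord p x).mulVec (dualVec p c x) = c := by
  have hdet : IsUnit ((dropCoord p x) * (dropCoord p x).transpose).det := by
    rw [isUnit_iff_ne_zero]
    intro h0
    obtain ⟨v, hv0, hv⟩ := Matrix.exists_mulVec_eq_zero_iff.2 h0
    have h1 : Matrix.vecMul v (dropCoord p x) = 0 := by
      rw [← Matrix.mulVec_transpose, ← dotProduct_self_eq_zero]
      rw [← Matrix.mulVec_mulVec] at hv
      rw [Matrix.dotProduct_mulVec, ← Matrix.mulVec_transpose, Matrix.transpose_transpose, hv,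
        zero_dotProduct]
    rw [Fintype.linearIndependent_iff] at hx
    have := hx (Fin.cons (-∑ i, v i * x i p) v) (by
      rw [Fin.sum_univ_succ]
      simp only [Fin.cons_zero, Fin.cons_succ]
      funext j
      have hj := congrFun h1 j
      simp only [Matrix.vecMul, dotProduct, dropCoord, Matrix.of_apply, Pi.zero_apply] at hj
      simp only [Pi.add_apply, Pi.smul_apply, smul_eq_mul, Finset.sum_apply, Pi.zero_apply]
      by_cases hjp : j = p
      · subst hjp; simp
      · simp only [hjp, if_false] at hj
        simp [hjp, hj])
    apply hv0
    funext i
    simpa using this i.succ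
  rw [dualVec, ← Matrix.mulVec_transpose, Matrix.mulVec_mulVec, Matrix.mulVec_mulVec,
    Matrix.mul_nonsing_inv _ hdet, Matrix.one_mulVec]

theorem dropCoord_mulVec (p : Fin n) (x : Fin m → Fin n → ℝ) (t : Fin n → ℝ) (ht : t p = 0)
    (i : Fin m) : (dropCoord p x).mulVec t i = t ⬝ᵥ x i := by
  simp only [Matrix.mulVec, dotProduct, dropCoord, Matrix.of_apply]
  refine Finset.sum_congr rfl fun j _ => ?_
  by_cases h : j = p
  · subst h; simp [ht]
  · simp [h, mul_comm]

theorem dualVec_transv (p : Fin n) (c : Fin m → ℝ) (x : Fin m → Fin n → ℝ) (t : Fin n → ℝ) :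
    dualVec p c (act (transv (Pi.single p 1) t) x) = dualVec p c x := by
  have : dropCoord p (act (transv (Pi.single p 1) t) x) = dropCoord p x := by
    ext i j
    by_cases h : j = p
    · simp [dropCoord, h]
    · simp [dropCoord, h, transv_act]
  rw [dualVec, this, dualVec]

theorem act_dualVec (p : Fin n) (c : Fin m → ℝ) (x : Fin m → Fin n → ℝ)
    (hx : LinearIndependent ℝ (Fin.cons (Pi.single p (1 : ℝ)) x : Fin (m + 1) → Fin n → ℝ)) :
    act (transv (Pi.single p 1) (dualVec p c x)) x = x + fun i => Pi.single p (c i) := by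
  rw [transv_act]
  funext i
  rw [← dropCoord_mulVec p x _ (dualVec_apply_self p c x), dropCoord_mulVec_dualVec p c x hx,
    Pi.add_apply, ← Pi.single_smul, smul_eq_mul, mul_one]

/-- Setting one coordinate to zero. -/
def zeroAt (p : Fin n) (t : Fin n → ℝ) : Fin n → ℝ := fun j => if j = p then 0 else t j

theorem act_transv_add (p : Fin n) (s t : Fin n → ℝ) (hs : s p = 0) (x : Fin m → Fin n → ℝ) :
    act (transv (Pi.single p 1) s) (act (transv (Pi.single p 1) t) x) =
      act (transv (Pi.single p 1) (s + t)) x := by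
  funext i
  simp only [transv_act, dotProduct_add, dotProduct_smul, dotProduct_single, hs, add_dotProduct]
  simp only [add_smul, zero_mul, smul_zero, add_zero]
  rw [add_assoc, add_comm (_ • _) (_ • _)]

/-- If `ν` is invariant under the flow `u (z s)`, then it is invariant under the
transformation `x ↦ u (t x) x` whenever `t` is an invariant function. -/
theorem lintegral_flow_eq {X : Type*} [MeasurableSpace X] {ν : Measure X} [SFinite ν]
    (u : (Fin n → ℝ) → X → X) (hum : Measurable fun q : (Fin n → ℝ) × X => u q.1 q.2)
    (z : (Fin n → ℝ) → (Fin n → ℝ)) (hzm : Measurable z) (t : X → Fin n → ℝ) (htm : Measurable t)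
    (hinv : ∀ s, ∀ F : X → ℝ≥0∞, Measurable F → ∫⁻ x, F (u (z s) x) ∂ν = ∫⁻ x, F x ∂ν)
    (htu : ∀ s x, t (u (z s) x) = t x)
    (huu : ∀ s x, u (t x) (u (z s) x) = u (z (t x + s)) x)
    (f : X → ℝ≥0∞) (hf : Measurable f) :
    ∫⁻ x, f (u (t x) x) ∂ν = ∫⁻ x, f x ∂ν := by
  obtain ⟨ψ, hψm, hψ⟩ : ∃ ψ : (Fin n → ℝ) → ℝ≥0∞, Measurable ψ ∧ ∫⁻ s, ψ s = 1 := by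
    refine ⟨(Set.univ.pi fun _ => Set.Icc (0 : ℝ) 1).indicator 1,
      measurable_one.indicator (MeasurableSet.univ_pi fun _ => measurableSet_Icc), ?_⟩
    rw [lintegral_indicator_one (MeasurableSet.univ_pi fun _ => measurableSet_Icc), volume_pi_pi]
    simp
  have step2 : ∀ s, ∫⁻ x, f (u (t x) x) ∂ν = ∫⁻ x, f (u (z (t x + s)) x) ∂ν := by
    intro s
    have := hinv s (fun x => f (u (t x) x)) (hf.comp (hum.comp (htm.prodMk measurable_id)))
    rw [← this]
    refine lintegral_congr fun x => ?_
    rw [htu, huu]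
  have step3 : ∀ x, ∫⁻ s, ψ s * f (u (z (t x + s)) x) = ∫⁻ s, ψ (s - t x) * f (u (z s) x) := by
    intro x
    have := lintegral_add_left_eq_self (μ := (volume : Measure (Fin n → ℝ)))
      (fun s => ψ (s - t x) * f (u (z s) x)) (t x)
    rw [← this]
    simp
  have step4 : ∀ s, ∫⁻ x, ψ (s - t x) * f (u (z s) x) ∂ν = ∫⁻ x, ψ (s - t x) * f x ∂ν := by
    intro s
    have := hinv s (fun x => ψ (s - t x) * f x)
      ((hψm.comp (measurable_const.sub htm)).mul hf)
    rw [← this]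
    simp only [htu]
  have m1 : Measurable fun q : (Fin n → ℝ) × X => ψ q.1 * f (u (z (t q.2 + q.1)) q.2) :=
    (hψm.comp measurable_fst).mul (hf.comp (hum.comp ((hzm.comp
      ((htm.comp measurable_snd).add measurable_fst)).prodMk measurable_snd)))
  have m2 : Measurable fun q : (Fin n → ℝ) × X => ψ (q.1 - t q.2) * f (u (z q.1) q.2) :=
    (hψm.comp (measurable_fst.sub (htm.comp measurable_snd))).mul
      (hf.comp (hum.comp ((hzm.comp measurable_fst).prodMk measurable_snd)))
  have m3 : Measurable fun q : (Fin n → ℝ) × X => ψ (q.1 - t q.2) * f q.2 :=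
    (hψm.comp (measurable_fst.sub (htm.comp measurable_snd))).mul (hf.comp measurable_snd)
  calc ∫⁻ x, f (u (t x) x) ∂ν
      = ∫⁻ s, ψ s * ∫⁻ x, f (u (t x) x) ∂ν := by
        rw [lintegral_mul_const _ hψm, hψ, one_mul]
    _ = ∫⁻ s, ∫⁻ x, ψ s * f (u (z (t x + s)) x) ∂ν := by
        refine lintegral_congr fun s => ?_
        have h : Measurable fun x => f (u (z (t x + s)) x) := hf.comp (hum.comp ((hzm.comp
          (htm.add measurable_const)).prodMk measurable_id))
        rw [step2 s, lintegral_const_mul _ h]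
    _ = ∫⁻ x, (∫⁻ s, ψ s * f (u (z (t x + s)) x)) ∂ν :=
        lintegral_lintegral_swap m1.aemeasurable
    _ = ∫⁻ x, (∫⁻ s, ψ (s - t x) * f (u (z s) x)) ∂ν := by simp only [step3]
    _ = ∫⁻ s, ∫⁻ x, ψ (s - t x) * f (u (z s) x) ∂ν :=
        (lintegral_lintegral_swap m2.aemeasurable).symm
    _ = ∫⁻ s, ∫⁻ x, ψ (s - t x) * f x ∂ν := by simp only [step4]
    _ = ∫⁻ x, (∫⁻ s, ψ (s - t x) * f x) ∂ν := lintegral_lintegral_swap m3.aemeasurable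
    _ = ∫⁻ x, f x ∂ν := by
        refine lintegral_congr fun x => ?_
        have h : Measurable fun s => ψ (s - t x) := hψm.comp (measurable_id.sub measurable_const)
        rw [lintegral_mul_const _ h,
          lintegral_sub_right_eq_self ψ (t x), hψ, one_mul]

theorem lintegral_add_single [SFinite ν] (hmn : m < n) (hν : SLInvariant ν)
    (hind : ∀ᵐ x ∂ν, LinearIndependent ℝ x) (p : Fin n) (c : Fin m → ℝ)
    (f : (Fin m → Fin n → ℝ) → ℝ≥0∞) (hf : Measurable f) :
    ∫⁻ x, f (x + fun i => Pi.single p (c i)) ∂ν = ∫⁻ x, f x ∂ν := by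
  have hzp : ∀ s, zeroAt p s p = 0 := fun s => by simp [zeroAt]
  have hzm : Measurable (zeroAt p) := by
    refine measurable_pi_lambda _ fun j => ?_
    by_cases h : j = p
    · simp [zeroAt, h]
    · simpa [zeroAt, h] using measurable_pi_apply j
  have hz_add : ∀ s (x : Fin m → Fin n → ℝ),
      zeroAt p (dualVec p c x + s) = dualVec p c x + zeroAt p s := by
    intro s x; funext j
    by_cases h : j = p
    · subst h; simp [zeroAt, dualVec_apply_self]
    · simp [zeroAt, h]
  rw [← lintegral_flow_eq (fun s => act (transv (Pi.single p 1) s)) (measurable_transv_act _)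
    (zeroAt p) hzm (dualVec p c) (measurable_dualVec p c)
    (fun s F hF => hν _ (transv_det _ _ (by simp [hzp])) F hF)
    (fun s x => dualVec_transv p c x _)
    (fun s x => by rw [act_transv_add p _ _ (dualVec_apply_self p c x), hz_add]) f hf]
  refine lintegral_congr_ae ?_
  filter_upwards [ae_linearIndependent_cons_single hmn hν hind p] with x hx
  rw [act_dualVec p c x hx]

/-- Uniqueness of translation-invariant s-finite measures, in integrated form. -/
theorem lintegral_mul_lintegral_swap {X : Type*} [MeasurableSpace X] [AddCommGroup X]
    [MeasurableAdd₂ X] [MeasurableNeg X] {ν ρ : Measure X} [SFinite ν] [SFinite ρ]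
    (hν : ∀ (y : X) (f : X → ℝ≥0∞), Measurable f → ∫⁻ x, f (x + y) ∂ν = ∫⁻ x, f x ∂ν)
    (hρ : ∀ (y : X) (f : X → ℝ≥0∞), ∫⁻ x, f (x + y) ∂ρ = ∫⁻ x, f x ∂ρ)
    {f g : X → ℝ≥0∞} (hf : Measurable f) (hg : Measurable g) [ρ.IsNegInvariant] :
    (∫⁻ x, f x ∂ν) * ∫⁻ y, g y ∂ρ = (∫⁻ x, g x ∂ν) * ∫⁻ y, f y ∂ρ := by
  have m1 : Measurable fun q : X × X => f q.1 * g (q.2 + q.1) :=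
    (hf.comp measurable_fst).mul (hg.comp (measurable_snd.add measurable_fst))
  have m2 : Measurable fun q : X × X => f (q.1 + -q.2) * g q.1 :=
    (hf.comp (measurable_fst.add measurable_snd.neg)).mul (hg.comp measurable_fst)
  calc (∫⁻ x, f x ∂ν) * ∫⁻ y, g y ∂ρ
      = ∫⁻ x, (∫⁻ y, f x * g (y + x) ∂ρ) ∂ν := by
        rw [← lintegral_mul_const _ hf]
        refine lintegral_congr fun x => ?_
        have h : Measurable fun y => g (y + x) := hg.comp (measurable_id.add measurable_const)
        rw [lintegral_const_mul _ h, hρ]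
    _ = ∫⁻ y, (∫⁻ x, f x * g (y + x) ∂ν) ∂ρ := lintegral_lintegral_swap m1.aemeasurable
    _ = ∫⁻ y, (∫⁻ x, f (x + -y) * g x ∂ν) ∂ρ := by
        refine lintegral_congr fun y => ?_
        have h : Measurable fun x => f x * g (y + x) :=
          hf.mul (hg.comp (measurable_const.add measurable_id))
        rw [← hν (-y) _ h]
        refine lintegral_congr fun x => ?_
        congr 2; abel
    _ = ∫⁻ x, (∫⁻ y, f (x + -y) * g x ∂ρ) ∂ν := (lintegral_lintegral_swap m2.aemeasurable).symm
    _ = (∫⁻ x, g x ∂ν) * ∫⁻ y, f y ∂ρ := by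
        rw [← lintegral_mul_const _ hg]
        refine lintegral_congr fun x => ?_
        have h : Measurable fun y => f (x + -y) := hf.comp (measurable_const.add measurable_neg)
        rw [lintegral_mul_const _ h, mul_comm]
        congr 1
        rw [← hρ x f, ← lintegral_neg_eq_self]
        refine lintegral_congr fun y => ?_
        rw [neg_neg, add_comm]

/-- An `SL(n, ℝ)`-invariant s-finite measure on tuples of fewer than `n` vectors, which is
concentrated on independent tuples, is a multiple of Lebesgue measure. -/
theorem exists_eq_smul_volume [SFinite ν] (hmn : m < n) (hν : SLInvariant ν)
    (hind : ∀ᵐ x ∂ν, LinearIndependent ℝ x) : ∃ c : ℝ≥0∞, ν = c • volume := by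
  have htrans : ∀ (F : Finset (Fin n)) (y : Fin m → Fin n → ℝ)
      (f : (Fin m → Fin n → ℝ) → ℝ≥0∞), Measurable f →
      ∫⁻ x, f (x + ∑ p ∈ F, fun i => Pi.single p (y i p)) ∂ν = ∫⁻ x, f x ∂ν := by
    intro F y
    induction F using Finset.induction_on with
    | empty => intro f _; simp
    | insert p F hp ih =>
      intro f hf
      have h1 := ih (fun x => f (x + fun i => Pi.single p (y i p)))
        (hf.comp (measurable_id.add_const _))
      rw [lintegral_add_single hmn hν hind p (fun i => y i p) f hf] at h1
      rw [← h1]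
      refine lintegral_congr fun x => ?_
      rw [Finset.sum_insert hp, add_assoc, add_comm (∑ p ∈ F, fun i => Pi.single p (y i p))]
  have hsum : ∀ y : Fin m → Fin n → ℝ, (∑ p, fun i => Pi.single p (y i p)) = y := by
    intro y; funext i j
    simp [Finset.sum_apply, Pi.single_apply]
  have hadd : ∀ (y : Fin m → Fin n → ℝ) (f : (Fin m → Fin n → ℝ) → ℝ≥0∞), Measurable f →
      ∫⁻ x, f (x + y) ∂ν = ∫⁻ x, f x ∂ν := fun y f hf => by
    have h := htrans Finset.univ y f hf
    rwa [hsum] at h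
  let B : Set (Fin m → Fin n → ℝ) := Set.univ.pi fun _ => Set.univ.pi fun _ => Set.Icc (0 : ℝ) 1
  have hB : MeasurableSet B :=
    MeasurableSet.univ_pi fun _ => MeasurableSet.univ_pi fun _ => measurableSet_Icc
  have hvol : volume B = 1 := by
    simp only [B, volume_pi_pi, Real.volume_Icc, sub_zero, ENNReal.ofReal_one,
      Finset.prod_const_one]
  refine ⟨ν B, ?_⟩
  ext E hE
  have mE : Measurable (E.indicator (1 : (Fin m → Fin n → ℝ) → ℝ≥0∞)) :=
    measurable_one.indicator hE
  have mB : Measurable (B.indicator (1 : (Fin m → Fin n → ℝ) → ℝ≥0∞)) :=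
    measurable_one.indicator hB
  have h := lintegral_mul_lintegral_swap (ν := ν) (ρ := volume) hadd
    (fun y f => lintegral_add_right_eq_self f y) mE mB
  rw [lintegral_indicator_one hE, lintegral_indicator_one hB, lintegral_indicator_one hE,
    lintegral_indicator_one hB, hvol, mul_one] at h
  rw [h, Measure.smul_apply, smul_eq_mul]

end InvariantMeasure

/-- The real tuple underlying an integer tuple. -/
def icast {m n : ℕ} (v : Fin m → Fin n → ℤ) : Fin m → Fin n → ℝ := fun i j => (v i j : ℝ)

/-- A set of integer tuples is invariant under the diagonal action of `SL(n, ℤ)`. -/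
def SLZInvariant {m n : ℕ} (O : Set (Fin m → Fin n → ℤ)) : Prop :=
  ∀ γ : Matrix.SpecialLinearGroup (Fin n) ℤ, ∀ v ∈ O, (fun i => γ.1.mulVec (v i)) ∈ O

/-- A random unimodular matrix `g` whose associated random lattice `g ℤⁿ` has an
`SL(n, ℝ)`-invariant law. -/
structure IsInvariantFrame {X : Type*} [MeasurableSpace X] {n : ℕ} (μ : Measure X)
    (g : X → Matrix (Fin n) (Fin n) ℝ) : Prop where
  measurable : ∀ i j, Measurable fun L => g L i j
  det_eq_one : ∀ L, (g L).det = 1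
  lintegral_eq : ∀ (m : ℕ) (O : Set (Fin m → Fin n → ℤ)), SLZInvariant O →
    ∀ h : Matrix (Fin n) (Fin n) ℝ, h.det = 1 →
    ∀ f : (Fin m → Fin n → ℝ) → ℝ≥0∞, Measurable f →
    ∫⁻ L, ∑' v : O, f (act h (act (g L) (icast v.1))) ∂μ =
      ∫⁻ L, ∑' v : O, f (act (g L) (icast v.1)) ∂μ

theorem icast_mulVec {m n : ℕ} (γ : Matrix.SpecialLinearGroup (Fin n) ℤ) (v : Fin m → Fin n → ℤ) :
    icast (fun i => γ.1.mulVec (v i)) =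
      act (Matrix.SpecialLinearGroup.map (Int.castRingHom ℝ) γ).1 (icast v) := by
  funext i j
  simp [icast, act, Matrix.mulVec, dotProduct]

/-- The action of `SL(n, ℤ)` on an invariant set of tuples, as a permutation. -/
def SLZInvariant.perm {m n : ℕ} {O : Set (Fin m → Fin n → ℤ)} (hO : SLZInvariant O)
    (γ : Matrix.SpecialLinearGroup (Fin n) ℤ) : O ≃ O where
  toFun v := ⟨fun i => γ.1.mulVec (v.1 i), hO γ _ v.2⟩
  invFun v := ⟨fun i => (γ⁻¹).1.mulVec (v.1 i), hO γ⁻¹ _ v.2⟩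
  left_inv v := by
    ext1; funext i
    have h : (γ⁻¹).1 * γ.1 = 1 := by
      rw [← Matrix.SpecialLinearGroup.coe_mul, inv_mul_cancel, Matrix.SpecialLinearGroup.coe_one]
    simp only [Matrix.mulVec_mulVec, h, Matrix.one_mulVec]
  right_inv v := by
    ext1; funext i
    have h : γ.1 * (γ⁻¹).1 = 1 := by
      rw [← Matrix.SpecialLinearGroup.coe_mul, mul_inv_cancel, Matrix.SpecialLinearGroup.coe_one]
    simp only [Matrix.mulVec_mulVec, h, Matrix.one_mulVec]

theorem SLZInvariant.tsum_act {m n : ℕ} {O : Set (Fin m → Fin n → ℤ)} (hO : SLZInvariant O)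
    (A B : SLR n) (hAB : QuotientGroup.mk (s := SLZ n) A = QuotientGroup.mk (s := SLZ n) B)
    (f : (Fin m → Fin n → ℝ) → ℝ≥0∞) :
    ∑' v : O, f (act A.1 (icast v.1)) = ∑' v : O, f (act B.1 (icast v.1)) := by
  obtain ⟨γ, hγ⟩ : A⁻¹ * B ∈ SLZ n := QuotientGroup.eq.1 hAB
  have hB : B = A * Matrix.SpecialLinearGroup.map (Int.castRingHom ℝ) γ := by
    rw [hγ, mul_inv_cancel_left]
  rw [hB, ← (hO.perm γ).tsum_eq]
  refine tsum_congr fun v => ?_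
  rw [Matrix.SpecialLinearGroup.coe_mul, ← act_act, ← icast_mulVec]
  rfl

section Frame

variable {X : Type*} [MeasurableSpace X] {m n : ℕ} {μ : Measure X}
  {g : X → Matrix (Fin n) (Fin n) ℝ}

theorem measurable_act_icast (hg : ∀ i j, Measurable fun L => g L i j) (v : Fin m → Fin n → ℤ) :
    Measurable fun L => act (g L) (icast v) := by
  refine measurable_pi_lambda _ fun i => measurable_pi_lambda _ fun j => ?_
  simp only [act, Matrix.mulVec, dotProduct]
  exact Finset.measurable_sum _ fun k _ => (hg j k).mul_const _

theorem exists_isInvariantFrame (n : ℕ) (μ : Measure (LatticeSpace n)) [IsProbabilityMeasure μ]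
    (hμ : ∀ g : SLR n, Measure.map (fun x => g • x) μ = μ) :
    ∃ g : LatticeSpace n → Matrix (Fin n) (Fin n) ℝ, IsInvariantFrame μ g ∧
      ∀ L, latticeOf L = {y | ∃ v : Fin n → ℤ, y = (g L).mulVec fun i => (v i : ℝ)} := by
  obtain ⟨σ, hσ, hσm⟩ := exists_borel_section n
  have hm : ∀ i j, Measurable fun L => (σ L).1 i j := by
    intro i j
    refine measurable_of_isOpen fun U hU => ?_
    refine hσm ((fun g : SLR n => g.1 i j) ⁻¹' U) (hU.preimage ?_)
    exact Continuous.matrix_elem continuous_induced_dom i j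
  refine ⟨fun L => (σ L).1, ⟨hm, fun L => (σ L).2, ?_⟩, ?_⟩
  · intro m O hO h hh f hf
    let h' : SLR n := ⟨h, hh⟩
    have hms : Measurable fun L => ∑' v : O, f (act (σ L).1 (icast v.1)) :=
      Measurable.tsum fun v => hf.comp (measurable_act_icast hm v.1)
    have hae : AEMeasurable (fun x : LatticeSpace n => h' • x) μ := by
      by_contra hcon
      have h0 := hμ h'
      rw [Measure.map_of_not_aemeasurable hcon] at h0
      exact IsProbabilityMeasure.ne_zero μ h0.symm
    have key : ∫⁻ L, ∑' v : O, f (act (σ L).1 (icast v.1)) ∂μ =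
        ∫⁻ L, ∑' v : O, f (act (σ (h' • L)).1 (icast v.1)) ∂μ := by
      conv_lhs => rw [← hμ h']
      exact lintegral_map' hms.aemeasurable hae
    rw [key]
    refine lintegral_congr fun L => ?_
    have h1 := hO.tsum_act (h' * σ L) (σ (h' • L)) (by
      rw [hσ]
      conv_rhs => rw [← hσ L]
      rfl) f
    rw [← h1]
    refine tsum_congr fun v => ?_
    rw [act_act, Matrix.SpecialLinearGroup.coe_mul]
  · intro L
    have hL : QuotientGroup.mk (s := SLZ n) (Quotient.out (α := SLR n) L) =
        QuotientGroup.mk (s := SLZ n) (σ L) := by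
      rw [hσ]; exact Quotient.out_eq (s := QuotientGroup.leftRel (SLZ n)) L
    obtain ⟨γ, hγ⟩ : (Quotient.out (α := SLR n) L)⁻¹ * σ L ∈ SLZ n := QuotientGroup.eq.1 hL
    have hB : σ L = Quotient.out (α := SLR n) L *
        Matrix.SpecialLinearGroup.map (Int.castRingHom ℝ) γ := by
      rw [hγ, mul_inv_cancel_left]
    have hA : Quotient.out (α := SLR n) L = σ L *
        Matrix.SpecialLinearGroup.map (Int.castRingHom ℝ) γ⁻¹ := by
      rw [hB, map_inv, mul_inv_cancel_right]
    have hcast : ∀ (δ : Matrix.SpecialLinearGroup (Fin n) ℤ) (v : Fin n → ℤ),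
        (Matrix.SpecialLinearGroup.map (Int.castRingHom ℝ) δ).1.mulVec (fun i => (v i : ℝ)) =
          fun i => ((δ.1.mulVec v i : ℤ) : ℝ) := by
      intro δ v; funext j; simp [Matrix.mulVec, dotProduct]
    ext y
    constructor
    · rintro ⟨v, rfl⟩
      refine ⟨(γ⁻¹).1.mulVec v, ?_⟩
      rw [hA, Matrix.SpecialLinearGroup.coe_mul, ← Matrix.mulVec_mulVec, hcast]
    · rintro ⟨v, rfl⟩
      refine ⟨γ.1.mulVec v, ?_⟩
      dsimp only
      rw [hB, Matrix.SpecialLinearGroup.coe_mul, ← Matrix.mulVec_mulVec, hcast]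

/-- The intensity measure of the tuples `g v`, `v ∈ O`. -/
def hitMeasure (μ : Measure X) (g : X → Matrix (Fin n) (Fin n) ℝ) (O : Set (Fin m → Fin n → ℤ)) :
    Measure (Fin m → Fin n → ℝ) :=
  Measure.sum fun v : O => μ.map fun L => act (g L) (icast v.1)

instance [SFinite μ] (O : Set (Fin m → Fin n → ℤ)) : SFinite (hitMeasure μ g O) := by
  unfold hitMeasure; infer_instance

theorem lintegral_hitMeasure (hg : IsInvariantFrame μ g) (O : Set (Fin m → Fin n → ℤ))
    {f : (Fin m → Fin n → ℝ) → ℝ≥0∞} (hf : Measurable f) :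
    ∫⁻ x, f x ∂(hitMeasure μ g O) = ∫⁻ L, ∑' v : O, f (act (g L) (icast v.1)) ∂μ := by
  have h : ∀ v : O, Measurable fun L => f (act (g L) (icast v.1)) := fun v =>
    hf.comp (measurable_act_icast hg.measurable v.1)
  rw [hitMeasure, lintegral_sum_measure, lintegral_tsum fun v => (h v).aemeasurable]
  refine tsum_congr fun v => ?_
  rw [lintegral_map hf (measurable_act_icast hg.measurable v.1)]

theorem act_linearIndependent {M : Matrix (Fin n) (Fin n) ℝ} (hM : M.det = 1)
    {x : Fin m → Fin n → ℝ} (hx : LinearIndependent ℝ x) : LinearIndependent ℝ (act M x) := by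
  have hinj : Function.Injective M.mulVec := by
    refine Matrix.mulVec_injective_of_isUnit ?_
    rw [Matrix.isUnit_iff_isUnit_det, hM]; exact isUnit_one
  exact hx.map' M.mulVecLin (LinearMap.ker_eq_bot.2 hinj)

/-- The value of `hitMeasure` on the unit cube, i.e. its density when it is a multiple of Lebesgue
measure. -/
def rogersConst (μ : Measure X) (g : X → Matrix (Fin n) (Fin n) ℝ) (O : Set (Fin m → Fin n → ℤ)) :
    ℝ≥0∞ :=
  hitMeasure μ g O (Set.univ.pi fun _ => Set.univ.pi fun _ => Set.Icc (0 : ℝ) 1)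

theorem hitMeasure_eq_smul [SFinite μ] (hg : IsInvariantFrame μ g) (hmn : m < n)
    {O : Set (Fin m → Fin n → ℤ)} (hO : SLZInvariant O)
    (hind : ∀ v ∈ O, LinearIndependent ℝ (icast v)) :
    hitMeasure μ g O = rogersConst μ g O • volume := by
  have hinv : SLInvariant (hitMeasure μ g O) := by
    intro h hh f hf
    rw [lintegral_hitMeasure hg O hf, ← hg.lintegral_eq m O hO h hh f hf]
    exact lintegral_hitMeasure hg O (hf.comp (measurable_act h))
  have hae : ∀ᵐ x ∂(hitMeasure μ g O), LinearIndependent ℝ x := by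
    rw [hitMeasure, Measure.ae_sum_iff]
    · intro v
      rw [ae_map_iff (measurable_act_icast hg.measurable v.1).aemeasurable
        (measurableSet_linearIndependent m n)]
      exact Filter.Eventually.of_forall fun L =>
        act_linearIndependent (hg.det_eq_one L) (hind v.1 v.2)
  obtain ⟨c, hc⟩ := exists_eq_smul_volume hmn hinv hae
  have : rogersConst μ g O = c := by
    rw [rogersConst, hc, Measure.smul_apply]
    simp only [volume_pi_pi, Real.volume_Icc, sub_zero, ENNReal.ofReal_one, Finset.prod_const_one,
      smul_eq_mul, mul_one]
  rw [this, hc]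

theorem lintegral_tsum_eq [SFinite μ] (hg : IsInvariantFrame μ g) (hmn : m < n)
    {O : Set (Fin m → Fin n → ℤ)} (hO : SLZInvariant O)
    (hind : ∀ v ∈ O, LinearIndependent ℝ (icast v))
    {f : (Fin m → Fin n → ℝ) → ℝ≥0∞} (hf : Measurable f) :
    ∫⁻ L, ∑' v : O, f (act (g L) (icast v.1)) ∂μ = rogersConst μ g O * ∫⁻ x, f x := by
  rw [← lintegral_hitMeasure hg O hf, hitMeasure_eq_smul hg hmn hO hind, lintegral_smul_measure,
    smul_eq_mul]

end Frame

section SnocDet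

variable {m : ℕ} {R : Type*} [CommRing R]

/-- The determinant of the matrix with rows `x 0, …, x (m - 1), y`, as a function of `y`. -/
def snocDet (x : Fin m → Fin (m + 1) → R) : (Fin (m + 1) → R) →ₗ[R] R :=
  (Matrix.detRowAlternating (n := Fin (m + 1)) (R := R)).toMultilinearMap.toLinearMap
    (Fin.snoc (α := fun _ => Fin (m + 1) → R) x 0) (Fin.last m)

theorem snocDet_apply (x : Fin m → Fin (m + 1) → R) (y : Fin (m + 1) → R) :
    snocDet x y = (Matrix.of (Fin.snoc (α := fun _ => Fin (m + 1) → R) x y)).det := by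
  rw [snocDet, MultilinearMap.toLinearMap_apply, Fin.update_snoc_last]
  rfl

theorem snocDet_self (x : Fin m → Fin (m + 1) → R) (i : Fin m) : snocDet x (x i) = 0 := by
  rw [snocDet_apply]
  refine Matrix.det_zero_of_row_eq (Fin.castSucc_lt_last i).ne ?_
  funext j
  simp

theorem snocDet_map {S : Type*} [CommRing S] (f : R →+* S) (x : Fin m → Fin (m + 1) → R)
    (y : Fin (m + 1) → R) :
    snocDet (fun i j => f (x i j)) (fun j => f (y j)) = f (snocDet x y) := by
  rw [snocDet_apply, snocDet_apply, RingHom.map_det]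
  congr 1
  ext i j
  refine Fin.lastCases ?_ (fun i => ?_) i <;> simp

theorem snocDet_mulVec (M : Matrix (Fin (m + 1)) (Fin (m + 1)) R) (x : Fin m → Fin (m + 1) → R)
    (y : Fin (m + 1) → R) :
    snocDet (fun i => M.mulVec (x i)) (M.mulVec y) = M.det * snocDet x y := by
  rw [snocDet_apply, snocDet_apply, mul_comm, ← Matrix.det_transpose M, ← Matrix.det_mul]
  congr 1
  ext i j
  refine Fin.lastCases ?_ (fun i => ?_) i
  · simp [Matrix.mul_apply, Matrix.mulVec, dotProduct, mul_comm]
  · simp [Matrix.mul_apply, Matrix.mulVec, dotProduct, mul_comm]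

theorem exists_snocDet_ne_zero {K : Type*} [Field K] {x : Fin m → Fin (m + 1) → K}
    (hx : LinearIndependent K x) : ∃ y, snocDet x y ≠ 0 := by
  have hspan : Submodule.span K (Set.range x) ≠ ⊤ := by
    intro htop
    have h1 := finrank_span_eq_card hx
    rw [htop, finrank_top] at h1
    simp at h1
  obtain ⟨y, hy⟩ : ∃ y, y ∉ Submodule.span K (Set.range x) := by
    by_contra! h
    exact hspan (eq_top_iff.2 fun y _ => h y)
  refine ⟨y, ?_⟩
  have h2 : LinearIndependent K (Fin.snoc (α := fun _ => Fin (m + 1) → K) x y) :=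
    linearIndependent_finSnoc.2 ⟨hx, hy⟩
  have h3 := Matrix.linearIndependent_rows_iff_isUnit
    (A := Matrix.of (Fin.snoc (α := fun _ => Fin (m + 1) → K) x y)).1 h2
  rw [Matrix.isUnit_iff_isUnit_det, isUnit_iff_ne_zero] at h3
  rwa [snocDet_apply]

theorem linearIndependent_of_snocDet_ne_zero {K : Type*} [Field K] {x : Fin m → Fin (m + 1) → K}
    {y : Fin (m + 1) → K} (h : snocDet x y ≠ 0) : LinearIndependent K x := by
  rw [snocDet_apply, ← isUnit_iff_ne_zero, ← Matrix.isUnit_iff_isUnit_det,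
    ← Matrix.linearIndependent_rows_iff_isUnit] at h
  exact (linearIndependent_finSnoc.1 h).1

end SnocDet

section Refine

variable {D n : ℕ}

/-- Parameters of an elementary index-increasing operation on `D`-tuples. -/
abbrev RefineIndex (D : ℕ) := Σ (q : ℕ) (j : Fin D), (Fin j.1 → Fin (q + 2))

/-- Replace the `j`-th entry `w j` of a tuple by `ℓ w j + ∑ i < j, a i w i`, where `ℓ ≥ 2` and
`0 ≤ a i < ℓ`. -/
def refineTuple {V : Type*} [AddCommMonoid V] (s : RefineIndex D) (w : Fin D → V) : Fin D → V :=
  Function.update w s.2.1 ((s.1 + 2) • w s.2.1 +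
    ∑ i : Fin s.2.1.1, (s.2.2 i : ℕ) • w (Fin.castLE s.2.1.2.le i))

theorem refineTuple_map {V W : Type*} [AddCommMonoid V] [AddCommMonoid W] (f : V →+ W)
    (s : RefineIndex D) (w : Fin D → V) :
    (fun i => f (refineTuple s w i)) = refineTuple s fun i => f (w i) := by
  funext i
  by_cases h : i = s.2.1
  · subst h
    simp [refineTuple, map_sum, map_nsmul]
  · simp [refineTuple, h]

theorem act_refineTuple (M : Matrix (Fin n) (Fin n) ℝ) (s : RefineIndex D)
    (x : Fin D → Fin n → ℝ) : act M (refineTuple s x) = refineTuple s (act M x) :=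
  refineTuple_map M.mulVecLin.toAddMonoidHom s x

theorem icast_refineTuple (s : RefineIndex D) (v : Fin D → Fin n → ℤ) :
    icast (refineTuple s v) = refineTuple s (icast v) :=
  refineTuple_map ((Int.castAddHom ℝ).compLeft (Fin n)) s v

theorem mulVec_refineTuple {R : Type*} [CommRing R] (M : Matrix (Fin n) (Fin n) R)
    (s : RefineIndex D) (v : Fin D → Fin n → R) :
    (fun i => M.mulVec (refineTuple s v i)) = refineTuple s fun i => M.mulVec (v i) :=
  refineTuple_map M.mulVecLin.toAddMonoidHom s v

theorem refineTuple_injective {V : Type*} [AddCommGroup V] [IsAddTorsionFree V]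
    (s : RefineIndex D) : Function.Injective (refineTuple (V := V) s) := by
  intro w w' h
  have hne : ∀ i, i ≠ s.2.1 → w i = w' i := by
    intro i hi
    have := congrFun h i
    simpa [refineTuple, hi] using this
  have hj := congrFun h s.2.1
  simp only [refineTuple, Function.update_self] at hj
  have hs : ∀ i : Fin s.2.1.1, w (Fin.castLE s.2.1.2.le i) = w' (Fin.castLE s.2.1.2.le i) := by
    intro i
    refine hne _ fun hi => ?_
    have := congrArg Fin.val hi
    simp at this
    omega
  simp only [hs, add_left_inj] at hj
  have hj' : w s.2.1 = w' s.2.1 := nsmul_right_injective (by omega) hj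
  funext i
  by_cases hi : i = s.2.1
  · rw [hi, hj']
  · exact hne i hi

theorem snocDet_refineTuple {m : ℕ} {R : Type*} [CommRing R] (s : RefineIndex m)
    (w : Fin m → Fin (m + 1) → R) (y : Fin (m + 1) → R) :
    snocDet (refineTuple s w) y = ((s.1 + 2 : ℕ) : R) * snocDet w y := by
  set A : (Fin (m + 1) → R) [⋀^(Fin (m + 1))]→ₗ[R] R := Matrix.detRowAlternating with hA
  have hdet : ∀ x : Fin m → Fin (m + 1) → R, snocDet x y =
      A (Fin.snoc (α := fun _ => Fin (m + 1) → R) x y) := fun x => by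
    rw [snocDet_apply]; rfl
  let L := A.toMultilinearMap.toLinearMap (Fin.snoc (α := fun _ => Fin (m + 1) → R) w y)
    s.2.1.castSucc
  have hL : ∀ z, A (Fin.snoc (α := fun _ => Fin (m + 1) → R) (Function.update w s.2.1 z) y) =
      L z := by
    intro z
    rw [Fin.snoc_update]; rfl
  have hself : L (w s.2.1) = snocDet w y := by
    rw [← hL, Function.update_eq_self, hdet]
  have hother : ∀ i : Fin s.2.1.1, L (w (Fin.castLE s.2.1.2.le i)) = 0 := by
    intro i
    have hne : Fin.castLE s.2.1.2.le i ≠ s.2.1 := by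
      intro h
      have := congrArg Fin.val h
      simp at this
      omega
    obtain ⟨i', hi'⟩ : ∃ i' : Fin m, i' = Fin.castLE s.2.1.2.le i := ⟨_, rfl⟩
    rw [← hi'] at hne ⊢
    rw [← hL]
    refine A.map_eq_zero_of_eq _ (i := i'.castSucc) (j := s.2.1.castSucc) ?_ ?_
    · rw [Fin.snoc_castSucc, Fin.snoc_castSucc, Function.update_self, Function.update_of_ne hne]
    · exact fun h => hne (Fin.castSucc_injective _ h)
  rw [hdet, refineTuple, hL, map_add, map_nsmul, hself, map_sum]
  have hzero : ∀ i : Fin s.2.1.1,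
      L ((s.2.2 i : ℕ) • w (Fin.castLE s.2.1.2.le i)) = 0 := fun i => by
    rw [map_nsmul, hother, smul_zero]
  rw [Finset.sum_eq_zero fun i _ => hzero i, add_zero, nsmul_eq_mul]

/-- If a nontrivial combination of the entries of an integer tuple vanishes modulo a prime, the
tuple arises from another integer tuple by an index-increasing operation. -/
theorem exists_refineTuple {p : ℕ} (hp : p.Prime) (v : Fin D → Fin n → ℤ) (c : Fin D → ℤ)
    (hc : ∀ k, (p : ℤ) ∣ ∑ i, c i * v i k) (hne : ∃ i, ¬ (p : ℤ) ∣ c i) :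
    ∃ (s : RefineIndex D) (w : Fin D → Fin n → ℤ), v = refineTuple s w := by
  classical
  have hpp : (0 : ℤ) < p := by exact_mod_cast hp.pos
  let F : Finset (Fin D) := Finset.univ.filter fun i => ¬ (p : ℤ) ∣ c i
  have hF : F.Nonempty := by
    obtain ⟨i, hi⟩ := hne
    exact ⟨i, by simpa [F] using hi⟩
  set j := F.max' hF with hj
  have hcj : ¬ (p : ℤ) ∣ c j := by
    have := F.max'_mem hF
    simpa [F] using this
  have hgt : ∀ i, j < i → (p : ℤ) ∣ c i := by
    intro i hi
    by_contra h
    exact absurd (F.le_max' i (by simpa [F] using h)) (not_le.2 hi)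
  obtain ⟨b, t, hbt⟩ : ∃ b t : ℤ, b * c j = 1 + p * t := by
    have hcop : IsCoprime (c j) (p : ℤ) :=
      ((Nat.prime_iff_prime_int.1 hp).coprime_iff_not_dvd.2 hcj).symm
    obtain ⟨x, y, hxy⟩ := hcop
    exact ⟨x, -y, by linarith⟩
  let a : Fin D → ℕ := fun i => ((-(b * c i)) % p).toNat
  have ha : ∀ i, ((a i : ℕ) : ℤ) = (-(b * c i)) % p := fun i =>
    Int.toNat_of_nonneg (Int.emod_nonneg _ hpp.ne')
  have halt : ∀ i, a i < p := by
    intro i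
    have h := Int.emod_lt_of_pos (-(b * c i)) hpp
    rw [← ha] at h
    exact_mod_cast h
  have h2p : p - 2 + 2 = p := by have := hp.two_le; omega
  have hdvd : ∀ k, (p : ℤ) ∣ v j k - ∑ i : Fin j.1, (a (Fin.castLE j.2.le i) : ℤ) *
      v (Fin.castLE j.2.le i) k := by
    intro k
    have hsum : ∑ i : Fin j.1, (a (Fin.castLE j.2.le i) : ℤ) * v (Fin.castLE j.2.le i) k =
        ∑ i ∈ Finset.univ.filter (fun i => i < j), (a i : ℤ) * v i k := by
      refine Finset.sum_bij (fun i _ => Fin.castLE j.2.le i) ?_ ?_ ?_ ?_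
      · intro i _
        simp only [Finset.mem_filter, Finset.mem_univ, true_and]
        exact Fin.lt_def.2 (by simp)
      · intro i _ i' _ h
        exact Fin.castLE_injective _ h
      · intro i hi
        simp only [Finset.mem_filter, Finset.mem_univ, true_and] at hi
        exact ⟨⟨i.1, Fin.lt_def.1 hi⟩, Finset.mem_univ _, by ext; simp⟩
      · intro i _; rfl
    rw [hsum]
    rw [← ZMod.intCast_zmod_eq_zero_iff_dvd]
    have hck := (ZMod.intCast_zmod_eq_zero_iff_dvd (∑ i, c i * v i k) p).2 (hc k)
    have hbt' : (b : ZMod p) * (c j : ZMod p) = 1 := by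
      have := congrArg (Int.cast : ℤ → ZMod p) hbt
      push_cast at this
      simpa using this
    have ha' : ∀ i, (a i : ZMod p) = -(b * c i) := by
      intro i
      have := congrArg (Int.cast : ℤ → ZMod p) (ha i)
      rw [ZMod.intCast_mod] at this
      push_cast at this
      exact this
    have hsplit : ∑ i, (c i : ZMod p) * (v i k : ZMod p) =
        ∑ i ∈ Finset.univ.filter (fun i => i < j), (c i : ZMod p) * (v i k : ZMod p) +
          (c j : ZMod p) * v j k := by
      rw [← Finset.sum_filter_add_sum_filter_not Finset.univ (fun i => i < j)]
      congr 1
      rw [Finset.sum_eq_single_of_mem j (by simp)]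
      intro i hi hij
      have hji : j < i := lt_of_le_of_ne (by simpa using hi) (Ne.symm hij)
      rw [(ZMod.intCast_zmod_eq_zero_iff_dvd (c i) p).2 (hgt i hji), zero_mul]
    push_cast at hck ⊢
    rw [hsplit] at hck
    simp only [ha', neg_mul, Finset.sum_neg_distrib, sub_neg_eq_add, mul_assoc]
    rw [← Finset.mul_sum]
    calc (v j k : ZMod p) + b * ∑ i ∈ Finset.univ.filter (fun i => i < j),
          (c i : ZMod p) * (v i k : ZMod p)
        = b * (∑ i ∈ Finset.univ.filter (fun i => i < j), (c i : ZMod p) * (v i k : ZMod p) +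
          (c j : ZMod p) * v j k) + (1 - b * c j) * v j k := by ring
      _ = 0 := by rw [hck, hbt']; simp
  choose w hw using hdvd
  refine ⟨⟨p - 2, j, fun i => ⟨a (Fin.castLE j.2.le i), by rw [h2p]; exact halt _⟩⟩,
    Function.update v j w, ?_⟩
  funext i
  by_cases hi : i = j
  · rw [hi]
    have hne' : ∀ i : Fin j.1, Fin.castLE j.2.le i ≠ j := by
      intro i h
      have := congrArg Fin.val h
      simp at this
      omega
    funext k
    simp only [refineTuple, Function.update_self, Pi.add_apply, Finset.sum_apply, Pi.smul_apply,
      hne', ne_eq, not_false_eq_true, Function.update_of_ne]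
    simp only [nsmul_eq_mul, h2p]
    linarith [hw k]
  · simp [refineTuple, hi]

end Refine

section Scaling

variable {D n : ℕ}

/-- Rescaling one entry of a tuple and translating it by a function of the other entries. -/
theorem lintegral_update_smul_add (j : Fin D) {c : ℝ} (hc : c ≠ 0)
    {b : (Fin D → Fin n → ℝ) → Fin n → ℝ} (hb : Measurable b)
    (hbj : ∀ x y, b (Function.update x j y) = b x)
    {f : (Fin D → Fin n → ℝ) → ℝ≥0∞} (hf : Measurable f) :
    ∫⁻ x, f (Function.update x j (c • x j + b x)) = ENNReal.ofReal (|c ^ n|⁻¹) * ∫⁻ x, f x := by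
  have hm : Measurable fun x : Fin D → Fin n → ℝ => Function.update x j (c • x j + b x) := by
    refine measurable_pi_lambda _ fun i => ?_
    by_cases hi : i = j
    · subst hi
      have h2 : Measurable fun x : Fin D → Fin n → ℝ => c • x i :=
        Continuous.measurable (by fun_prop)
      simp only [Function.update_self]
      exact h2.add hb
    · simpa [hi] using measurable_pi_apply i
  have hF : Measurable fun x : Fin D → Fin n → ℝ =>
      f (Function.update x j (c • x j + b x)) := hf.comp hm
  have hG : Measurable fun x : Fin D → Fin n → ℝ => ENNReal.ofReal (|c ^ n|⁻¹) * f x :=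
    hf.const_mul _
  rw [← lintegral_const_mul _ hf]
  refine lintegral_eq_of_lmarginal_eq {j} hF hG ?_
  rw [lmarginal_singleton, lmarginal_singleton]
  funext x
  dsimp only
  have hcomp : Measurable fun y : Fin n → ℝ => f (Function.update x j y) :=
    hf.comp (measurable_update x)
  rw [lintegral_const_mul _ hcomp]
  simp only [Function.update_self, Function.update_idem, hbj]
  have h1 : ∫⁻ y : Fin n → ℝ, f (Function.update x j (c • y + b x)) =
      ∫⁻ y : Fin n → ℝ, f (Function.update x j (c • y)) := by
    have h2 : ∀ y : Fin n → ℝ, c • y + b x = c • (y + c⁻¹ • b x) := fun y => by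
      rw [smul_add, smul_inv_smul₀ hc]
    simp only [h2]
    exact lintegral_add_right_eq_self (fun y : Fin n → ℝ => f (Function.update x j (c • y)))
      (c⁻¹ • b x)
  rw [h1, ← lintegral_map (μ := volume) hcomp (measurable_const_smul c),
    Measure.map_addHaar_smul volume hc, lintegral_smul_measure, smul_eq_mul, Module.finrank_fin_fun,
    abs_inv]

theorem measurable_refineTuple (s : RefineIndex D) :
    Measurable (refineTuple (V := Fin n → ℝ) s) := by
  refine measurable_pi_lambda _ fun i => ?_
  by_cases hi : i = s.2.1
  · subst hi
    simp only [refineTuple, Function.update_self]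
    exact Continuous.measurable (by fun_prop)
  · simpa [refineTuple, hi] using measurable_pi_apply i

theorem castLE_ne (j : Fin D) (i : Fin j.1) : Fin.castLE j.2.le i ≠ j := by
  intro h
  have := congrArg Fin.val h
  simp at this
  omega

theorem lintegral_refineTuple (s : RefineIndex D) {f : (Fin D → Fin n → ℝ) → ℝ≥0∞}
    (hf : Measurable f) :
    ∫⁻ x, f (refineTuple s x) = (((s.1 + 2 : ℕ) : ℝ≥0∞) ^ n)⁻¹ * ∫⁻ x, f x := by
  have h := lintegral_update_smul_add (D := D) (n := n) s.2.1 (c := ((s.1 + 2 : ℕ) : ℝ))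
    (by positivity) (b := fun x => ∑ i : Fin s.2.1.1, (s.2.2 i : ℕ) • x (Fin.castLE s.2.1.2.le i))
    (Continuous.measurable (by fun_prop))
    (fun x y => by simp only [castLE_ne, ne_eq, not_false_eq_true, Function.update_of_ne]) hf
  have h2 : ENNReal.ofReal |((s.1 + 2 : ℕ) : ℝ) ^ n|⁻¹ = (((s.1 + 2 : ℕ) : ℝ≥0∞) ^ n)⁻¹ := by
    rw [abs_of_pos (by positivity), ENNReal.ofReal_inv_of_pos (by positivity),
      ENNReal.ofReal_pow (by positivity), ENNReal.ofReal_natCast]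
  rw [← h2, ← h]
  simp only [refineTuple, Nat.cast_smul_eq_nsmul]

theorem span_refineTuple (s : RefineIndex D) (w : Fin D → Fin n → ℝ) :
    Submodule.span ℝ (Set.range (refineTuple s w)) = Submodule.span ℝ (Set.range w) := by
  have hne : ∀ i, i ≠ s.2.1 → refineTuple s w i = w i := fun i hi => by simp [refineTuple, hi]
  have hj : refineTuple s w s.2.1 = (s.1 + 2) • w s.2.1 +
      ∑ i : Fin s.2.1.1, (s.2.2 i : ℕ) • w (Fin.castLE s.2.1.2.le i) := by simp [refineTuple]
  refine le_antisymm (Submodule.span_le.2 ?_) (Submodule.span_le.2 ?_)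
  · rintro _ ⟨i, rfl⟩
    by_cases hi : i = s.2.1
    · rw [hi, hj]
      refine Submodule.add_mem _ (Submodule.smul_of_tower_mem _ _ (Submodule.subset_span ⟨_, rfl⟩))
        (Submodule.sum_mem _ fun i _ => Submodule.smul_of_tower_mem _ _ ?_)
      exact Submodule.subset_span ⟨_, rfl⟩
    · rw [hne i hi]
      exact Submodule.subset_span ⟨_, rfl⟩
  · rintro _ ⟨i, rfl⟩
    by_cases hi : i = s.2.1
    · have h0 : ((s.1 + 2 : ℕ) : ℝ) ≠ 0 := by positivity
      have h1 : w s.2.1 = ((s.1 + 2 : ℕ) : ℝ)⁻¹ • (refineTuple s w s.2.1 -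
          ∑ i : Fin s.2.1.1, (s.2.2 i : ℕ) • refineTuple s w (Fin.castLE s.2.1.2.le i)) := by
        simp only [hne _ (castLE_ne s.2.1 _)]
        rw [hj, add_sub_cancel_right, ← Nat.cast_smul_eq_nsmul ℝ, inv_smul_smul₀ h0]
      rw [hi, h1]
      refine Submodule.smul_mem _ _ (Submodule.sub_mem _ (Submodule.subset_span ⟨_, rfl⟩)
        (Submodule.sum_mem _ fun i _ => Submodule.smul_of_tower_mem _ _ ?_))
      exact Submodule.subset_span ⟨_, rfl⟩
    · rw [← hne i hi]
      exact Submodule.subset_span ⟨_, rfl⟩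

theorem linearIndependent_refineTuple (s : RefineIndex D) (w : Fin D → Fin n → ℝ) :
    LinearIndependent ℝ (refineTuple s w) ↔ LinearIndependent ℝ w := by
  rw [linearIndependent_iff_card_eq_finrank_span, linearIndependent_iff_card_eq_finrank_span,
    Set.finrank, Set.finrank, span_refineTuple]

end Scaling

section RogersConst

variable {X : Type*} [MeasurableSpace X] {m n : ℕ} {μ : Measure X}
  {g : X → Matrix (Fin n) (Fin n) ℝ}

theorem exists_measure_eq_rogersConst (μ : Measure X)
    (g : X → Matrix (Fin n) (Fin n) ℝ) :
    ∃ κ : Measure (Fin m → Fin n → ℤ), ∀ O, rogersConst μ g O = κ O := by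
  refine ⟨Measure.sum fun v => (μ.map fun L => act (g L) (icast v))
    (Set.univ.pi fun _ => Set.univ.pi fun _ => Set.Icc (0 : ℝ) 1) • Measure.dirac v, fun O => ?_⟩
  have hO : MeasurableSet O := O.to_countable.measurableSet
  have hc : MeasurableSet ((Set.univ : Set (Fin m)).pi fun _ =>
      (Set.univ : Set (Fin n)).pi fun _ => Set.Icc (0 : ℝ) 1) :=
    MeasurableSet.univ_pi fun _ => MeasurableSet.univ_pi fun _ => measurableSet_Icc
  rw [rogersConst, hitMeasure, Measure.sum_apply _ hc, Measure.sum_apply _ hO,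
    tsum_subtype O fun v => (μ.map fun L => act (g L) (icast v))
    (Set.univ.pi fun _ => Set.univ.pi fun _ => Set.Icc (0 : ℝ) 1)]
  refine tsum_congr fun v => ?_
  rw [Measure.smul_apply, Measure.dirac_apply' _ hO]
  by_cases h : v ∈ O <;> simp [h]

theorem SLZInvariant.image_refineTuple {O : Set (Fin m → Fin n → ℤ)} (hO : SLZInvariant O)
    (s : RefineIndex m) : SLZInvariant (refineTuple s '' O) := by
  rintro γ _ ⟨w, hw, rfl⟩
  exact ⟨_, hO γ w hw, (mulVec_refineTuple _ _ _).symm⟩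

theorem rogersConst_image_refineTuple [SFinite μ] (hg : IsInvariantFrame μ g) (hmn : m < n)
    {O : Set (Fin m → Fin n → ℤ)} (hO : SLZInvariant O)
    (hind : ∀ v ∈ O, LinearIndependent ℝ (icast v)) (s : RefineIndex m) :
    rogersConst μ g (refineTuple s '' O) = (((s.1 + 2 : ℕ) : ℝ≥0∞) ^ n)⁻¹ * rogersConst μ g O := by
  have hind' : ∀ v ∈ refineTuple s '' O, LinearIndependent ℝ (icast v) := by
    rintro _ ⟨w, hw, rfl⟩
    rw [icast_refineTuple, linearIndependent_refineTuple]
    exact hind w hw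
  let Q : Set (Fin m → Fin n → ℝ) := Set.univ.pi fun _ => Set.univ.pi fun _ => Set.Icc (0 : ℝ) 1
  have hQm : MeasurableSet Q :=
    MeasurableSet.univ_pi fun _ => MeasurableSet.univ_pi fun _ => measurableSet_Icc
  have hQ : volume Q = 1 := by
    simp only [Q, volume_pi_pi, Real.volume_Icc, sub_zero, ENNReal.ofReal_one,
      Finset.prod_const_one]
  let f : (Fin m → Fin n → ℝ) → ℝ≥0∞ := Q.indicator 1
  have hf : Measurable f := measurable_one.indicator hQm
  have hf1 : ∫⁻ x, f x = 1 := by rw [lintegral_indicator_one hQm, hQ]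
  have h1 := lintegral_tsum_eq hg hmn (hO.image_refineTuple s) hind' hf
  have h2 := lintegral_tsum_eq hg hmn hO hind (hf.comp (measurable_refineTuple s))
  have h3 : ∀ L, ∑' v : refineTuple s '' O, f (act (g L) (icast v.1)) =
      ∑' v : O, (f ∘ refineTuple s) (act (g L) (icast v.1)) := by
    intro L
    rw [tsum_image (fun v => f (act (g L) (icast v))) (refineTuple_injective s).injOn]
    refine tsum_congr fun v => ?_
    rw [icast_refineTuple, act_refineTuple]; rfl
  simp only [h3] at h1
  rw [h2, hf1, mul_one] at h1
  rw [← h1, mul_comm]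
  congr 1
  have h4 := lintegral_refineTuple (n := n) s hf
  rw [hf1, mul_one] at h4
  exact h4

end RogersConst

/-- Independent integer tuples that are not obtained from another integer tuple by an elementary
index-increasing operation. -/
def primTuples (m n : ℕ) : Set (Fin m → Fin n → ℤ) :=
  {v | LinearIndependent ℝ (icast v) ∧ ∀ s w, v ≠ refineTuple s w}

theorem linearIndependent_icast_mulVec {m n : ℕ} (γ : Matrix.SpecialLinearGroup (Fin n) ℤ)
    {v : Fin m → Fin n → ℤ} (hv : LinearIndependent ℝ (icast v)) :
    LinearIndependent ℝ (icast fun i => γ.1.mulVec (v i)) := by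
  rw [icast_mulVec]
  exact act_linearIndependent (Matrix.SpecialLinearGroup.map (Int.castRingHom ℝ) γ).2 hv

theorem primTuples_invariant (m n : ℕ) : SLZInvariant (primTuples m n) := by
  rintro γ v ⟨hv, hs⟩
  refine ⟨linearIndependent_icast_mulVec γ hv, fun s w h => hs s (fun i => (γ⁻¹).1.mulVec (w i)) ?_⟩
  rw [← mulVec_refineTuple, ← h]
  funext i
  rw [Matrix.mulVec_mulVec, ← Matrix.SpecialLinearGroup.coe_mul, inv_mul_cancel,
    Matrix.SpecialLinearGroup.coe_one, Matrix.one_mulVec]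

section Codimension

variable {m : ℕ}

theorem exists_snocDet_eq_one {v : Fin m → Fin (m + 1) → ℤ} (hv : v ∈ primTuples m (m + 1)) :
    ∃ y, snocDet v y = 1 := by
  obtain ⟨d, hd⟩ := IsPrincipalIdealRing.principal (LinearMap.range (snocDet v))
  have hmem : ∀ y, d ∣ snocDet v y := fun y => by
    have h : snocDet v y ∈ LinearMap.range (snocDet v) := ⟨y, rfl⟩
    rw [hd, Submodule.mem_span_singleton] at h
    obtain ⟨a, ha⟩ := h
    exact ⟨a, by rw [← ha, smul_eq_mul, mul_comm]⟩
  by_cases hunit : d.natAbs = 1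
  · have h1 : (1 : ℤ) ∈ LinearMap.range (snocDet v) := by
      rw [hd, Submodule.mem_span_singleton]
      rcases Int.natAbs_eq_iff.1 hunit with h | h
      · exact ⟨1, by simp [h]⟩
      · exact ⟨-1, by simp [h]⟩
    obtain ⟨y, hy⟩ := h1
    exact ⟨y, hy⟩
  exfalso
  obtain ⟨p, hp, hpd⟩ := Nat.exists_prime_and_dvd hunit
  have hpd' : (p : ℤ) ∣ d := Int.natCast_dvd.2 hpd
  have hfact : Fact p.Prime := ⟨hp⟩
  let vb : Fin m → Fin (m + 1) → ZMod p := fun i j => Int.castRingHom (ZMod p) (v i j)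
  have hdep : ¬ LinearIndependent (ZMod p) vb := by
    intro hli
    obtain ⟨y, hy⟩ := exists_snocDet_ne_zero hli
    choose z hz using fun j => ZMod.intCast_surjective (y j)
    refine hy ?_
    have h2 := snocDet_map (Int.castRingHom (ZMod p)) v z
    have h3 : (fun j => Int.castRingHom (ZMod p) (z j)) = y := funext hz
    rw [h3] at h2
    rw [h2]
    exact (ZMod.intCast_zmod_eq_zero_iff_dvd _ p).2 (hpd'.trans (hmem z))
  rw [Fintype.not_linearIndependent_iff] at hdep
  obtain ⟨c, hc, i, hi⟩ := hdep
  choose z hz using fun j => ZMod.intCast_surjective (c j)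
  obtain ⟨s, w, hsw⟩ := exists_refineTuple hp v z (fun k => by
    rw [← ZMod.intCast_zmod_eq_zero_iff_dvd]
    have h4 := congrFun hc k
    rw [Finset.sum_apply] at h4
    push_cast
    simp only [hz]
    exact h4) ⟨i, fun h => hi (by
      rw [← hz, (ZMod.intCast_zmod_eq_zero_iff_dvd _ p).2 h])⟩
  exact hv.2 s w hsw

theorem continuous_snocDet (e : Fin (m + 1) → ℝ) :
    Continuous fun x : Fin m → Fin (m + 1) → ℝ => snocDet x e := by
  simp only [snocDet_apply]
  refine Continuous.matrix_det (continuous_matrix fun i j => ?_)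
  refine Fin.lastCases ?_ (fun i => ?_) i
  · simp only [Matrix.of_apply, Fin.snoc_last]
    exact continuous_const
  · simp only [Matrix.of_apply, Fin.snoc_castSucc]
    exact continuous_apply_apply i j

/-- A neighbourhood of the first `m` standard basis vectors of `ℝ^(m+1)`. -/
def basisBox (m : ℕ) : Set (Fin m → Fin (m + 1) → ℝ) :=
  {x | (∀ i j, |x i j| < 2) ∧ 1 / 2 < snocDet x (Pi.single (Fin.last m) 1)}

theorem isOpen_basisBox : IsOpen (basisBox m) := by
  refine IsOpen.inter ?_ (isOpen_lt continuous_const (continuous_snocDet _))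
  have h : {x : Fin m → Fin (m + 1) → ℝ | ∀ i j, |x i j| < 2} = ⋂ i, ⋂ j, {x | |x i j| < 2} := by
    ext x; simp
  change IsOpen {x : Fin m → Fin (m + 1) → ℝ | ∀ i j, |x i j| < 2}
  rw [h]
  refine isOpen_iInter_of_finite fun i => isOpen_iInter_of_finite fun j => ?_
  exact isOpen_lt (by fun_prop) continuous_const

theorem volume_basisBox_pos : 0 < volume (basisBox m) := by
  refine isOpen_basisBox.measure_pos _ ⟨fun i => Pi.single i.castSucc 1, fun i j => ?_, ?_⟩
  · by_cases h : j = i.castSucc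
    · subst h; simp
    · simp [h]
  · rw [snocDet_apply]
    have : Matrix.of (Fin.snoc (α := fun _ => Fin (m + 1) → ℝ)
        (fun i : Fin m => Pi.single i.castSucc 1) (Pi.single (Fin.last m) 1)) =
        (1 : Matrix (Fin (m + 1)) (Fin (m + 1)) ℝ) := by
      ext i j
      refine Fin.lastCases ?_ (fun i => ?_) i
      · simp [Matrix.one_apply, Pi.single_apply, eq_comm]
      · simp [Matrix.one_apply, Pi.single_apply, eq_comm]
    rw [this, Matrix.det_one]
    norm_num

theorem mem_span_of_snocDet_eq_zero {K : Type*} [Field K] {x : Fin m → Fin (m + 1) → K}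
    (hx : LinearIndependent K x) {z : Fin (m + 1) → K} (hz : snocDet x z = 0) :
    z ∈ Submodule.span K (Set.range x) := by
  by_contra h
  have h2 : LinearIndependent K (Fin.snoc (α := fun _ => Fin (m + 1) → K) x z) :=
    linearIndependent_finSnoc.2 ⟨hx, h⟩
  have h3 := Matrix.linearIndependent_rows_iff_isUnit
    (A := Matrix.of (Fin.snoc (α := fun _ => Fin (m + 1) → K) x z)).1 h2
  rw [Matrix.isUnit_iff_isUnit_det, isUnit_iff_ne_zero, ← snocDet_apply] at h3
  exact h3 hz

theorem exists_short_complement {g : Matrix (Fin (m + 1)) (Fin (m + 1)) ℝ} (hg : g.det = 1)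
    {v : Fin m → Fin (m + 1) → ℤ} (hv : v ∈ primTuples m (m + 1))
    (hE : act g (icast v) ∈ basisBox m) :
    ∃ y : Fin (m + 1) → ℤ, snocDet v y = 1 ∧
      ∀ j, |g.mulVec (fun k => (y k : ℝ)) j| ≤ 2 * m + 2 := by
  obtain ⟨y, hy⟩ := exists_snocDet_eq_one hv
  set x := act g (icast v) with hx
  set z := g.mulVec fun k => (y k : ℝ) with hz
  have hxz : snocDet x z = 1 := by
    have h1 := snocDet_map (Int.castRingHom ℝ) v y
    rw [hy, map_one] at h1
    rw [hx, hz]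
    unfold act
    rw [snocDet_mulVec, hg, one_mul]
    exact h1
  set e : Fin (m + 1) → ℝ := Pi.single (Fin.last m) 1 with he
  have hd : 1 / 2 < snocDet x e := hE.2
  have hd0 : snocDet x e ≠ 0 := by linarith
  have hspan : z - (snocDet x e)⁻¹ • e ∈ Submodule.span ℝ (Set.range x) := by
    refine mem_span_of_snocDet_eq_zero (linearIndependent_of_snocDet_ne_zero hd0) ?_
    rw [map_sub, map_smul, hxz, smul_eq_mul, inv_mul_cancel₀ hd0, sub_self]
  obtain ⟨c, hc⟩ := (Submodule.mem_span_range_iff_exists_fun ℝ).1 hspan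
  refine ⟨y - ∑ i, ⌊c i⌋ • v i, ?_, fun j => ?_⟩
  · have h1 : ∀ i, snocDet v (⌊c i⌋ • v i) = 0 := fun i => by
      rw [map_smul, snocDet_self, smul_zero]
    rw [map_sub, map_sum, hy, Finset.sum_eq_zero fun i _ => h1 i, sub_zero]
  · have h1 : g.mulVec (fun k => ((y - ∑ i, ⌊c i⌋ • v i) k : ℝ)) =
        ∑ i, Int.fract (c i) • x i + (snocDet x e)⁻¹ • e := by
      have h2 : (fun k => (((y - ∑ i, ⌊c i⌋ • v i) k : ℤ) : ℝ)) =
          (fun k => (y k : ℝ)) - ∑ i, (⌊c i⌋ : ℝ) • icast v i := by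
        funext k
        simp [icast, Finset.sum_apply]
      rw [h2, Matrix.mulVec_sub, ← hz, sub_eq_iff_eq_add.1 hc.symm, Matrix.mulVec_sum]
      have h3 : ∀ i, g.mulVec ((⌊c i⌋ : ℝ) • icast v i) = (⌊c i⌋ : ℝ) • x i := fun i => by
        rw [Matrix.mulVec_smul]; rfl
      simp only [h3, Int.fract, sub_smul, Finset.sum_sub_distrib]
      abel
    rw [h1]
    simp only [Pi.add_apply, Finset.sum_apply, Pi.smul_apply, smul_eq_mul]
    have h4 : |∑ i, Int.fract (c i) * x i j| ≤ 2 * m := by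
      refine (Finset.abs_sum_le_sum_abs _ _).trans ?_
      have : ∀ i ∈ Finset.univ, |Int.fract (c i) * x i j| ≤ 2 := fun i _ => by
        rw [abs_mul, abs_of_nonneg (Int.fract_nonneg _)]
        have h5 := (hE.1 i j).le
        have h6 := (Int.fract_lt_one (c i)).le
        nlinarith [abs_nonneg (x i j), Int.fract_nonneg (c i)]
      refine (Finset.sum_le_sum this).trans ?_
      simp [mul_comm]
    have h5 : |(snocDet x e)⁻¹ * e j| ≤ 2 := by
      have h6 : |e j| ≤ 1 := by
        rw [he]
        by_cases h : j = Fin.last m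
        · subst h; simp
        · simp [h]
      have h7 : (snocDet x e)⁻¹ ≤ 2 := by
        rw [inv_le_comm₀ (by linarith) two_pos]; linarith
      have h8 : 0 < (snocDet x e)⁻¹ := inv_pos.2 (by linarith)
      rw [abs_mul, abs_of_pos h8]
      nlinarith [abs_nonneg (e j)]
    exact (abs_add_le _ _).trans (add_le_add h4 h5)

theorem abs_adjugate_le {ι : Type*} [Fintype ι] [DecidableEq ι] {A : Matrix ι ι ℝ} {B : ℝ}
    (hB : 1 ≤ B) (hA : ∀ i j, |A i j| ≤ B) (i j : ι) :
    |A.adjugate i j| ≤ (Fintype.card ι).factorial • B ^ Fintype.card ι := by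
  rw [Matrix.adjugate_apply]
  refine Matrix.det_le (abv := AbsoluteValue.abs) fun k l => ?_
  by_cases hk : k = j
  · subst hk
    rw [Matrix.updateRow_self]
    by_cases hl : l = i
    · subst hl; simpa using hB
    · simp [hl]; linarith
  · rw [Matrix.updateRow_ne hk]; exact hA k l

/-- The number of primitive tuples which a unimodular matrix maps to `basisBox m` is bounded
independently of the matrix. -/
theorem exists_tsum_primTuples_le (m : ℕ) : ∃ N : ℕ,
    ∀ g : Matrix (Fin (m + 1)) (Fin (m + 1)) ℝ, g.det = 1 →
      ∑' v : primTuples m (m + 1), (basisBox m).indicator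
        (1 : (Fin m → Fin (m + 1) → ℝ) → ℝ≥0∞) (act g (icast v.1)) ≤ N := by
  classical
  set B : ℝ := 2 * m + 2 with hB
  have hB1 : 1 ≤ B := by rw [hB]; linarith [(Nat.cast_nonneg m : (0 : ℝ) ≤ m)]
  set K : ℝ := (m + 1) * (B * ((m + 1).factorial • B ^ (m + 1))) with hK
  let Z : Finset (Matrix (Fin (m + 1)) (Fin (m + 1)) ℤ) :=
    Fintype.piFinset fun _ => Fintype.piFinset fun _ => Finset.Icc (-⌈K⌉) ⌈K⌉
  refine ⟨Z.card, fun g hg => ?_⟩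
  rw [ENNReal.tsum_eq_iSup_sum]
  refine iSup_le fun F => ?_
  let F' := F.filter fun v => act g (icast v.1) ∈ basisBox m
  have hsum : ∑ v ∈ F, (basisBox m).indicator (1 : (Fin m → Fin (m + 1) → ℝ) → ℝ≥0∞)
      (act g (icast v.1)) = (F'.card : ℝ≥0∞) := by
    simp only [Set.indicator_apply, Pi.one_apply, F']
    rw [Finset.sum_boole]
  rw [hsum, Nat.cast_le]
  rcases F'.eq_empty_or_nonempty with hF' | ⟨v₀, hv₀⟩
  · rw [hF']; simp
  have hex : ∀ v : primTuples m (m + 1), ∃ y : Fin (m + 1) → ℤ, v ∈ F' → (snocDet v.1 y = 1 ∧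
      ∀ j, |g.mulVec (fun k => (y k : ℝ)) j| ≤ B) := by
    intro v
    by_cases hv : v ∈ F'
    · obtain ⟨y, hy⟩ := exists_short_complement hg v.2 (Finset.mem_filter.1 hv).2
      exact ⟨y, fun _ => hy⟩
    · exact ⟨0, fun h => absurd h hv⟩
  choose y hy using hex
  let M : primTuples m (m + 1) → Matrix (Fin (m + 1)) (Fin (m + 1)) ℤ := fun v =>
    Matrix.of (Fin.snoc (α := fun _ => Fin (m + 1) → ℤ) v.1 (y v))
  have hMdet : ∀ v ∈ F', (M v).det = 1 := fun v hv => by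
    have := (hy v hv).1
    rwa [snocDet_apply] at this
  let R : primTuples m (m + 1) → Matrix (Fin (m + 1)) (Fin (m + 1)) ℝ := fun v =>
    (M v).map (Int.castRingHom ℝ) * g.transpose
  have hR : ∀ v ∈ F', ∀ i j, |R v i j| ≤ B := by
    intro v hv i j
    have h1 : R v i j = g.mulVec (fun k => (M v i k : ℝ)) j := by
      simp [R, Matrix.mul_apply, Matrix.mulVec, dotProduct, mul_comm]
    rw [h1]
    refine Fin.lastCases ?_ (fun i => ?_) i
    · simpa [M] using (hy v hv).2 j
    · have h2 := ((Finset.mem_filter.1 hv).2.1 i j).le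
      have h3 : act g (icast v.1) i j = g.mulVec (fun k => (M v i.castSucc k : ℝ)) j := by
        simp [M, act]; rfl
      rw [← h3]
      refine h2.trans ?_
      rw [hB]; linarith [(Nat.cast_nonneg m : (0 : ℝ) ≤ m)]
  let A : primTuples m (m + 1) → Matrix (Fin (m + 1)) (Fin (m + 1)) ℤ := fun v =>
    M v * (M v₀).adjugate
  have hA : ∀ v, (A v).map (Int.castRingHom ℝ) = R v * (R v₀).adjugate := by
    intro v
    have h1 : ((M v₀).adjugate).map (Int.castRingHom ℝ) =
        ((M v₀).map (Int.castRingHom ℝ)).adjugate := by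
      have := RingHom.map_adjugate (Int.castRingHom ℝ) (M v₀)
      simpa [RingHom.mapMatrix_apply] using this
    simp only [A, R]
    rw [Matrix.map_mul, h1, Matrix.adjugate_mul_distrib, Matrix.mul_assoc,
      ← Matrix.mul_assoc g.transpose, Matrix.mul_adjugate, Matrix.det_transpose, hg, one_smul,
      Matrix.one_mul]
  refine Finset.card_le_card_of_injOn A (fun v hv => ?_) fun v hv v' hv' hvv' => ?_
  · refine Fintype.mem_piFinset.2 fun i => Fintype.mem_piFinset.2 fun j => Finset.mem_Icc.2 ?_
    have h1 : ((A v i j : ℤ) : ℝ) = ∑ k, R v i k * (R v₀).adjugate k j := by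
      have := congrFun (congrFun (hA v) i) j
      rw [Matrix.mul_apply] at this
      exact this
    have h2 : |((A v i j : ℤ) : ℝ)| ≤ K := by
      rw [h1]
      refine (Finset.abs_sum_le_sum_abs _ _).trans ?_
      have h3 : ∀ k ∈ Finset.univ, |R v i k * (R v₀).adjugate k j| ≤
          B * ((m + 1).factorial • B ^ (m + 1)) := fun k _ => by
        rw [abs_mul]
        have h4 := abs_adjugate_le hB1 (hR v₀ hv₀) k j
        rw [Fintype.card_fin] at h4
        exact mul_le_mul (hR v hv i k) h4 (abs_nonneg _) (by linarith)
      refine (Finset.sum_le_sum h3).trans ?_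
      simp [hK]
    have h5 := abs_le.1 (h2.trans (Int.le_ceil K))
    constructor
    · exact_mod_cast h5.1
    · exact_mod_cast h5.2
  · have h1 : ∀ w, A w * M v₀ = M w := fun w => by
      simp only [A]
      rw [Matrix.mul_assoc, Matrix.adjugate_mul, hMdet v₀ hv₀, one_smul, Matrix.mul_one]
    have h2 : M v = M v' := by rw [← h1, ← h1 v', hvv']
    ext1
    funext i
    have h3 : Fin.snoc (α := fun _ => Fin (m + 1) → ℤ) v.1 (y v) i.castSucc =
        Fin.snoc (α := fun _ => Fin (m + 1) → ℤ) v'.1 (y v') i.castSucc := congrFun h2 i.castSucc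
    rwa [Fin.snoc_castSucc, Fin.snoc_castSucc] at h3

variable {X : Type*} [MeasurableSpace X] {μ : Measure X}

theorem rogersConst_primTuples_lt_top [IsProbabilityMeasure μ]
    {g : X → Matrix (Fin (m + 1)) (Fin (m + 1)) ℝ} (hg : IsInvariantFrame μ g) :
    rogersConst μ g (primTuples m (m + 1)) < ∞ := by
  obtain ⟨N, hN⟩ := exists_tsum_primTuples_le m
  have hE := isOpen_basisBox (m := m) |>.measurableSet
  have h1 := lintegral_tsum_eq hg (Nat.lt_succ_self m) (primTuples_invariant m (m + 1))
    (fun v hv => hv.1) (f := (basisBox m).indicator 1) (measurable_one.indicator hE)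
  rw [lintegral_indicator_one hE] at h1
  have h2 : rogersConst μ g (primTuples m (m + 1)) * volume (basisBox m) ≤ N := by
    rw [← h1]
    refine (lintegral_mono fun L => hN (g L) (hg.det_eq_one L)).trans ?_
    simp
  by_contra h
  rw [not_lt, top_le_iff] at h
  rw [h, ENNReal.top_mul volume_basisBox_pos.ne'] at h2
  exact absurd h2 (by simp)

/-- Tuples obtained from primitive ones by fewer than `k` index-increasing operations. -/
def refinements (m n : ℕ) : ℕ → Set (Fin m → Fin n → ℤ)
  | 0 => ∅
  | k + 1 => primTuples m n ∪ ⋃ s, refineTuple s '' refinements m n k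

theorem refinements_spec {n : ℕ} (k : ℕ) : SLZInvariant (refinements m n k) ∧
    ∀ v ∈ refinements m n k, LinearIndependent ℝ (icast v) := by
  induction k with
  | zero => exact ⟨fun _ _ h => h.elim, fun _ h => h.elim⟩
  | succ k ih =>
    constructor
    · rintro γ v (hv | hv)
      · exact Or.inl (primTuples_invariant m n γ v hv)
      · obtain ⟨s, hs⟩ := Set.mem_iUnion.1 hv
        exact Or.inr (Set.mem_iUnion.2 ⟨s, ih.1.image_refineTuple s γ v hs⟩)
    · rintro v (hv | hv)
      · exact hv.1
      · obtain ⟨s, w, hw, rfl⟩ := Set.mem_iUnion.1 hv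
        rw [icast_refineTuple, linearIndependent_refineTuple]
        exact ih.2 w hw

theorem refinements_mono {n : ℕ} : Monotone (refinements m n) := by
  refine monotone_nat_of_le_succ fun k => ?_
  induction k with
  | zero => exact Set.empty_subset _
  | succ k ih =>
    exact Set.union_subset_union_right _ (Set.iUnion_mono fun s => Set.image_mono ih)

theorem tsum_refineIndex_lt_one (m : ℕ) :
    ∑' s : RefineIndex m, (((s.1 + 2 : ℕ) : ℝ≥0∞) ^ (m + 1))⁻¹ < 1 := by
  have hterm : ∀ q : ℕ, ∑' s : (Σ j : Fin m, (Fin j.1 → Fin (q + 2))),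
      (((q + 2 : ℕ) : ℝ≥0∞) ^ (m + 1))⁻¹ =
        ENNReal.ofReal (((q : ℝ) + 1)⁻¹ - ((q : ℝ) + 2)⁻¹ -
          (((q : ℝ) + 1) * ((q : ℝ) + 2) ^ (m + 1))⁻¹) := by
    intro q
    have hq1 : (q : ℝ) + 1 ≠ 0 := by positivity
    have hq2 : (q : ℝ) + 2 ≠ 0 := by positivity
    rw [tsum_fintype, Finset.sum_const, Finset.card_univ, Fintype.card_sigma]
    simp only [Fintype.card_pi, Fintype.card_fin, Finset.prod_const, Finset.card_univ, nsmul_eq_mul]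
    have h1 : (((q + 2 : ℕ) : ℝ≥0∞) ^ (m + 1))⁻¹ =
        ENNReal.ofReal ((((q : ℝ) + 2) ^ (m + 1))⁻¹) := by
      rw [ENNReal.ofReal_inv_of_pos (by positivity), ENNReal.ofReal_pow (by positivity)]
      congr 2
      rw [← ENNReal.ofReal_natCast]; push_cast; rfl
    rw [h1, ← ENNReal.ofReal_natCast, ← ENNReal.ofReal_mul (by positivity)]
    congr 1
    push_cast
    rw [Fin.sum_univ_eq_sum_range (fun j => ((q : ℝ) + 2) ^ j), geom_sum_eq (by linarith)]
    rw [show (q : ℝ) + 2 - 1 = q + 1 by ring]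
    field_simp
    ring
  have hle : ∀ N : ℕ, ∑ q ∈ Finset.range N, (((q : ℝ) + 1)⁻¹ - ((q : ℝ) + 2)⁻¹) ≤ 1 := by
    intro N
    have h := Finset.sum_range_sub' (fun q : ℕ => ((q : ℝ) + 1)⁻¹) N
    have h2 : ∀ q : ℕ, ((q : ℝ) + 2)⁻¹ = (((q + 1 : ℕ) : ℝ) + 1)⁻¹ := fun q => by
      push_cast; ring
    simp only [h2, h]
    simp only [CharP.cast_eq_zero, zero_add, inv_one, sub_le_self_iff]
    positivity
  set δ : ℝ := ((2 : ℝ) ^ (m + 1))⁻¹ with hδ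
  have hδ0 : 0 < δ := by positivity
  refine lt_of_le_of_lt (b := ENNReal.ofReal (1 - δ)) ?_ ?_
  · rw [ENNReal.tsum_sigma']
    simp only [hterm]
    rw [ENNReal.tsum_eq_iSup_nat]
    refine iSup_le fun N => ?_
    have hnn : ∀ q : ℕ, 0 ≤ ((q : ℝ) + 1)⁻¹ - ((q : ℝ) + 2)⁻¹ -
          (((q : ℝ) + 1) * ((q : ℝ) + 2) ^ (m + 1))⁻¹ := by
      intro q
      have hpow : (1 : ℝ) ≤ ((q : ℝ) + 2) ^ m := one_le_pow₀ (by linarith [q.cast_nonneg (α := ℝ)])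
      have h1 : (((q : ℝ) + 1) * ((q : ℝ) + 2) ^ (m + 1))⁻¹ ≤
          (((q : ℝ) + 1) * ((q : ℝ) + 2))⁻¹ := by
        refine inv_anti₀ (by positivity) ?_
        rw [pow_succ]
        have : (0 : ℝ) ≤ ((q : ℝ) + 1) * ((q : ℝ) + 2) := by positivity
        nlinarith
      have h2 : ((q : ℝ) + 1)⁻¹ - ((q : ℝ) + 2)⁻¹ = (((q : ℝ) + 1) * ((q : ℝ) + 2))⁻¹ := by
        field_simp; ring
      linarith
    rw [← ENNReal.ofReal_sum_of_nonneg fun q _ => hnn q]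
    refine ENNReal.ofReal_le_ofReal ?_
    rcases N with _ | N
    · simp only [Finset.range_zero, Finset.sum_empty, sub_nonneg, hδ]
      exact inv_le_one_of_one_le₀ (one_le_pow₀ (by norm_num))
    · rw [Finset.sum_sub_distrib]
      have h1 := hle (N + 1)
      have h2 : δ ≤ ∑ q ∈ Finset.range (N + 1), (((q : ℝ) + 1) * ((q : ℝ) + 2) ^ (m + 1))⁻¹ := by
        refine le_trans ?_ (Finset.single_le_sum (f := fun q : ℕ =>
          (((q : ℝ) + 1) * ((q : ℝ) + 2) ^ (m + 1))⁻¹) (fun q _ => by positivity)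
          (Finset.mem_range.2 N.succ_pos))
        simp [hδ]
      linarith
  · rw [← ENNReal.ofReal_one]
    exact (ENNReal.ofReal_lt_ofReal_iff one_pos).2 (by linarith)

theorem iUnion_refinements : ⋃ k, refinements m (m + 1) k =
    {v | LinearIndependent ℝ (icast v)} := by
  ext v
  simp only [Set.mem_iUnion, Set.mem_ofPred_eq]
  refine ⟨fun ⟨k, hk⟩ => (refinements_spec k).2 v hk, fun hv => ?_⟩
  obtain ⟨y, hy⟩ : ∃ y : Fin (m + 1) → ℤ, snocDet v y ≠ 0 := by
    by_contra! hall
    obtain ⟨z, hz⟩ := exists_snocDet_ne_zero hv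
    refine hz ?_
    have h1 : snocDet (icast v) = 0 := by
      refine LinearMap.pi_ext' fun i => ?_
      ext
      have h2 := snocDet_map (Int.castRingHom ℝ) v (Pi.single i 1)
      rw [hall, map_zero] at h2
      have h3 : (fun j => Int.castRingHom ℝ (Pi.single (M := fun _ => ℤ) i 1 j)) =
          Pi.single i 1 := by
        funext j
        by_cases hj : j = i
        · subst hj; simp
        · simp [hj]
      rw [h3] at h2
      simpa using (show snocDet (icast v) (Pi.single i 1) = 0 from h2)
    rw [h1]; rfl
  induction hN : (snocDet v y).natAbs using Nat.strong_induction_on generalizing v with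
  | _ N ih =>
    by_cases hp : v ∈ primTuples m (m + 1)
    · exact ⟨1, Or.inl hp⟩
    · obtain ⟨s, w, hsw⟩ : ∃ s w, v = refineTuple s w := by
        by_contra! hcon
        exact hp ⟨hv, hcon⟩
      have hdet := snocDet_refineTuple s w y
      rw [← hsw] at hdet
      have hw0 : snocDet w y ≠ 0 := fun h => hy (by rw [hdet, h, mul_zero])
      have hw : LinearIndependent ℝ (icast w) := by
        rw [hsw, icast_refineTuple, linearIndependent_refineTuple] at hv
        exact hv
      obtain ⟨k, hk⟩ := ih (snocDet w y).natAbs (by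
        rw [← hN, hdet, Int.natAbs_mul, Int.natAbs_natCast]
        have := Int.natAbs_pos.2 hw0
        nlinarith) w hw hw0 rfl
      exact ⟨k + 1, Or.inr (Set.mem_iUnion.2 ⟨s, w, hk, hsw.symm⟩)⟩

theorem rogersConst_codim_one_lt_top [IsProbabilityMeasure μ]
    {g : X → Matrix (Fin (m + 1)) (Fin (m + 1)) ℝ} (hg : IsInvariantFrame μ g) :
    rogersConst μ g {v : Fin m → Fin (m + 1) → ℤ | LinearIndependent ℝ (icast v)} < ∞ := by
  obtain ⟨κ, hκ⟩ := exists_measure_eq_rogersConst (m := m) μ g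
  set θ := ∑' s : RefineIndex m, (((s.1 + 2 : ℕ) : ℝ≥0∞) ^ (m + 1))⁻¹ with hθ
  have hθ1 : θ < 1 := tsum_refineIndex_lt_one m
  set c := rogersConst μ g (primTuples m (m + 1)) with hc
  have hctop : c < ∞ := rogersConst_primTuples_lt_top hg
  have hne : 1 - θ ≠ 0 := (tsub_pos_of_lt hθ1).ne'
  have hbound : ∀ k, κ (refinements m (m + 1) k) ≤ c / (1 - θ) := by
    intro k
    induction k with
    | zero => simp [refinements]
    | succ k ih =>
      have h1 : κ (refinements m (m + 1) (k + 1)) ≤ c + θ * (c / (1 - θ)) := by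
        refine (measure_union_le _ _).trans (add_le_add (by rw [← hκ]) ?_)
        refine (measure_iUnion_le _).trans ?_
        rw [hθ, ← ENNReal.tsum_mul_right]
        refine ENNReal.tsum_le_tsum fun s => ?_
        rw [← hκ, rogersConst_image_refineTuple hg (Nat.lt_succ_self m) (refinements_spec k).1
          (refinements_spec k).2 s, hκ]
        gcongr
      refine h1.trans (le_of_eq ?_)
      have h2 : c = (1 - θ) * (c / (1 - θ)) :=
        (ENNReal.mul_div_cancel hne (ne_top_of_le_ne_top ENNReal.one_ne_top tsub_le_self)).symm
      nth_rw 1 [h2]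
      rw [← add_mul, tsub_add_cancel_of_le hθ1.le, one_mul]
  rw [← iUnion_refinements, hκ, refinements_mono.measure_iUnion]
  refine (iSup_le hbound).trans_lt (ENNReal.div_lt_top hctop.ne hne)

end Codimension

section LatticePoints

variable {n : ℕ}

/-- The real vector underlying an integer vector. -/
def ivec (y : Fin n → ℤ) : Fin n → ℝ := fun k => (y k : ℝ)

theorem ivec_add (y z : Fin n → ℤ) : ivec (y + z) = ivec y + ivec z := by
  funext k; simp [ivec]

theorem ivec_sub (y z : Fin n → ℤ) : ivec (y - z) = ivec y - ivec z := by
  funext k; simp [ivec]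

theorem ivec_smul (c : ℤ) (y : Fin n → ℤ) : ivec (c • y) = (c : ℝ) • ivec y := by
  funext k; simp [ivec]

theorem ivec_injective : Function.Injective (ivec (n := n)) := by
  intro y z h
  funext k
  have := congrFun h k
  simpa [ivec] using this

/-- Integer vectors mapped by `g` to the cube of half-side `R`. -/
def latticeBox (g : Matrix (Fin n) (Fin n) ℝ) (R : ℝ) : Set (Fin n → ℤ) :=
  {y | ∀ j, |g.mulVec (ivec y) j| ≤ R}

theorem latticeBox_finite {g : Matrix (Fin n) (Fin n) ℝ} (hg : g.det = 1) (R : ℝ) :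
    (latticeBox g R).Finite := by
  set B : ℝ := ∑ k, ∑ j, |g.adjugate k j| * |R| with hB
  refine (Set.Finite.pi' (t := fun _ : Fin n => Set.Icc (-⌈B⌉) ⌈B⌉)
    fun _ => Set.finite_Icc _ _).subset fun y hy k => ?_
  have h1 : ivec y = g.adjugate.mulVec (g.mulVec (ivec y)) := by
    rw [Matrix.mulVec_mulVec, Matrix.adjugate_mul, hg, one_smul, Matrix.one_mulVec]
  have h2 : |(y k : ℝ)| ≤ B := by
    have h3 : (y k : ℝ) = ∑ j, g.adjugate k j * g.mulVec (ivec y) j := congrFun h1 k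
    rw [h3]
    refine (Finset.abs_sum_le_sum_abs _ _).trans ?_
    refine le_trans ?_ (Finset.single_le_sum (f := fun k => ∑ j, |g.adjugate k j| * |R|)
      (fun k _ => Finset.sum_nonneg fun j _ => by positivity) (Finset.mem_univ k))
    refine Finset.sum_le_sum fun j _ => ?_
    rw [abs_mul]
    exact mul_le_mul_of_nonneg_left ((hy j).trans (le_abs_self R)) (abs_nonneg _)
  have h5 := abs_le.1 (h2.trans (Int.le_ceil B))
  constructor
  · exact_mod_cast h5.1
  · exact_mod_cast h5.2

theorem tendsto_ncard_latticeBox {g : Matrix (Fin n) (Fin n) ℝ} (hg : g.det = 1) :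
    Filter.Tendsto (fun N : ℕ => ((latticeBox g N).ncard : ℝ) / (2 * N) ^ n) Filter.atTop
      (nhds 1) := by
  let T := Matrix.toLin' g
  have hdet : LinearMap.det T = 1 := by rw [LinearMap.det_toLin', hg]
  set s : Set (Fin n → ℝ) := T ⁻¹' Set.univ.pi fun _ => Set.Icc (-1 : ℝ) 1 with hs
  have hmem : ∀ x, x ∈ s ↔ ∀ j, |g.mulVec x j| ≤ 1 := by
    intro x
    simp [hs, T, abs_le, Pi.le_def, forall_and]
  have hclosed : IsClosed s :=
    (isClosed_set_pi fun _ _ => isClosed_Icc).preimage T.continuous_of_finiteDimensional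
  have hconv : Convex ℝ s := (convex_pi fun _ _ => convex_Icc _ _).linear_preimage T
  have hbdd : Bornology.IsBounded s := by
    have h1 : s ⊆ (Matrix.toLin' g.adjugate) '' Set.univ.pi fun _ => Set.Icc (-1 : ℝ) 1 := by
      intro x hx
      refine ⟨T x, hx, ?_⟩
      simp only [T, Matrix.toLin'_apply, Matrix.mulVec_mulVec, Matrix.adjugate_mul, hg, one_smul,
        Matrix.one_mulVec]
    refine Bornology.IsBounded.subset ?_ h1
    exact ((isCompact_univ_pi fun _ => isCompact_Icc).image
      (LinearMap.continuous_of_finiteDimensional _)).isBounded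
  have hvol : volume.real s = 2 ^ n := by
    rw [measureReal_def, hs, Measure.addHaar_preimage_linearMap _ (by rw [hdet]; exact one_ne_zero),
      hdet, volume_pi_pi]
    simp only [inv_one, abs_one, ENNReal.ofReal_one, Real.volume_Icc, Finset.prod_const,
      Finset.card_univ, Fintype.card_fin, one_mul, ENNReal.toReal_pow]
    norm_num
  have h1 := tendsto_card_div_pow_atTop_volume s hbdd hclosed.measurableSet
    (hconv.addHaar_frontier volume)
  rw [hvol] at h1
  have h2 := h1.div_const (2 ^ n)
  rw [div_self (by positivity)] at h2
  refine h2.congr' ?_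
  filter_upwards [Filter.eventually_gt_atTop 0] with N hN
  have hN' : (0 : ℝ) < N := by exact_mod_cast hN
  have h3 : s ∩ (N : ℝ)⁻¹ • (Submodule.span ℤ (Set.range (Pi.basisFun ℝ (Fin n))) : Set _) =
      (fun y => (N : ℝ)⁻¹ • ivec y) '' latticeBox g N := by
    ext x
    constructor
    · rintro ⟨hx, z, hz, rfl⟩
      rw [SetLike.mem_coe, Module.Basis.mem_span_iff_repr_mem] at hz
      choose y hy using hz
      have hzy : z = ivec y := by
        funext k
        have := hy k
        simp only [algebraMap_int_eq, eq_intCast, Pi.basisFun_repr] at this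
        exact this.symm
      refine ⟨y, fun j => ?_, by simp [hzy]⟩
      have h4 := (hmem _).1 hx j
      simp only [hzy, Matrix.mulVec_smul, Pi.smul_apply, smul_eq_mul, abs_mul, abs_inv,
        abs_of_pos hN'] at h4
      rwa [inv_mul_le_one₀ hN'] at h4
    · rintro ⟨y, hy, rfl⟩
      refine ⟨(hmem _).2 fun j => ?_, ivec y, ?_, rfl⟩
      · simp only [Matrix.mulVec_smul, Pi.smul_apply, smul_eq_mul, abs_mul, abs_inv,
          abs_of_pos hN']
        rw [inv_mul_le_one₀ hN']
        exact hy j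
      · rw [SetLike.mem_coe, Module.Basis.mem_span_iff_repr_mem]
        intro k
        exact ⟨y k, by simp [ivec]⟩
  rw [h3, Nat.card_coe_set_eq, Set.ncard_image_of_injective, Fintype.card_fin, mul_pow, div_div,
    mul_comm ((N : ℝ) ^ n)]
  exact (smul_right_injective _ (inv_ne_zero hN'.ne')).comp ivec_injective

theorem tendsto_ncard_latticeBox_subspace {g : Matrix (Fin n) (Fin n) ℝ} (hg : g.det = 1)
    {W : Submodule ℝ (Fin n → ℝ)} (hW : W ≠ ⊤) :
    Filter.Tendsto (fun N : ℕ => ((latticeBox g N ∩ {y | ivec y ∈ W}).ncard : ℝ) / (2 * N) ^ n)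
      Filter.atTop (nhds 0) := by
  obtain ⟨u, hu⟩ : ∃ u : Fin n → ℤ, ivec u ∉ W := by
    by_contra! h
    refine hW (eq_top_iff.2 ?_)
    rw [← (Pi.basisFun ℝ (Fin n)).span_eq, Submodule.span_le]
    rintro _ ⟨i, rfl⟩
    have h1 := h (Pi.single i 1)
    have h2 : ivec (Pi.single i 1) = Pi.basisFun ℝ (Fin n) i := by
      funext k
      by_cases hk : k = i
      · subst hk; simp [ivec]
      · simp [ivec, hk]
    rwa [h2] at h1
  obtain ⟨A, hA⟩ : ∃ A : ℕ, ∀ j, |g.mulVec (ivec u) j| ≤ A := by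
    obtain ⟨A, hA⟩ := exists_nat_ge (∑ j, |g.mulVec (ivec u) j|)
    exact ⟨A, fun j => (Finset.single_le_sum (f := fun j => |g.mulVec (ivec u) j|)
      (fun _ _ => abs_nonneg _) (Finset.mem_univ j)).trans hA⟩
  have hkey : ∀ K N : ℕ, (K : ℝ) * (latticeBox g N ∩ {y | ivec y ∈ W}).ncard ≤
      (latticeBox g ((N + K * A : ℕ) : ℝ)).ncard := by
    intro K N
    have hfin := latticeBox_finite hg ((N + K * A : ℕ) : ℝ)
    have hfinW : (latticeBox g N ∩ {y | ivec y ∈ W}).Finite :=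
      (latticeBox_finite hg N).inter_of_left _
    have h1 : ((Set.univ : Set (Fin K)) ×ˢ (latticeBox g N ∩ {y | ivec y ∈ W})).ncard ≤
        (latticeBox g ((N + K * A : ℕ) : ℝ)).ncard := by
      refine Set.ncard_le_ncard_of_injOn
        (fun p : Fin K × (Fin n → ℤ) => p.2 + ((p.1 : ℕ) : ℤ) • u) ?_ ?_ hfin
      · rintro ⟨k, y⟩ ⟨-, hy, -⟩ j
        simp only [ivec_add, ivec_smul, Matrix.mulVec_add, Matrix.mulVec_smul, Pi.add_apply,
          Pi.smul_apply, smul_eq_mul]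
        refine (abs_add_le _ _).trans ?_
        push_cast
        refine add_le_add (hy j) ?_
        rw [abs_mul, Nat.abs_cast]
        refine mul_le_mul ?_ (hA j) (abs_nonneg _) (Nat.cast_nonneg _)
        exact_mod_cast k.2.le
      · rintro ⟨k, y⟩ ⟨-, -, hy⟩ ⟨k', y'⟩ ⟨-, -, hy'⟩ h
        simp only [Set.mem_ofPred_eq] at hy hy'
        have h2 : ivec y + ((k : ℕ) : ℝ) • ivec u = ivec y' + ((k' : ℕ) : ℝ) • ivec u := by
          have := congrArg ivec h
          simpa only [ivec_add, ivec_smul, Int.cast_natCast] using this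
        have h3 : (((k : ℕ) : ℝ) - ((k' : ℕ) : ℝ)) • ivec u ∈ W := by
          have h4 : (((k : ℕ) : ℝ) - ((k' : ℕ) : ℝ)) • ivec u = ivec y' - ivec y := by
            rw [sub_smul, sub_eq_sub_iff_add_eq_add, add_comm _ (ivec y), h2]
          rw [h4]
          exact W.sub_mem hy' hy
        have hk : k = k' := by
          by_contra hne
          refine hu ((W.smul_mem_iff ?_).1 h3)
          rw [sub_ne_zero]
          exact fun h => hne (Fin.ext (by exact_mod_cast h))
        subst hk
        simpa using h
    rw [Set.ncard_prod, Set.ncard_univ, Nat.card_fin] at h1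
    exact_mod_cast h1
  have hlim : ∀ B : ℕ, Filter.Tendsto (fun N : ℕ => ((latticeBox g ((N + B : ℕ) : ℝ)).ncard : ℝ) /
      (2 * N) ^ n) Filter.atTop (nhds 1) := by
    intro B
    have h1 := (tendsto_ncard_latticeBox hg).comp (Filter.tendsto_add_atTop_nat B)
    have h2 : Filter.Tendsto (fun N : ℕ => (((N + B : ℕ) : ℝ) / N) ^ n) Filter.atTop (nhds 1) := by
      have h3 : Filter.Tendsto (fun N : ℕ => 1 + (B : ℝ) / N) Filter.atTop (nhds (1 + 0)) :=
        tendsto_const_nhds.add (tendsto_const_div_atTop_nhds_zero_nat _)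
      rw [add_zero] at h3
      have h4 := h3.pow n
      rw [one_pow] at h4
      refine h4.congr' ?_
      filter_upwards [Filter.eventually_gt_atTop 0] with N hN
      have hN' : (N : ℝ) ≠ 0 := by exact_mod_cast hN.ne'
      rw [Nat.cast_add, add_div, div_self hN']
    have h5 := h1.mul h2
    rw [one_mul] at h5
    refine h5.congr' ?_
    filter_upwards [Filter.eventually_gt_atTop 0] with N hN
    have hN' : (N : ℝ) ≠ 0 := by exact_mod_cast hN.ne'
    have hNB : ((N + B : ℕ) : ℝ) ≠ 0 := by positivity
    simp only [Function.comp_apply]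
    rw [mul_pow, mul_pow, div_pow]
    field_simp
  rw [tendsto_order]
  refine ⟨fun a ha => Filter.Eventually.of_forall fun N => ha.trans_le (by positivity),
    fun ε hε => ?_⟩
  obtain ⟨K, hK⟩ := exists_nat_gt (2 / ε)
  have hK0 : (0 : ℝ) < K := (by positivity : 0 < 2 / ε).trans hK
  filter_upwards [(hlim (K * A)).eventually_lt_const one_lt_two] with N hN
  have h1 := hkey K N
  have h2 : (K : ℝ) * (((latticeBox g N ∩ {y | ivec y ∈ W}).ncard : ℝ) / (2 * N) ^ n) < 2 := by
    rw [← mul_div_assoc]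
    exact (div_le_div_of_nonneg_right h1 (by positivity)).trans_lt hN
  rw [div_lt_iff₀ hε] at hK
  by_contra! hcon
  nlinarith

theorem ncard_latticeBox_le {g : Matrix (Fin n) (Fin n) ℝ} (hg : g.det = 1) (N : ℕ) :
    (latticeBox g N).ncard ≤ (latticeBox g 1).ncard * (2 * N + 1) ^ n := by
  classical
  have hfin := latticeBox_finite hg N
  have hfin1 := latticeBox_finite hg 1
  rw [Set.ncard_eq_toFinset_card _ hfin]
  let φ : (Fin n → ℤ) → Fin n → ℤ := fun y j => ⌊g.mulVec (ivec y) j⌋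
  let T : Finset (Fin n → ℤ) := Fintype.piFinset fun _ => Finset.Icc (-(N : ℤ)) N
  have hT : T.card = (2 * N + 1) ^ n := by
    simp only [T, Fintype.card_piFinset, Int.card_Icc, Finset.prod_const, Finset.card_univ,
      Fintype.card_fin]
    congr 1
    omega
  rw [← hT]
  refine Finset.card_le_mul_card_image_of_maps_to (f := φ) (fun y hy => ?_) _ fun b _ => ?_
  · rw [Set.Finite.mem_toFinset] at hy
    refine Fintype.mem_piFinset.2 fun j => Finset.mem_Icc.2 ⟨?_, ?_⟩
    · refine Int.le_floor.2 ?_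
      push_cast
      exact (abs_le.1 (hy j)).1
    · have h1 : (⌊g.mulVec (ivec y) j⌋ : ℝ) ≤ N :=
        (Int.floor_le _).trans (abs_le.1 (hy j)).2
      exact_mod_cast h1
  · rcases (hfin.toFinset.filter fun y => φ y = b).eq_empty_or_nonempty with h0 | ⟨y₀, hy₀⟩
    · rw [h0]; simp
    · rw [Set.ncard_eq_toFinset_card _ hfin1]
      refine Finset.card_le_card_of_injOn (fun y => y - y₀) (fun y hy => ?_)
        (fun y _ y' _ h => by simpa using h)
      rw [Finset.mem_coe, Set.Finite.mem_toFinset]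
      intro j
      rw [Finset.mem_coe, Finset.mem_filter] at hy
      rw [Finset.mem_filter] at hy₀
      have h1 : ⌊g.mulVec (ivec y) j⌋ = ⌊g.mulVec (ivec y₀) j⌋ := by
        have := congrFun (hy.2.trans hy₀.2.symm) j
        exact this
      rw [ivec_sub, Matrix.mulVec_sub, Pi.sub_apply]
      exact (Int.abs_sub_lt_one_of_floor_eq_floor h1).le

end LatticePoints

section Extension

variable {X : Type*} [MeasurableSpace X] {m n : ℕ} {μ : Measure X}
  {g : X → Matrix (Fin n) (Fin n) ℝ}

/-- Linearly independent tuples whose truncation lies in `O`. -/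
def extTuples (O : Set (Fin m → Fin n → ℤ)) : Set (Fin (m + 1) → Fin n → ℤ) :=
  {w | Fin.init w ∈ O ∧ LinearIndependent ℝ (icast w)}

/-- Number of lattice points in `B` outside the span of the tuple. -/
def outCount (M : Matrix (Fin n) (Fin n) ℝ) (v : Fin m → Fin n → ℤ) (B : Set (Fin n → ℝ)) :
    ℝ≥0∞ :=
  ∑' y : {y : Fin n → ℤ // ivec y ∉ Submodule.span ℝ (Set.range (icast v))},
    B.indicator (1 : (Fin n → ℝ) → ℝ≥0∞) (M.mulVec (ivec y.1))

theorem extTuples_invariant {O : Set (Fin m → Fin n → ℤ)} (hO : SLZInvariant O) :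
    SLZInvariant (extTuples O) := fun γ _ hw =>
  ⟨hO γ _ hw.1, linearIndependent_icast_mulVec γ hw.2⟩

theorem icast_snoc (v : Fin m → Fin n → ℤ) (y : Fin n → ℤ) :
    icast (Fin.snoc v y : Fin (m + 1) → Fin n → ℤ) =
      (Fin.snoc (icast v) (ivec y) : Fin (m + 1) → Fin n → ℝ) := by
  funext i
  refine Fin.lastCases ?_ (fun i => ?_) i
  · funext j; simp [icast, ivec]
  · funext j; simp [icast]

/-- Extended tuples are pairs of a tuple and a vector outside its span. -/
def extTuplesEquiv (O : Set (Fin m → Fin n → ℤ)) (hind : ∀ v ∈ O, LinearIndependent ℝ (icast v)) :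
    extTuples O ≃
      (Σ v : O, {y : Fin n → ℤ // ivec y ∉ Submodule.span ℝ (Set.range (icast v.1))}) where
  toFun w := ⟨⟨Fin.init w.1, w.2.1⟩, ⟨w.1 (Fin.last m), by
    have h := w.2.2
    rw [← Fin.snoc_init_self w.1, icast_snoc, linearIndependent_finSnoc] at h
    exact h.2⟩⟩
  invFun p := ⟨Fin.snoc p.1.1 p.2.1, by
    refine ⟨by rw [Fin.init_snoc]; exact p.1.2, ?_⟩
    rw [icast_snoc, linearIndependent_finSnoc]
    exact ⟨hind _ p.1.2, p.2.2⟩⟩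
  left_inv w := by
    ext1; exact Fin.snoc_init_self w.1
  right_inv p := by
    obtain ⟨⟨v, hv⟩, ⟨y, hy⟩⟩ := p
    exact Sigma.subtype_ext (Subtype.ext (Fin.init_snoc (α := fun _ => Fin n → ℤ) y v))
      (Fin.snoc_last (α := fun _ => Fin n → ℤ) y v)

theorem tsum_extTuples (M : Matrix (Fin n) (Fin n) ℝ) (O : Set (Fin m → Fin n → ℤ))
    (hind : ∀ v ∈ O, LinearIndependent ℝ (icast v)) (f : (Fin m → Fin n → ℝ) → ℝ≥0∞)
    (B : Set (Fin n → ℝ)) :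
    ∑' w : extTuples O, f (Fin.init (act M (icast w.1))) *
        B.indicator (1 : (Fin n → ℝ) → ℝ≥0∞) (act M (icast w.1) (Fin.last m)) =
      ∑' v : O, f (act M (icast v.1)) * outCount M v.1 B := by
  rw [← (extTuplesEquiv O hind).symm.tsum_eq, ENNReal.tsum_sigma']
  refine tsum_congr fun v => ?_
  rw [outCount, ← ENNReal.tsum_mul_left]
  refine tsum_congr fun y => ?_
  have h : act M (icast ((extTuplesEquiv O hind).symm ⟨v, y⟩).1) =
      (Fin.snoc (act M (icast v.1)) (M.mulVec (ivec y.1)) : Fin (m + 1) → Fin n → ℝ) := by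
    show act M (icast (Fin.snoc v.1 y.1 : Fin (m + 1) → Fin n → ℤ)) = _
    rw [icast_snoc]
    funext i
    refine Fin.lastCases ?_ (fun i => ?_) i <;> simp [act]
  rw [h, Fin.init_snoc, Fin.snoc_last]

theorem lintegral_init_mul_last {f : (Fin m → Fin n → ℝ) → ℝ≥0∞} (hf : Measurable f)
    {h : (Fin n → ℝ) → ℝ≥0∞} (hh : Measurable h) :
    ∫⁻ x : Fin (m + 1) → Fin n → ℝ, f (Fin.init x) * h (x (Fin.last m)) =
      (∫⁻ x, f x) * ∫⁻ y, h y := by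
  have h1 := (volume_preserving_piFinSuccAbove (fun _ : Fin (m + 1) => Fin n → ℝ) (Fin.last m))
  have h2 := h1.lintegral_comp (f := fun p => h p.1 * f p.2)
    ((hh.comp measurable_fst).mul (hf.comp measurable_snd))
  rw [Measure.volume_eq_prod, lintegral_prod_mul hh.aemeasurable hf.aemeasurable, mul_comm] at h2
  rw [← h2]
  refine lintegral_congr fun x => ?_
  rw [mul_comm]
  simp [MeasurableEquiv.piFinSuccAbove, Fin.insertNthEquiv, Fin.removeNth_last]

theorem measurable_finInit : Measurable (Fin.init : (Fin (m + 1) → Fin n → ℝ) → _) :=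
  measurable_pi_lambda _ fun i => measurable_pi_apply i.castSucc

theorem lintegral_tsum_outCount [SFinite μ] (hg : IsInvariantFrame μ g) (hmn : m + 1 < n)
    {O : Set (Fin m → Fin n → ℤ)} (hO : SLZInvariant O)
    (hind : ∀ v ∈ O, LinearIndependent ℝ (icast v))
    {f : (Fin m → Fin n → ℝ) → ℝ≥0∞} (hf : Measurable f)
    {B : Set (Fin n → ℝ)} (hB : MeasurableSet B) :
    ∫⁻ L, ∑' v : O, f (act (g L) (icast v.1)) * outCount (g L) v.1 B ∂μ =
      rogersConst μ g (extTuples O) * ((∫⁻ x, f x) * volume B) := by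
  have h1 : Measurable (B.indicator (1 : (Fin n → ℝ) → ℝ≥0∞)) := measurable_one.indicator hB
  have h2 := lintegral_tsum_eq (f := fun x => f (Fin.init x) *
    B.indicator (1 : (Fin n → ℝ) → ℝ≥0∞) (x (Fin.last m))) hg hmn (extTuples_invariant hO)
    (fun w hw => hw.2)
    ((hf.comp measurable_finInit).mul (h1.comp (measurable_pi_apply _)))
  rw [lintegral_init_mul_last hf h1, lintegral_indicator_one hB] at h2
  rw [← h2]
  exact lintegral_congr fun L => (tsum_extTuples (g L) O hind f B).symm

end Extension

section Limits

variable {X ι : Type*} [MeasurableSpace X] {μ : Measure X} [Countable ι]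

theorem lintegral_tsum_eq_lintegral_prod [MeasurableSpace ι] [MeasurableSingletonClass ι]
    {F : X → ι → ℝ≥0∞} (hF : ∀ v, Measurable fun L => F L v) :
    ∫⁻ p, F p.1 p.2 ∂(μ.prod Measure.count) = ∫⁻ L, ∑' v, F L v ∂μ := by
  have h : Measurable fun p : X × ι => F p.1 p.2 :=
    measurable_from_prod_countable_left fun v => hF v
  rw [lintegral_prod _ h.aemeasurable]
  exact lintegral_congr fun L => lintegral_count _

theorem lintegral_tsum_le_of_tendsto [SFinite μ] {F : ℕ → X → ι → ℝ≥0∞} {F₀ : X → ι → ℝ≥0∞}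
    (hF : ∀ N v, Measurable fun L => F N L v) (hF₀ : ∀ v, Measurable fun L => F₀ L v)
    (hlim : ∀ L v, Filter.Tendsto (fun N => F N L v) Filter.atTop (nhds (F₀ L v))) {a : ℝ≥0∞}
    (ha : ∀ᶠ N in Filter.atTop, ∫⁻ L, ∑' v, F N L v ∂μ ≤ a) :
    ∫⁻ L, ∑' v, F₀ L v ∂μ ≤ a := by
  let _ : MeasurableSpace ι := ⊤
  have : MeasurableSingletonClass ι := ⟨fun _ => trivial⟩
  rw [← lintegral_tsum_eq_lintegral_prod hF₀]
  have h1 : ∫⁻ p, F₀ p.1 p.2 ∂(μ.prod Measure.count) ≤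
      Filter.liminf (fun N => ∫⁻ p, F N p.1 p.2 ∂(μ.prod Measure.count)) Filter.atTop := by
    refine le_trans (le_of_eq ?_) (lintegral_liminf_le fun N =>
      measurable_from_prod_countable_left fun v => hF N v)
    exact lintegral_congr fun p => (hlim p.1 p.2).liminf_eq.symm
  refine h1.trans ?_
  simp only [lintegral_tsum_eq_lintegral_prod (hF _)]
  refine Filter.liminf_le_of_frequently_le' ha.frequently

theorem tendsto_lintegral_tsum [SFinite μ] {F : ℕ → X → ι → ℝ≥0∞} {F₀ G : X → ι → ℝ≥0∞}
    (hF : ∀ N v, Measurable fun L => F N L v) (hF₀ : ∀ v, Measurable fun L => F₀ L v)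
    (hG : ∀ v, Measurable fun L => G L v)
    (hlim : ∀ L v, Filter.Tendsto (fun N => F N L v) Filter.atTop (nhds (F₀ L v)))
    (hFG : ∀ N L v, F N L v ≤ G L v) (hfin : ∫⁻ L, ∑' v, G L v ∂μ ≠ ∞) :
    Filter.Tendsto (fun N => ∫⁻ L, ∑' v, F N L v ∂μ) Filter.atTop
      (nhds (∫⁻ L, ∑' v, F₀ L v ∂μ)) := by
  let _ : MeasurableSpace ι := ⊤
  have : MeasurableSingletonClass ι := ⟨fun _ => trivial⟩
  simp only [← lintegral_tsum_eq_lintegral_prod (hF _), ← lintegral_tsum_eq_lintegral_prod hF₀]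
  rw [← lintegral_tsum_eq_lintegral_prod hG] at hfin
  exact tendsto_lintegral_of_dominated_convergence _
    (fun N => measurable_from_prod_countable_left fun v => hF N v)
    (fun N => Filter.Eventually.of_forall fun p => hFG N p.1 p.2) hfin
    (Filter.Eventually.of_forall fun p => hlim p.1 p.2)

end Limits

section CubeCount

variable {m n : ℕ}

/-- The cube of half-side `R` centred at the origin. -/
def cube (n : ℕ) (R : ℝ) : Set (Fin n → ℝ) := Set.univ.pi fun _ => Set.Icc (-R) R

theorem mem_cube {R : ℝ} {x : Fin n → ℝ} : x ∈ cube n R ↔ ∀ j, |x j| ≤ R := by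
  simp only [cube, Set.mem_univ_pi, Set.mem_Icc, abs_le]

theorem measurableSet_cube (R : ℝ) : MeasurableSet (cube n R) :=
  MeasurableSet.univ_pi fun _ => measurableSet_Icc

theorem volume_cube (N : ℕ) : volume (cube n N) = (2 * N : ℝ≥0∞) ^ n := by
  rw [cube, volume_pi_pi]
  simp only [Real.volume_Icc, Finset.prod_const, Finset.card_univ, Fintype.card_fin]
  congr 1
  rw [show (N : ℝ) - -N = ((2 * N : ℕ) : ℝ) by push_cast; ring, ENNReal.ofReal_natCast]
  push_cast; rfl

theorem outCount_cube {M : Matrix (Fin n) (Fin n) ℝ} (hM : M.det = 1) (v : Fin m → Fin n → ℤ)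
    (R : ℝ) : outCount M v (cube n R) =
      ((latticeBox M R \ {y | ivec y ∈ Submodule.span ℝ (Set.range (icast v))}).ncard : ℝ≥0∞) := by
  have hfin := (latticeBox_finite hM R).subset (Set.sdiff_subset
    (t := {y | ivec y ∈ Submodule.span ℝ (Set.range (icast v))}))
  refine (tsum_subtype {y : Fin n → ℤ | ivec y ∉ Submodule.span ℝ (Set.range (icast v))}
    (fun y => (cube n R).indicator (1 : (Fin n → ℝ) → ℝ≥0∞) (M.mulVec (ivec y)))).trans ?_
  have h1 : ∀ y : Fin n → ℤ, ({y | ivec y ∉ Submodule.span ℝ (Set.range (icast v))}.indicator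
      (fun y => (cube n R).indicator (1 : (Fin n → ℝ) → ℝ≥0∞) (M.mulVec (ivec y)))) y =
      (latticeBox M R \ {y | ivec y ∈ Submodule.span ℝ (Set.range (icast v))}).indicator
        (1 : (Fin n → ℤ) → ℝ≥0∞) y := by
    intro y
    have h2 : M.mulVec (ivec y) ∈ cube n R ↔ y ∈ latticeBox M R := mem_cube
    classical
    by_cases h1 : ivec y ∈ Submodule.span ℝ (Set.range (icast v)) <;>
      simp [Set.indicator_apply, h1, h2]
  rw [tsum_congr h1, ← tsum_subtype]
  simp only [Pi.one_apply, ENNReal.tsum_set_one]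
  rw [← hfin.cast_ncard_eq]
  simp

theorem tendsto_outCount_cube {M : Matrix (Fin n) (Fin n) ℝ} (hM : M.det = 1) (hmn : m < n)
    (v : Fin m → Fin n → ℤ) :
    Filter.Tendsto (fun N : ℕ => outCount M v (cube n N) / (2 * N : ℝ≥0∞) ^ n) Filter.atTop
      (nhds 1) := by
  set W := Submodule.span ℝ (Set.range (icast v)) with hW
  have hWtop : W ≠ ⊤ := by
    intro h
    have h1 := finrank_range_le_card (R := ℝ) (icast v)
    rw [Set.finrank, ← hW, h, finrank_top] at h1
    simp at h1
    omega
  have h1 := (tendsto_ncard_latticeBox hM).sub (tendsto_ncard_latticeBox_subspace hM hWtop)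
  rw [sub_zero] at h1
  have h2 := ENNReal.tendsto_ofReal h1
  rw [ENNReal.ofReal_one] at h2
  refine h2.congr' ?_
  filter_upwards [Filter.eventually_gt_atTop 0] with N hN
  have hN' : (0 : ℝ) < N := by exact_mod_cast hN
  have h3 := Set.ncard_inter_add_ncard_sdiff_eq_ncard (latticeBox M N) {y | ivec y ∈ W}
    (latticeBox_finite hM N)
  rw [← sub_div, ← h3, outCount_cube hM, ENNReal.ofReal_div_of_pos (by positivity)]
  push_cast
  rw [add_sub_cancel_left, ENNReal.ofReal_natCast, ENNReal.ofReal_pow (by positivity),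
    ENNReal.ofReal_mul (by norm_num)]
  simp [hW]

end CubeCount

section MeanValue

variable {X : Type*} [MeasurableSpace X] {m n : ℕ} {μ : Measure X}
  {g : X → Matrix (Fin n) (Fin n) ℝ}

theorem measurable_outCount (hg : ∀ i j, Measurable fun L => g L i j) (v : Fin m → Fin n → ℤ)
    {B : Set (Fin n → ℝ)} (hB : MeasurableSet B) : Measurable fun L => outCount (g L) v B := by
  unfold outCount
  refine Measurable.tsum fun y => (measurable_one.indicator hB).comp ?_
  exact (measurable_pi_apply (0 : Fin 1)).comp
    (measurable_act_icast (m := 1) hg fun _ => y.1)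

theorem lintegral_tsum_outCount_div [SFinite μ] (hg : IsInvariantFrame μ g) (hmn : m + 1 < n)
    {O : Set (Fin m → Fin n → ℤ)} (hO : SLZInvariant O)
    (hind : ∀ v ∈ O, LinearIndependent ℝ (icast v))
    {f : (Fin m → Fin n → ℝ) → ℝ≥0∞} (hf : Measurable f) {N : ℕ} (hN : 0 < N) :
    ∫⁻ L, ∑' v : O, f (act (g L) (icast v.1)) *
      (outCount (g L) v.1 (cube n N) / (2 * N : ℝ≥0∞) ^ n) ∂μ =
      rogersConst μ g (extTuples O) * ∫⁻ x, f x := by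
  have h1 := lintegral_tsum_outCount hg hmn hO hind hf (measurableSet_cube (n := n) N)
  have h0 : (2 * N : ℝ≥0∞) ^ n ≠ 0 := by
    have : (N : ℝ≥0∞) ≠ 0 := by exact_mod_cast hN.ne'
    positivity
  have ht : (2 * N : ℝ≥0∞) ^ n ≠ ∞ :=
    ENNReal.pow_ne_top (ENNReal.mul_ne_top (by norm_num) (ENNReal.natCast_ne_top N))
  have h2 : ∀ L, ∑' v : O, f (act (g L) (icast v.1)) *
      (outCount (g L) v.1 (cube n N) / (2 * N : ℝ≥0∞) ^ n) =
      (∑' v : O, f (act (g L) (icast v.1)) * outCount (g L) v.1 (cube n N)) *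
        ((2 * N : ℝ≥0∞) ^ n)⁻¹ := by
    intro L
    rw [← ENNReal.tsum_mul_right]
    exact tsum_congr fun v => by rw [div_eq_mul_inv, mul_assoc]
  simp only [h2]
  rw [lintegral_mul_const' _ _ (ENNReal.inv_ne_top.2 h0), h1, volume_cube, mul_assoc, mul_assoc,
    ENNReal.mul_inv_cancel h0 ht, mul_one]

theorem tendsto_mul_outCount (hg : IsInvariantFrame μ g) (hmn : m < n)
    (L : X) (v : Fin m → Fin n → ℤ) (a : ℝ≥0∞) :
    Filter.Tendsto (fun N : ℕ => a * (outCount (g L) v (cube n N) / (2 * N : ℝ≥0∞) ^ n))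
      Filter.atTop (nhds a) := by
  have h := ENNReal.Tendsto.const_mul (a := a) (tendsto_outCount_cube (hg.det_eq_one L) hmn v)
    (Or.inl one_ne_zero)
  rwa [mul_one] at h

/-- Tuples close to the first standard basis vectors. -/
def frameNhd (m n : ℕ) : Set (Fin m → Fin n → ℝ) :=
  Set.univ.pi fun i => Set.univ.pi fun j => Set.Icc
    ((if i.1 = j.1 then 1 else 0) - 1 / (2 * (m + 1))) ((if i.1 = j.1 then 1 else 0) +
      1 / (2 * (m + 1)))

theorem measurableSet_frameNhd : MeasurableSet (frameNhd m n) :=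
  MeasurableSet.univ_pi fun _ => MeasurableSet.univ_pi fun _ => measurableSet_Icc

theorem volume_frameNhd : volume (frameNhd m n) ≠ 0 ∧ volume (frameNhd m n) ≠ ∞ := by
  rw [frameNhd, volume_pi_pi]
  simp only [volume_pi_pi, Real.volume_Icc]
  constructor
  · refine Finset.prod_ne_zero_iff.2 fun i _ => Finset.prod_ne_zero_iff.2 fun j _ => ?_
    have h : (0 : ℝ) < 1 / (2 * (m + 1)) := by positivity
    rw [Ne, ENNReal.ofReal_eq_zero, not_le]
    linarith
  · exact ENNReal.prod_ne_top fun i _ => ENNReal.prod_ne_top fun j _ => ENNReal.ofReal_ne_top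

theorem abs_coeff_le_two_of_mem_frameNhd (hmn : m ≤ n) {x : Fin m → Fin n → ℝ}
    (hx : x ∈ frameNhd m n) {t : Fin m → ℝ} (ht : ∀ j, |(∑ i, t i • x i) j| ≤ 1) (i : Fin m) :
    |t i| ≤ 2 := by
  obtain ⟨i₀, -, h0⟩ := Finset.exists_max_image Finset.univ (fun i => |t i|) ⟨i, Finset.mem_univ i⟩
  refine (h0 i (Finset.mem_univ i)).trans ?_
  have hε : (0 : ℝ) < 1 / (2 * (m + 1)) := by positivity
  set j₀ : Fin n := Fin.castLE hmn i₀ with hj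
  have h1 : ∀ i, |x i j₀ - (if i = i₀ then 1 else 0)| ≤ 1 / (2 * (m + 1)) := by
    intro i
    have h2 := (Set.mem_univ_pi.1 ((Set.mem_univ_pi.1 hx) i)) j₀
    have h3 : (i.1 = j₀.1) = (i = i₀) := by simp [hj, Fin.ext_iff]
    simp only [h3, Set.mem_Icc] at h2
    rw [abs_le]
    constructor <;> linarith [h2.1, h2.2]
  have h2 : (∑ i, t i • x i) j₀ = t i₀ + ∑ i, t i * (x i j₀ - if i = i₀ then 1 else 0) := by
    simp [Finset.sum_apply, mul_sub, Finset.sum_sub_distrib]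
  have h3 : |∑ i, t i * (x i j₀ - if i = i₀ then 1 else 0)| ≤ |t i₀| / 2 := by
    refine (Finset.abs_sum_le_sum_abs _ _).trans ?_
    have h4 : ∀ i ∈ Finset.univ, |t i * (x i j₀ - if i = i₀ then 1 else 0)| ≤
        |t i₀| * (1 / (2 * (m + 1))) := by
      intro i hi
      rw [abs_mul]
      exact mul_le_mul (h0 i hi) (h1 i) (abs_nonneg _) (abs_nonneg _)
    refine (Finset.sum_le_card_nsmul _ _ _ h4).trans ?_
    rw [Finset.card_univ, Fintype.card_fin, nsmul_eq_mul]
    have h5 : (m : ℝ) * (1 / (2 * (m + 1))) ≤ 1 / 2 := by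
      rw [mul_one_div, div_le_div_iff₀ (by positivity) (by norm_num)]
      linarith
    nlinarith [abs_nonneg (t i₀)]
  have h4 := ht j₀
  rw [h2] at h4
  have h5 := abs_sub_abs_le_abs_sub (t i₀) (-∑ i, t i * (x i j₀ - if i = i₀ then 1 else 0))
  rw [sub_neg_eq_add, abs_neg] at h5
  linarith

theorem rogersConst_le_extTuples [SFinite μ] (hg : IsInvariantFrame μ g) (hmn : m + 1 < n)
    {O : Set (Fin m → Fin n → ℤ)} (hO : SLZInvariant O)
    (hind : ∀ v ∈ O, LinearIndependent ℝ (icast v)) :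
    rogersConst μ g O ≤ rogersConst μ g (extTuples O) := by
  set f : (Fin m → Fin n → ℝ) → ℝ≥0∞ := (frameNhd m n).indicator 1 with hf
  have hfm : Measurable f := measurable_one.indicator measurableSet_frameNhd
  have hfi : ∫⁻ x, f x = volume (frameNhd m n) := lintegral_indicator_one measurableSet_frameNhd
  have hact : ∀ v : O, Measurable fun L => f (act (g L) (icast v.1)) := fun v =>
    hfm.comp (measurable_act_icast hg.measurable v.1)
  have h1 := lintegral_tsum_le_of_tendsto (μ := μ)
    (F := fun N L (v : O) => f (act (g L) (icast v.1)) *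
      (outCount (g L) v.1 (cube n N) / (2 * N : ℝ≥0∞) ^ n))
    (F₀ := fun L (v : O) => f (act (g L) (icast v.1)))
    (a := rogersConst μ g (extTuples O) * ∫⁻ x, f x)
    (fun N v => (hact v).mul ((measurable_outCount hg.measurable v.1
      (measurableSet_cube _)).div_const _)) hact
    (fun L v => tendsto_mul_outCount hg (by omega) L v.1 _)
    (by
      filter_upwards [Filter.eventually_gt_atTop 0] with N hN
      exact (lintegral_tsum_outCount_div hg hmn hO hind hfm hN).le)
  rw [lintegral_tsum_eq hg (by omega) hO hind hfm, hfi] at h1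
  exact (ENNReal.mul_le_mul_iff_left volume_frameNhd.1 volume_frameNhd.2).1 h1

/-- Integer vectors that are combinations of the tuple with coefficients at most two. -/
def shortCombos (v : Fin m → Fin n → ℤ) : Set (Fin n → ℤ) :=
  {z | ∃ t : Fin m → ℝ, (∀ i, |t i| ≤ 2) ∧ ivec z = ∑ i, t i • icast v i}

theorem shortCombos_finite (v : Fin m → Fin n → ℤ) : (shortCombos v).Finite := by
  set B : Fin n → ℤ := fun k => ∑ i, 2 * |v i k| with hB
  refine (Set.Finite.pi' (t := fun k : Fin n => Set.Icc (-B k) (B k))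
    fun _ => Set.finite_Icc _ _).subset ?_
  rintro z ⟨t, ht, hz⟩ k
  have h1 : |(z k : ℝ)| ≤ B k := by
    have h2 : (z k : ℝ) = ∑ i, t i * (v i k : ℝ) := by
      have := congrFun hz k
      simpa [ivec, icast, Finset.sum_apply] using this
    rw [h2, hB]
    push_cast
    refine (Finset.abs_sum_le_sum_abs _ _).trans (Finset.sum_le_sum fun i _ => ?_)
    rw [abs_mul]
    exact mul_le_mul_of_nonneg_right (ht i) (abs_nonneg _)
  have h5 := abs_le.1 h1
  exact ⟨by exact_mod_cast h5.1, by exact_mod_cast h5.2⟩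

/-- All integer tuples that are linearly independent over `ℝ`. -/
def indepTuples (m n : ℕ) : Set (Fin m → Fin n → ℤ) := {v | LinearIndependent ℝ (icast v)}

theorem indepTuples_invariant : SLZInvariant (indepTuples m n) := fun γ _ hv =>
  linearIndependent_icast_mulVec γ hv

/-- Independent tuples with at most `K` short combinations. -/
def thinTuples (m n K : ℕ) : Set (Fin m → Fin n → ℤ) :=
  {v | LinearIndependent ℝ (icast v) ∧ (shortCombos v).encard ≤ K}

theorem thinTuples_mono : Monotone (thinTuples m n) := fun K K' h _ hv =>
  ⟨hv.1, hv.2.trans (by exact_mod_cast h)⟩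

theorem iUnion_thinTuples : ⋃ K, thinTuples m n K = indepTuples m n := by
  ext v
  refine ⟨fun h => ?_, fun h => ?_⟩
  · obtain ⟨K, hK⟩ := Set.mem_iUnion.1 h
    exact hK.1
  · refine Set.mem_iUnion.2 ⟨(shortCombos v).ncard, h, ?_⟩
    rw [(shortCombos_finite v).cast_ncard_eq]

theorem thinTuples_invariant (K : ℕ) : SLZInvariant (thinTuples m n K) := by
  rintro γ v ⟨hv, hK⟩
  refine ⟨linearIndependent_icast_mulVec γ hv, le_trans ?_ hK⟩
  have hcast : ∀ (δ : Matrix.SpecialLinearGroup (Fin n) ℤ) (z : Fin n → ℤ),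
      ivec (δ.1.mulVec z) =
        (Matrix.SpecialLinearGroup.map (Int.castRingHom ℝ) δ).1.mulVec (ivec z) := by
    intro δ v; funext j; simp [Matrix.mulVec, dotProduct, ivec]
  have h : shortCombos (fun i => γ.1.mulVec (v i)) ⊆ γ.1.mulVec '' shortCombos v := by
    rintro z ⟨t, ht, hz⟩
    refine ⟨(γ⁻¹).1.mulVec z, ⟨t, ht, ?_⟩, ?_⟩
    · rw [hcast, hz, Matrix.mulVec_sum]
      refine Finset.sum_congr rfl fun i _ => ?_
      rw [Matrix.mulVec_smul]
      congr 1
      rw [icast_mulVec, act, Matrix.mulVec_mulVec, ← Matrix.SpecialLinearGroup.coe_mul, ← map_mul,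
        inv_mul_cancel, map_one, Matrix.SpecialLinearGroup.coe_one, Matrix.one_mulVec]
    · rw [Matrix.mulVec_mulVec, ← Matrix.SpecialLinearGroup.coe_mul, mul_inv_cancel,
        Matrix.SpecialLinearGroup.coe_one, Matrix.one_mulVec]
  exact (Set.encard_le_encard h).trans (Set.encard_image_le _ _)

theorem extTuples_indepTuples : extTuples (indepTuples m n) = indepTuples (m + 1) n := by
  ext w
  refine ⟨fun h => h.2, fun h => ⟨?_, h⟩⟩
  have h1 : LinearIndependent ℝ (icast w) := h
  rw [← Fin.snoc_init_self w, icast_snoc, linearIndependent_finSnoc] at h1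
  exact h1.1

theorem ncard_latticeBox_one_le {M : Matrix (Fin n) (Fin n) ℝ} (hM : M.det = 1) (hmn : m ≤ n)
    {K : ℕ} {v : Fin m → Fin n → ℤ} (hv : v ∈ thinTuples m n K)
    (hf : act M (icast v) ∈ frameNhd m n) :
    ((latticeBox M 1).ncard : ℝ≥0∞) ≤ K + outCount M v (cube n 1) := by
  have h3 := Set.ncard_inter_add_ncard_sdiff_eq_ncard (latticeBox M 1)
    {y | ivec y ∈ Submodule.span ℝ (Set.range (icast v))} (latticeBox_finite hM 1)
  rw [outCount_cube hM, ← h3]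
  push_cast
  gcongr
  have h4 : latticeBox M 1 ∩ {y | ivec y ∈ Submodule.span ℝ (Set.range (icast v))} ⊆
      shortCombos v := by
    rintro y ⟨hy, hys⟩
    obtain ⟨t, ht⟩ := (Submodule.mem_span_range_iff_exists_fun ℝ).1 hys
    refine ⟨t, abs_coeff_le_two_of_mem_frameNhd hmn hf fun j => ?_, ht.symm⟩
    have h5 : ∑ i, t i • act M (icast v) i = M.mulVec (ivec y) := by
      rw [← ht, Matrix.mulVec_sum]
      exact Finset.sum_congr rfl fun i _ => (Matrix.mulVec_smul _ _ _).symm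
    rw [h5]
    exact hy j
  have h6 : ((shortCombos v).ncard : ℕ∞) ≤ K := by
    rw [(shortCombos_finite v).cast_ncard_eq]
    exact hv.2
  have h7 := (Set.ncard_le_ncard h4 (shortCombos_finite v)).trans (by exact_mod_cast h6)
  exact_mod_cast h7

theorem outCount_div_le {M : Matrix (Fin n) (Fin n) ℝ} (hM : M.det = 1) (hmn : m ≤ n)
    {K : ℕ} {v : Fin m → Fin n → ℤ} (hv : v ∈ thinTuples m n K)
    (hf : act M (icast v) ∈ frameNhd m n) {N : ℕ} (hN : 0 < N) :
    outCount M v (cube n N) / (2 * N : ℝ≥0∞) ^ n ≤ 2 ^ n * (K + outCount M v (cube n 1)) := by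
  refine ENNReal.div_le_of_le_mul ?_
  have h1 : outCount M v (cube n N) ≤ ((latticeBox M N).ncard : ℝ≥0∞) := by
    rw [outCount_cube hM]
    exact_mod_cast Set.ncard_le_ncard Set.sdiff_subset (latticeBox_finite hM N)
  have h2 : ((latticeBox M N).ncard : ℝ≥0∞) ≤ (latticeBox M 1).ncard * (2 * N + 1) ^ n := by
    exact_mod_cast ncard_latticeBox_le hM N
  have h3 : ((2 : ℝ≥0∞) * N + 1) ^ n ≤ 2 ^ n * (2 * N) ^ n := by
    rw [← mul_pow]
    gcongr
    have : 2 * N + 1 ≤ 2 * (2 * N) := by omega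
    exact_mod_cast this
  calc outCount M v (cube n N) ≤ (latticeBox M 1).ncard * (2 * N + 1) ^ n := h1.trans h2
    _ ≤ (K + outCount M v (cube n 1)) * (2 ^ n * (2 * N) ^ n) := by
        gcongr
        exact ncard_latticeBox_one_le hM hmn hv hf
    _ = 2 ^ n * (K + outCount M v (cube n 1)) * (2 * N) ^ n := by ring

theorem rogersConst_mono {O O' : Set (Fin m → Fin n → ℤ)} (h : O ⊆ O') :
    rogersConst μ g O ≤ rogersConst μ g O' := by
  obtain ⟨κ, hκ⟩ := exists_measure_eq_rogersConst (m := m) μ g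
  rw [hκ, hκ]
  exact measure_mono h

theorem rogersConst_extTuples_thin [SFinite μ] (hg : IsInvariantFrame μ g) (hmn : m + 1 < n)
    (hfin : rogersConst μ g (indepTuples (m + 1) n) < ∞) (K : ℕ) :
    rogersConst μ g (extTuples (thinTuples m n K)) = rogersConst μ g (thinTuples m n K) := by
  set O := thinTuples m n K with hOdef
  have hO : SLZInvariant O := thinTuples_invariant K
  have hind : ∀ v ∈ O, LinearIndependent ℝ (icast v) := fun v hv => hv.1
  have hfin1 : rogersConst μ g (extTuples O) < ∞ :=
    (rogersConst_mono fun w hw => hw.2).trans_lt hfin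
  have hfin0 : rogersConst μ g O < ∞ := (rogersConst_le_extTuples hg hmn hO hind).trans_lt hfin1
  set f : (Fin m → Fin n → ℝ) → ℝ≥0∞ := (frameNhd m n).indicator 1 with hf
  have hfm : Measurable f := measurable_one.indicator measurableSet_frameNhd
  have hfi : ∫⁻ x, f x = volume (frameNhd m n) := lintegral_indicator_one measurableSet_frameNhd
  have hact : ∀ v : O, Measurable fun L => f (act (g L) (icast v.1)) := fun v =>
    hfm.comp (measurable_act_icast hg.measurable v.1)
  have hcnt : ∀ (v : O) (R : ℝ), Measurable fun L => outCount (g L) v.1 (cube n R) := fun v R =>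
    measurable_outCount hg.measurable v.1 (measurableSet_cube R)
  have h1 := tendsto_lintegral_tsum (μ := μ)
    (F := fun N L (v : O) => f (act (g L) (icast v.1)) *
      (outCount (g L) v.1 (cube n (N + 1 : ℕ)) / (2 * (N + 1 : ℕ) : ℝ≥0∞) ^ n))
    (F₀ := fun L (v : O) => f (act (g L) (icast v.1)))
    (G := fun L (v : O) => f (act (g L) (icast v.1)) *
      (2 ^ n * (K + outCount (g L) v.1 (cube n 1))))
    (fun N v => (hact v).mul ((hcnt v _).div_const _)) hact
    (fun v => (hact v).mul (((hcnt v _).const_add _).const_mul _))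
    (fun L v => (Filter.tendsto_add_atTop_iff_nat 1).2
      (tendsto_mul_outCount hg (by omega) L v.1 _))
    (fun N L v => by
      by_cases hx : act (g L) (icast v.1) ∈ frameNhd m n
      · gcongr
        exact outCount_div_le (hg.det_eq_one L) (by omega) v.2 hx (Nat.succ_pos N)
      · simp [hf, hx])
    (by
      have h2 : ∀ L, ∑' v : O, f (act (g L) (icast v.1)) *
          (2 ^ n * (K + outCount (g L) v.1 (cube n 1))) =
          2 ^ n * (K * (∑' v : O, f (act (g L) (icast v.1))) +
            ∑' v : O, f (act (g L) (icast v.1)) * outCount (g L) v.1 (cube n 1)) := by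
        intro L
        rw [← ENNReal.tsum_mul_left, ← ENNReal.tsum_add, ← ENNReal.tsum_mul_left]
        exact tsum_congr fun v => by ring
      simp only [h2]
      rw [lintegral_const_mul' _ _ (ENNReal.pow_ne_top (by norm_num)),
        lintegral_add_left ((Measurable.tsum hact).const_mul _),
        lintegral_const_mul' _ _ (ENNReal.natCast_ne_top K),
        lintegral_tsum_eq hg (by omega) hO hind hfm,
        lintegral_tsum_outCount hg hmn hO hind hfm (measurableSet_cube _), hfi]
      have hc : volume (cube n 1) ≠ ∞ := by
        have := volume_cube (n := n) 1
        rw [Nat.cast_one] at this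
        rw [this]
        exact ENNReal.pow_ne_top (by norm_num)
      have := volume_frameNhd (m := m) (n := n)
      finiteness [hfin0.ne, hfin1.ne, this.2])
  simp only [fun N => lintegral_tsum_outCount_div hg hmn hO hind hfm (Nat.succ_pos N),
    lintegral_tsum_eq hg (show m < n by omega) hO hind hfm] at h1
  have h2 := tendsto_nhds_unique tendsto_const_nhds h1
  rw [hfi] at h2
  exact (ENNReal.mul_left_inj volume_frameNhd.1 volume_frameNhd.2).1 h2

theorem rogersConst_indepTuples_succ [SFinite μ] (hg : IsInvariantFrame μ g) (hmn : m + 1 < n)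
    (hfin : rogersConst μ g (indepTuples (m + 1) n) < ∞) :
    rogersConst μ g (indepTuples (m + 1) n) = rogersConst μ g (indepTuples m n) := by
  obtain ⟨κ, hκ⟩ := exists_measure_eq_rogersConst (m := m) μ g
  obtain ⟨κ', hκ'⟩ := exists_measure_eq_rogersConst (m := m + 1) μ g
  have h1 : ⋃ K, extTuples (thinTuples m n K) = indepTuples (m + 1) n := by
    rw [← extTuples_indepTuples, ← iUnion_thinTuples]
    ext w
    simp [extTuples]
  have h2 : Monotone fun K => extTuples (thinTuples m n K) := fun K K' h w hw =>
    ⟨thinTuples_mono h hw.1, hw.2⟩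
  rw [← h1, ← iUnion_thinTuples, hκ, hκ', h2.measure_iUnion, thinTuples_mono.measure_iUnion]
  refine iSup_congr fun K => ?_
  rw [← hκ, ← hκ', rogersConst_extTuples_thin hg hmn hfin]

theorem rogersConst_indepTuples_lt_top [IsProbabilityMeasure μ] (hg : IsInvariantFrame μ g)
    (hmn : m < n) : rogersConst μ g (indepTuples m n) < ∞ := by
  obtain ⟨d, hd⟩ : ∃ d, n = m + d + 1 := ⟨n - m - 1, by omega⟩
  induction d generalizing m with
  | zero =>
    subst hd
    exact rogersConst_codim_one_lt_top hg
  | succ d ih =>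
    refine (rogersConst_le_extTuples hg (by omega) indepTuples_invariant fun v hv => hv).trans_lt ?_
    rw [extTuples_indepTuples]
    exact ih (by omega) (by omega)

theorem rogersConst_indepTuples [IsProbabilityMeasure μ] (hg : IsInvariantFrame μ g)
    (hmn : m < n) : rogersConst μ g (indepTuples m n) = 1 := by
  induction m with
  | zero =>
    have h1 := lintegral_tsum_eq (f := fun _ => 1) hg hmn (indepTuples_invariant (m := 0))
      (fun v hv => hv) measurable_const
    have h2 : indepTuples 0 n = Set.univ := by
      ext v
      simp [indepTuples]
    have h3 : volume (Set.univ : Set (Fin 0 → Fin n → ℝ)) = 1 := by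
      rw [volume_pi, Measure.pi_of_empty, Measure.dirac_apply_of_mem (Set.mem_univ _)]
    rw [h2] at h1 ⊢
    simpa [h3] using h1.symm
  | succ m ih =>
    rw [rogersConst_indepTuples_succ hg hmn (rogersConst_indepTuples_lt_top hg hmn), ih (by omega)]

/-- **Rogers' mean value formula** for linearly independent tuples. -/
theorem lintegral_tsum_indepTuples [IsProbabilityMeasure μ] (hg : IsInvariantFrame μ g)
    (hmn : m < n) {f : (Fin m → Fin n → ℝ) → ℝ≥0∞} (hf : Measurable f) :
    ∫⁻ L, ∑' v : indepTuples m n, f (act (g L) (icast v.1)) ∂μ = ∫⁻ x, f x := by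
  rw [lintegral_tsum_eq hg hmn indepTuples_invariant (fun v hv => hv) hf,
    rogersConst_indepTuples hg hmn, one_mul]

end MeanValue

section BrunnMinkowski

theorem volume_add_volume_le_of_compact {K K' C : Set ℝ} (hK : IsCompact K) (hK' : IsCompact K')
    (hne : K.Nonempty) (hne' : K'.Nonempty) (hC : ∀ a ∈ K, ∀ b ∈ K', a + b ∈ C) :
    volume K + volume K' ≤ volume C := by
  obtain ⟨p, hp, hpmax⟩ := hK.exists_isMaxOn hne continuousOn_id
  obtain ⟨q, hq, hqmin⟩ := hK'.exists_isMinOn hne' continuousOn_id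
  have h1 := measure_union_add_inter (μ := volume) (q +ᵥ K) (hK'.measurableSet.const_vadd p)
  have h2 : volume ((q +ᵥ K) ∩ (p +ᵥ K')) = 0 := by
    refine measure_mono_null (t := {p + q}) ?_ Real.volume_singleton
    rintro _ ⟨⟨a, ha, rfl⟩, ⟨b, hb, hab⟩⟩
    have h3 : a ≤ p := hpmax ha
    have h4 : q ≤ b := hqmin hb
    simp only [vadd_eq_add, Set.mem_singleton_iff] at hab ⊢
    linarith
  rw [h2, add_zero, measure_vadd, measure_vadd] at h1
  rw [← h1]
  refine measure_mono (Set.union_subset ?_ ?_)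
  · rintro _ ⟨a, ha, rfl⟩
    have h3 := hC a ha q hq
    rwa [add_comm] at h3
  · rintro _ ⟨b, hb, rfl⟩
    exact hC p hp b hb

theorem volume_add_volume_le {A B C : Set ℝ} (hA : MeasurableSet A) (hB : MeasurableSet B)
    (hne : A.Nonempty) (hne' : B.Nonempty) (hC : ∀ a ∈ A, ∀ b ∈ B, a + b ∈ C) :
    volume A + volume B ≤ volume C := by
  have key : ∀ K ⊆ A, IsCompact K → ∀ K' ⊆ B, IsCompact K' → volume K + volume K' ≤ volume C := by
    intro K hKA hK K' hKB hK'
    obtain ⟨a, ha⟩ := hne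
    obtain ⟨b, hb⟩ := hne'
    refine le_trans (add_le_add (measure_mono (Set.subset_insert a K))
      (measure_mono (Set.subset_insert b K'))) ?_
    refine volume_add_volume_le_of_compact (hK.insert a) (hK'.insert b) (Set.insert_nonempty _ _)
      (Set.insert_nonempty _ _) fun x hx y hy => hC x ?_ y ?_
    · exact Set.insert_subset ha hKA hx
    · exact Set.insert_subset hb hKB hy
  rw [hA.measure_eq_iSup_isCompact, hB.measure_eq_iSup_isCompact]
  simp only [iSup_and']
  refine ENNReal.biSup_add_biSup_le' (p := fun K => K ⊆ A ∧ IsCompact K)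
    (q := fun K => K ⊆ B ∧ IsCompact K) ⟨∅, by simp⟩ ⟨∅, by simp⟩ fun K hK K' hK' => ?_
  exact key K hK.1 hK.2 K' hK'.1 hK'.2

theorem four_mul_le_sq_ennreal (a b : ℝ≥0∞) : 4 * a * b ≤ (a + b) ^ 2 := by
  rcases eq_or_ne a ∞ with rfl | ha
  · simp
  rcases eq_or_ne b ∞ with rfl | hb
  · simp
  lift a to NNReal using ha
  lift b to NNReal using hb
  exact_mod_cast four_mul_le_sq_add a b

theorem lintegral_eq_lintegral_meas_lt_ennreal {f : ℝ → ℝ≥0∞} (hf : Measurable f)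
    (hf1 : ∀ x, f x ≤ 1) :
    ∫⁻ x, f x = ∫⁻ t in Set.Ioi (0 : ℝ), volume {x | t < (f x).toReal} := by
  rw [← lintegral_eq_lintegral_meas_lt volume
    (Filter.Eventually.of_forall fun x => ENNReal.toReal_nonneg) hf.ennreal_toReal.aemeasurable]
  exact lintegral_congr fun x => (ENNReal.ofReal_toReal
    (ne_top_of_le_ne_top ENNReal.one_ne_top (hf1 x))).symm

theorem lintegral_add_lintegral_le_of_min_le {f g h : ℝ → ℝ≥0∞} (hf : Measurable f)
    (hg : Measurable g) (hh : Measurable h) (hf1 : ⨆ x, f x = 1) (hg1 : ⨆ x, g x = 1)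
    (hfg : ∀ x y, min (f x) (g y) ≤ h (x + y)) :
    (∫⁻ x, f x) + ∫⁻ x, g x ≤ ∫⁻ x, h x := by
  have hfle : ∀ x, f x ≤ 1 := fun x => hf1 ▸ le_iSup f x
  have hgle : ∀ x, g x ≤ 1 := fun x => hg1 ▸ le_iSup g x
  refine le_trans ?_ (lintegral_mono (f := fun x => min (h x) 1) fun x => min_le_left _ _)
  have hhm : Measurable fun x => min (h x) 1 := hh.min measurable_const
  rw [lintegral_eq_lintegral_meas_lt_ennreal hf hfle,
    lintegral_eq_lintegral_meas_lt_ennreal hg hgle,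
    lintegral_eq_lintegral_meas_lt_ennreal hhm fun x => min_le_right _ _, ← lintegral_add_left]
  swap
  · exact Antitone.measurable fun s t hst => measure_mono fun x hx => lt_of_le_of_lt hst hx
  refine setLIntegral_mono' measurableSet_Ioi fun t ht => ?_
  have ht0 : (0 : ℝ) < t := ht
  have hlt : ∀ {a : ℝ≥0∞}, a ≤ 1 → (t < a.toReal ↔ ENNReal.ofReal t < a) := fun ha =>
    (ENNReal.ofReal_lt_iff_lt_toReal ht0.le (ne_top_of_le_ne_top ENNReal.one_ne_top ha)).symm
  simp only [hlt (hfle _), hlt (hgle _), hlt (min_le_right _ _)]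
  rcases lt_or_ge (ENNReal.ofReal t) 1 with h1 | h1
  · obtain ⟨x, hx⟩ := lt_iSup_iff.1 (hf1.symm ▸ h1)
    obtain ⟨y, hy⟩ := lt_iSup_iff.1 (hg1.symm ▸ h1)
    refine volume_add_volume_le (measurableSet_lt measurable_const hf)
      (measurableSet_lt measurable_const hg) ⟨x, hx⟩ ⟨y, hy⟩ fun a ha b hb => ?_
    exact lt_min ((lt_min ha hb).trans_le (hfg a b)) h1
  · have h2 : {x | ENNReal.ofReal t < f x} = ∅ :=
      Set.eq_empty_of_forall_notMem fun x hx => absurd (hx.trans_le (hfle x)) (not_lt.2 h1)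
    have h3 : {x | ENNReal.ofReal t < g x} = ∅ :=
      Set.eq_empty_of_forall_notMem fun x hx => absurd (hx.trans_le (hgle x)) (not_lt.2 h1)
    rw [h2, h3]
    simp

theorem four_mul_lintegral_mul_le_of_bounded {f g h : ℝ → ℝ≥0∞} (hf : Measurable f)
    (hg : Measurable g) (hh : Measurable h) (hfb : ⨆ x, f x ≠ ∞) (hgb : ⨆ x, g x ≠ ∞)
    (hfg : ∀ x y, f x * g y ≤ h (x + y) ^ 2) :
    4 * (∫⁻ x, f x) * (∫⁻ x, g x) ≤ (∫⁻ x, h x) ^ 2 := by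
  set F := ⨆ x, f x with hF
  set G := ⨆ x, g x with hG
  rcases eq_or_ne F 0 with hF0 | hF0
  · have : ∀ x, f x = 0 := fun x => le_antisymm (hF0 ▸ le_iSup f x) zero_le
    simp [this]
  rcases eq_or_ne G 0 with hG0 | hG0
  · have : ∀ x, g x = 0 := fun x => le_antisymm (hG0 ▸ le_iSup g x) zero_le
    simp [this]
  obtain ⟨r, hr⟩ : ∃ r : ℝ≥0∞, r ^ 2 = F * G :=
    ⟨(F * G) ^ ((1 : ℝ) / 2), by rw [← ENNReal.rpow_natCast, ← ENNReal.rpow_mul]; norm_num⟩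
  have hFG0 : F * G ≠ 0 := mul_ne_zero hF0 hG0
  have hFGt : F * G ≠ ∞ := ENNReal.mul_ne_top hfb hgb
  have key := lintegral_add_lintegral_le_of_min_le (f := fun x => F⁻¹ * f x)
    (g := fun x => G⁻¹ * g x) (h := fun x => r⁻¹ * h x) (hf.const_mul _) (hg.const_mul _)
    (hh.const_mul _) (by rw [← ENNReal.mul_iSup, ← hF, ENNReal.inv_mul_cancel hF0 hfb])
    (by rw [← ENNReal.mul_iSup, ← hG, ENNReal.inv_mul_cancel hG0 hgb]) fun x y => by
      rw [← ENNReal.pow_le_pow_left_iff two_ne_zero, mul_pow, ← ENNReal.inv_pow, hr,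
        ENNReal.mul_inv (Or.inl hF0) (Or.inl hfb)]
      calc min (F⁻¹ * f x) (G⁻¹ * g y) ^ 2 ≤ (F⁻¹ * f x) * (G⁻¹ * g y) := by
            rw [sq]; exact mul_le_mul' (min_le_left _ _) (min_le_right _ _)
        _ = F⁻¹ * G⁻¹ * (f x * g y) := by ring
        _ ≤ F⁻¹ * G⁻¹ * h (x + y) ^ 2 := by gcongr; exact hfg x y
  rw [lintegral_const_mul _ hf, lintegral_const_mul _ hg, lintegral_const_mul _ hh] at key
  have h1 := (four_mul_le_sq_ennreal _ _).trans (pow_le_pow_left₀ zero_le key 2)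
  rw [mul_pow, ← ENNReal.inv_pow, hr] at h1
  calc 4 * (∫⁻ x, f x) * (∫⁻ x, g x)
      = (F * F⁻¹) * (G * G⁻¹) * (4 * (∫⁻ x, f x) * (∫⁻ x, g x)) := by
        rw [ENNReal.mul_inv_cancel hF0 hfb, ENNReal.mul_inv_cancel hG0 hgb, one_mul, one_mul]
    _ = F * G * (4 * (F⁻¹ * ∫⁻ x, f x) * (G⁻¹ * ∫⁻ x, g x)) := by ring
    _ ≤ F * G * ((F * G)⁻¹ * (∫⁻ x, h x) ^ 2) := by gcongr
    _ = (∫⁻ x, h x) ^ 2 := by rw [← mul_assoc, ENNReal.mul_inv_cancel hFG0 hFGt, one_mul]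

theorem lintegral_eq_iSup_min {f : ℝ → ℝ≥0∞} (hf : Measurable f) :
    ∫⁻ x, f x = ⨆ k : ℕ, ∫⁻ x, min (f x) k := by
  rw [← lintegral_iSup (fun k => hf.min measurable_const)
    fun k l hkl x => min_le_min_left _ (by exact_mod_cast hkl)]
  refine lintegral_congr fun x => ?_
  rw [← inf_iSup_eq (f x) fun k : ℕ => (k : ℝ≥0∞), ENNReal.iSup_natCast]
  simp

/-- The one-dimensional Prékopa–Leindler inequality at the midpoint. -/
theorem four_mul_lintegral_mul_le {f g h : ℝ → ℝ≥0∞} (hf : Measurable f)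
    (hg : Measurable g) (hh : Measurable h) (hfg : ∀ x y, f x * g y ≤ h (x + y) ^ 2) :
    4 * (∫⁻ x, f x) * (∫⁻ x, g x) ≤ (∫⁻ x, h x) ^ 2 := by
  rw [lintegral_eq_iSup_min hf, lintegral_eq_iSup_min hg, mul_assoc, ENNReal.iSup_mul,
    ENNReal.mul_iSup]
  refine iSup_le fun k => ?_
  rw [ENNReal.mul_iSup, ENNReal.mul_iSup]
  refine iSup_le fun l => ?_
  rw [← mul_assoc]
  refine four_mul_lintegral_mul_le_of_bounded (hf.min measurable_const) (hg.min measurable_const)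
    hh ?_ ?_ fun x y => (mul_le_mul' (min_le_left _ _) (min_le_left _ _)).trans (hfg x y)
  · exact ne_top_of_le_ne_top (ENNReal.natCast_ne_top k) (iSup_le fun x => min_le_right _ _)
  · exact ne_top_of_le_ne_top (ENNReal.natCast_ne_top l) (iSup_le fun x => min_le_right _ _)

/-- The **Brunn–Minkowski inequality** in multiplicative form. -/
theorem brunn_minkowski (n : ℕ) {A B C : Set (Fin n → ℝ)} (hA : MeasurableSet A)
    (hB : MeasurableSet B) (hCm : MeasurableSet C) (hC : ∀ a ∈ A, ∀ b ∈ B, a + b ∈ C) :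
    4 ^ n * volume A * volume B ≤ volume C ^ 2 := by
  induction n with
  | zero =>
    rcases A.eq_empty_or_nonempty with rfl | ⟨a, ha⟩
    · simp
    rcases B.eq_empty_or_nonempty with rfl | ⟨b, hb⟩
    · simp
    have h1 : ∀ (D : Set (Fin 0 → ℝ)) (d) (_ : d ∈ D), volume D = 1 := by
      intro D d hd
      rw [volume_pi, Measure.pi_of_empty]
      refine Measure.dirac_apply_of_mem ?_
      convert hd
    rw [h1 A a ha, h1 B b hb, h1 C _ (hC a ha b hb)]
    simp
  | succ n ih =>
    have hmp := volume_preserving_piFinSuccAbove (fun _ : Fin (n + 1) => ℝ) 0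
    set e := MeasurableEquiv.piFinSuccAbove (fun _ : Fin (n + 1) => ℝ) 0 with he
    have hadd : ∀ p q, e.symm (p + q) = e.symm p + e.symm q := by
      rintro ⟨s, x⟩ ⟨t, y⟩
      funext i
      refine Fin.cases ?_ (fun i => ?_) i <;>
        simp [he, MeasurableEquiv.piFinSuccAbove, Fin.insertNthEquiv]
    have hvol : ∀ D : Set (Fin (n + 1) → ℝ), MeasurableSet D →
        MeasurableSet (e.symm ⁻¹' D) ∧ volume D = ∫⁻ s, volume (Prod.mk s ⁻¹' (e.symm ⁻¹' D)) := by
      intro D hD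
      have h1 := e.symm.measurable hD
      refine ⟨h1, ?_⟩
      rw [← (hmp.symm e).measure_preimage hD.nullMeasurableSet, Measure.volume_eq_prod,
        Measure.prod_apply h1]
    obtain ⟨mA, vA⟩ := hvol A hA
    obtain ⟨mB, vB⟩ := hvol B hB
    obtain ⟨mC, vC⟩ := hvol C hCm
    have hfA := measurable_measure_prodMk_left (ν := (volume : Measure (Fin n → ℝ))) mA
    have hfB := measurable_measure_prodMk_left (ν := (volume : Measure (Fin n → ℝ))) mB
    have hfC := measurable_measure_prodMk_left (ν := (volume : Measure (Fin n → ℝ))) mC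
    have key := four_mul_lintegral_mul_le (hfA.const_mul (4 ^ n)) hfB hfC fun s t =>
      ih (mA.preimage measurable_prodMk_left) (mB.preimage measurable_prodMk_left)
        (mC.preimage measurable_prodMk_left) fun a ha b hb => by
          have := hC _ ha _ hb
          rw [← hadd] at this
          exact this
    rw [lintegral_const_mul _ hfA, ← vA, ← vB, ← vC] at key
    rwa [pow_succ', mul_assoc 4]

end BrunnMinkowski

section DensePaths

variable {α β : Type*} [MeasurableSpace α] [MeasurableSpace β]

/-- A dense bipartite graph contains large vertex sets any two members of which are joined by many
paths of length three. -/
theorem exists_sets_many_paths (P : Measure α) (Q : Measure β) [IsProbabilityMeasure P]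
    [IsProbabilityMeasure Q] {G : Set (α × β)} (hG : MeasurableSet G) {d : ℝ≥0∞} (hd0 : d ≠ 0)
    (hd : 16 * d ≤ (P.prod Q) G) :
    ∃ A' B', MeasurableSet A' ∧ MeasurableSet B' ∧ 2 * d ≤ P A' ∧ 4 * d ≤ Q B' ∧
      ∀ a ∈ A', ∀ b ∈ B',
        256 * d ^ 5 ≤ (P.prod Q) {p | (a, p.2) ∈ G ∧ p ∈ G ∧ (p.1, b) ∈ G} := by
  have hdt : d ≠ ∞ := by
    rintro rfl
    have := hd.trans prob_le_one
    norm_num at this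
  set deg : α → ℝ≥0∞ := fun a => Q (Prod.mk a ⁻¹' G) with hdeg
  have mdeg : Measurable deg := measurable_measure_prodMk_left hG
  set A₀ : Set α := {a | 8 * d ≤ deg a} with hA₀
  have mA₀ : MeasurableSet A₀ := measurableSet_le measurable_const mdeg
  set G₀ : Set (α × β) := {p | p.1 ∈ A₀ ∧ p ∈ G} with hG₀
  have mG₀ : MeasurableSet G₀ := (measurable_fst mA₀).inter hG
  have hG₀8 : 8 * d ≤ (P.prod Q) G₀ := by
    have h1 : (P.prod Q) (G \ G₀) ≤ 8 * d := by
      rw [Measure.prod_apply (hG.diff mG₀)]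
      calc ∫⁻ a, Q (Prod.mk a ⁻¹' (G \ G₀)) ∂P ≤ ∫⁻ _, 8 * d ∂P := by
            refine lintegral_mono fun a => ?_
            by_cases ha : a ∈ A₀
            · refine le_trans (le_of_eq ?_) zero_le
              refine measure_mono_null (t := ∅) (fun b hb => ?_) measure_empty
              exact hb.2 ⟨ha, hb.1⟩
            · exact (measure_mono fun b hb => hb.1).trans (not_le.1 ha).le
        _ = 8 * d := by simp
    have h2 : (P.prod Q) G ≤ (P.prod Q) G₀ + (P.prod Q) (G \ G₀) := by
      refine (measure_mono fun p hp => ?_).trans (measure_union_le G₀ (G \ G₀))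
      by_cases h : p ∈ G₀
      · exact Or.inl h
      · exact Or.inr ⟨hp, h⟩
    have h3 : 8 * d + 8 * d ≤ (P.prod Q) G₀ + 8 * d := by
      calc 8 * d + 8 * d = 16 * d := by ring
        _ ≤ _ := hd.trans (h2.trans (by gcongr))
    exact (ENNReal.add_le_add_iff_right (ENNReal.mul_ne_top (by norm_num) hdt)).1 h3
  set codeg : α × α → ℝ≥0∞ := fun p => Q {b | (p.1, b) ∈ G ∧ (p.2, b) ∈ G} with hcodeg
  have mtri : MeasurableSet {q : (α × α) × β | (q.1.1, q.2) ∈ G ∧ (q.1.2, q.2) ∈ G} :=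
    (hG.preimage (by fun_prop : Measurable fun q : (α × α) × β => (q.1.1, q.2))).inter
      (hG.preimage (by fun_prop : Measurable fun q : (α × α) × β => (q.1.2, q.2)))
  have mcodeg : Measurable codeg := measurable_measure_prodMk_left mtri
  set bad : β → ℝ≥0∞ := fun b => (P.prod P) {p | (p.1, b) ∈ G₀ ∧ (p.2, b) ∈ G₀ ∧
    codeg p < 32 * d ^ 3} with hbad
  have mbadset : MeasurableSet {q : (α × α) × β | (q.1.1, q.2) ∈ G₀ ∧ (q.1.2, q.2) ∈ G₀ ∧
      codeg q.1 < 32 * d ^ 3} :=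
    (mG₀.preimage (by fun_prop : Measurable fun q : (α × α) × β => (q.1.1, q.2))).inter
      ((mG₀.preimage (by fun_prop : Measurable fun q : (α × α) × β => (q.1.2, q.2))).inter
        (measurableSet_lt (mcodeg.comp measurable_fst) measurable_const))
  have mbad : Measurable bad := measurable_measure_prodMk_right mbadset
  have hbad_int : ∫⁻ b, bad b ∂Q ≤ 32 * d ^ 3 := by
    have h1 := Measure.prod_apply_symm (μ := P.prod P) (ν := Q) mbadset
    rw [Measure.prod_apply mbadset] at h1
    refine le_trans (le_of_eq h1.symm) ?_
    calc ∫⁻ p, Q (Prod.mk p ⁻¹' {q : (α × α) × β | (q.1.1, q.2) ∈ G₀ ∧ (q.1.2, q.2) ∈ G₀ ∧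
          codeg q.1 < 32 * d ^ 3}) ∂(P.prod P) ≤ ∫⁻ _, 32 * d ^ 3 ∂(P.prod P) := by
          refine lintegral_mono fun p => ?_
          by_cases hp : codeg p < 32 * d ^ 3
          · refine le_trans (measure_mono (t := {b | (p.1, b) ∈ G ∧ (p.2, b) ∈ G})
              fun b hb => ⟨hb.1.2, hb.2.1.2⟩) hp.le
          · refine le_trans (le_of_eq ?_) zero_le
            refine measure_mono_null (t := ∅) (fun b hb => ?_) measure_empty
            exact hp hb.2.2
      _ = 32 * d ^ 3 := by simp
  set φ : β → ℝ≥0∞ := fun b => P {a | (a, b) ∈ G₀} with hφ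
  have mφ : Measurable φ := measurable_measure_prodMk_right mG₀
  have hφint : 8 * d ≤ ∫⁻ b, φ b ∂Q := by
    rw [Measure.prod_apply_symm mG₀] at hG₀8
    exact hG₀8
  obtain ⟨b₀, hb₀⟩ : ∃ b, 16 * d ^ 3 + bad b ≤ d * φ b ^ 2 := by
    by_contra! hcon
    have h1 : ∀ b, 8 * d ^ 2 * φ b < 32 * d ^ 3 + bad b := by
      intro b
      have h2 : 8 * d ^ 2 * φ b ≤ d * φ b ^ 2 + 16 * d ^ 3 := by
        have hφt : φ b ≠ ∞ := measure_ne_top _ _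
        have h3 : 8 * d * φ b ≤ φ b ^ 2 + 16 * d ^ 2 := by
          lift d to NNReal using hdt
          generalize φ b = z at hφt
          lift z to NNReal using hφt
          have : (8 * d * z : NNReal) ≤ z ^ 2 + 16 * d ^ 2 := by
            rw [← NNReal.coe_le_coe]; push_cast; nlinarith [sq_nonneg ((z : ℝ) - 4 * d)]
          exact_mod_cast this
        calc 8 * d ^ 2 * φ b = d * (8 * d * φ b) := by ring
          _ ≤ d * (φ b ^ 2 + 16 * d ^ 2) := by gcongr
          _ = _ := by ring
      calc 8 * d ^ 2 * φ b ≤ d * φ b ^ 2 + 16 * d ^ 3 := h2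
        _ < 16 * d ^ 3 + bad b + 16 * d ^ 3 :=
            ENNReal.add_lt_add_right (by finiteness) (hcon b)
        _ = _ := by ring
    have h2 : ∫⁻ b, 8 * d ^ 2 * φ b ∂Q < ∫⁻ b, (32 * d ^ 3 + bad b) ∂Q := by
      refine lintegral_strict_mono (IsProbabilityMeasure.ne_zero Q)
        (mbad.const_add _).aemeasurable ?_ (Filter.Eventually.of_forall h1)
      rw [lintegral_const_mul _ mφ]
      have : ∫⁻ b, φ b ∂Q ≤ ∫⁻ _, 1 ∂Q := lintegral_mono fun b => prob_le_one
      have h3 : ∫⁻ b, φ b ∂Q ≠ ∞ := ne_top_of_le_ne_top (by simp) this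
      finiteness
    rw [lintegral_const_mul _ mφ, lintegral_add_left measurable_const] at h2
    simp only [lintegral_const, measure_univ, mul_one] at h2
    refine absurd h2 (not_lt.2 ?_)
    calc 32 * d ^ 3 + ∫⁻ b, bad b ∂Q ≤ 32 * d ^ 3 + 32 * d ^ 3 := by gcongr
      _ = 8 * d ^ 2 * (8 * d) := by ring
      _ ≤ 8 * d ^ 2 * ∫⁻ b, φ b ∂Q := by gcongr
  set U : Set α := {a | (a, b₀) ∈ G₀} with hU
  have mU : MeasurableSet U := mG₀.preimage measurable_prodMk_right
  set u := P U with hu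
  have hut : u ≠ ∞ := measure_ne_top _ _
  have hu4 : 4 * d ≤ u := by
    have h1 : d * (4 * d) ^ 2 ≤ d * u ^ 2 := by
      calc d * (4 * d) ^ 2 = 16 * d ^ 3 := by ring
        _ ≤ _ := le_self_add.trans hb₀
    exact (ENNReal.pow_le_pow_left_iff two_ne_zero).1 ((ENNReal.mul_le_mul_iff_right hd0 hdt).1 h1)
  have hu0 : u ≠ 0 := by
    intro h
    rw [h] at hu4
    simp [hd0] at hu4
  have hbadu : bad b₀ ≤ d * u ^ 2 := le_add_self.trans hb₀
  have mB2 : MeasurableSet {p : α × α | p.2 ∈ U ∧ codeg p < 32 * d ^ 3} :=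
    (mU.preimage measurable_snd).inter (measurableSet_lt mcodeg measurable_const)
  set bdeg : α → ℝ≥0∞ := fun a => P {a' | a' ∈ U ∧ codeg (a, a') < 32 * d ^ 3} with hbdeg
  have mbdeg : Measurable bdeg := measurable_measure_prodMk_left mB2
  set A' : Set α := {a | a ∈ U ∧ bdeg a ≤ 2 * d * u} with hA'
  have mA' : MeasurableSet A' := mU.inter (measurableSet_le mbdeg measurable_const)
  set B' : Set β := {b | 4 * d * u ≤ P {a | a ∈ U ∧ (a, b) ∈ G}} with hB'
  have mUG : MeasurableSet {p : α × β | p.1 ∈ U ∧ p ∈ G} := (mU.preimage measurable_fst).inter hG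
  have mB' : MeasurableSet B' :=
    measurableSet_le measurable_const (measurable_measure_prodMk_right mUG)
  refine ⟨A', B', mA', mB', ?_, ?_, ?_⟩
  · have h1 : 2 * d * u * P (U \ A') ≤ d * u ^ 2 := by
      refine le_trans ?_ hbadu
      have h2 : bad b₀ = ∫⁻ a, P (Prod.mk a ⁻¹' {p | p.1 ∈ U ∧ p.2 ∈ U ∧
          codeg p < 32 * d ^ 3}) ∂P :=
        Measure.prod_apply ((mU.preimage measurable_fst).inter mB2)
      rw [h2, ← setLIntegral_const]
      refine (setLIntegral_mono' (mU.diff mA') fun a ha => ?_).trans (setLIntegral_le_lintegral _ _)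
      have h3 : 2 * d * u ≤ bdeg a := by
        by_contra! h
        exact ha.2 ⟨ha.1, h.le⟩
      exact h3.trans (measure_mono fun a' ha' => ⟨ha.1, ha'.1, ha'.2⟩)
    have h2 : 2 * P (U \ A') ≤ u := by
      have h3 : (d * u) * (2 * P (U \ A')) ≤ (d * u) * u := by
        calc (d * u) * (2 * P (U \ A')) = 2 * d * u * P (U \ A') := by ring
          _ ≤ d * u ^ 2 := h1
          _ = _ := by ring
      exact (ENNReal.mul_le_mul_iff_right (mul_ne_zero hd0 hu0) (ENNReal.mul_ne_top hdt hut)).1 h3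
    have h3 : u ≤ P A' + P (U \ A') := by
      refine (measure_mono fun a ha => ?_).trans (measure_union_le A' (U \ A'))
      by_cases h : a ∈ A'
      · exact Or.inl h
      · exact Or.inr ⟨ha, h⟩
    have h4 : u + u ≤ 2 * P A' + u := by
      calc u + u ≤ (P A' + P (U \ A')) + (P A' + P (U \ A')) := add_le_add h3 h3
        _ = 2 * P A' + 2 * P (U \ A') := by ring
        _ ≤ _ := by gcongr
    have h5 : 2 * (2 * d) ≤ 2 * P A' := by
      calc 2 * (2 * d) = 4 * d := by ring
        _ ≤ _ := hu4.trans ((ENNReal.add_le_add_iff_right hut).1 h4)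
    exact (ENNReal.mul_le_mul_iff_right (by norm_num) (by norm_num)).1 h5
  · have h1 : 8 * d * u ≤ (P.prod Q) {p | p.1 ∈ U ∧ p ∈ G} := by
      rw [Measure.prod_apply mUG, hu, ← setLIntegral_const]
      refine (setLIntegral_mono' mU fun a ha => ?_).trans (setLIntegral_le_lintegral _ _)
      have h2 : 8 * d ≤ deg a := ha.1
      exact h2.trans (measure_mono fun b hb => ⟨ha, hb⟩)
    have h2 : (P.prod Q) {p | p.1 ∈ U ∧ p ∈ G} ≤ u * Q B' + 4 * d * u := by
      rw [Measure.prod_apply_symm mUG]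
      calc ∫⁻ b, P ((fun a => (a, b)) ⁻¹' {p | p.1 ∈ U ∧ p ∈ G}) ∂Q
          ≤ ∫⁻ b, (B'.indicator (fun _ => u) b + 4 * d * u) ∂Q := by
            refine lintegral_mono fun b => ?_
            by_cases hb : b ∈ B'
            · rw [Set.indicator_of_mem hb]
              exact (measure_mono fun a ha => ha.1).trans le_self_add
            · exact (not_le.1 hb).le.trans le_add_self
        _ = u * Q B' + 4 * d * u := by
            rw [lintegral_add_right _ measurable_const, lintegral_indicator_const mB']
            simp
    have h3 : u * (4 * d) + 4 * d * u ≤ u * Q B' + 4 * d * u := by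
      calc u * (4 * d) + 4 * d * u = 8 * d * u := by ring
        _ ≤ _ := h1.trans h2
    exact (ENNReal.mul_le_mul_iff_right hu0 hut).1
      ((ENNReal.add_le_add_iff_right (by finiteness)).1 h3)
  · intro a ha b hb
    set V : Set α := {a' | a' ∈ U ∧ (a', b) ∈ G ∧ 32 * d ^ 3 ≤ codeg (a, a')} with hV
    have mV : MeasurableSet V := mU.inter ((hG.preimage measurable_prodMk_right).inter
      (measurableSet_le measurable_const (mcodeg.comp measurable_prodMk_left)))
    have h1 : 4 * d * u ≤ P V + 2 * d * u := by
      refine le_trans hb ((measure_mono fun a' ha' => ?_).trans ((measure_union_le V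
        {a' | a' ∈ U ∧ codeg (a, a') < 32 * d ^ 3}).trans (add_le_add_right ha.2 _)))
      rcases lt_or_ge (codeg (a, a')) (32 * d ^ 3) with h | h
      · exact Or.inr ⟨ha'.1, h⟩
      · exact Or.inl ⟨ha'.1, ha'.2, h⟩
    have h2 : 8 * d ^ 2 ≤ P V := by
      have h3 : 2 * d * u + 2 * d * u ≤ P V + 2 * d * u := by
        calc 2 * d * u + 2 * d * u = 4 * d * u := by ring
          _ ≤ _ := h1
      calc 8 * d ^ 2 = 2 * d * (4 * d) := by ring
        _ ≤ 2 * d * u := by gcongr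
        _ ≤ _ := (ENNReal.add_le_add_iff_right (by finiteness)).1 h3
    have mpath : MeasurableSet {p : α × β | (a, p.2) ∈ G ∧ p ∈ G ∧ (p.1, b) ∈ G} :=
      (hG.preimage (by fun_prop : Measurable fun p : α × β => (a, p.2))).inter
        (hG.inter (hG.preimage (by fun_prop : Measurable fun p : α × β => (p.1, b))))
    rw [Measure.prod_apply mpath]
    calc 256 * d ^ 5 = 32 * d ^ 3 * (8 * d ^ 2) := by ring
      _ ≤ 32 * d ^ 3 * P V := by gcongr
      _ = ∫⁻ _ in V, 32 * d ^ 3 ∂P := (setLIntegral_const _ _).symm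
      _ ≤ ∫⁻ a' in V, Q (Prod.mk a' ⁻¹' {p | (a, p.2) ∈ G ∧ p ∈ G ∧ (p.1, b) ∈ G}) ∂P := by
          refine setLIntegral_mono' mV fun a' ha' => ha'.2.2.trans (measure_mono fun c hc => ?_)
          exact ⟨hc.1, hc.2, ha'.2.1⟩
      _ ≤ _ := setLIntegral_le_lintegral _ _

end DensePaths

section SumTriples

variable {n : ℕ}

theorem lintegral_volume_pairs_le {C : Set (Fin n → ℝ)} (hC : MeasurableSet C) :
    ∫⁻ z, (volume.prod volume)
      {q : (Fin n → ℝ) × (Fin n → ℝ) | q.1 ∈ C ∧ q.2 ∈ C ∧ q.1 + q.2 - z ∈ C} ≤ volume C ^ 3 := by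
  have mS : MeasurableSet {r : (Fin n → ℝ) × ((Fin n → ℝ) × (Fin n → ℝ)) |
      r.2.1 ∈ C ∧ r.2.2 ∈ C ∧ r.2.1 + r.2.2 - r.1 ∈ C} :=
    (hC.preimage (by fun_prop : Measurable fun r : (Fin n → ℝ) × ((Fin n → ℝ) × (Fin n → ℝ)) =>
        r.2.1)).inter
      ((hC.preimage (by fun_prop : Measurable fun r : (Fin n → ℝ) × ((Fin n → ℝ) × (Fin n → ℝ)) =>
        r.2.2)).inter
      (hC.preimage (by fun_prop : Measurable fun r : (Fin n → ℝ) × ((Fin n → ℝ) × (Fin n → ℝ)) =>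
        r.2.1 + r.2.2 - r.1)))
  have h1 := Measure.prod_apply (μ := (volume : Measure (Fin n → ℝ)))
    (ν := (volume : Measure (Fin n → ℝ)).prod volume) mS
  rw [Measure.prod_apply_symm mS] at h1
  refine (le_of_eq h1.symm).trans ?_
  calc ∫⁻ q, volume ((fun z => (z, q)) ⁻¹' {r : (Fin n → ℝ) × ((Fin n → ℝ) × (Fin n → ℝ)) |
          r.2.1 ∈ C ∧ r.2.2 ∈ C ∧ r.2.1 + r.2.2 - r.1 ∈ C}) ∂((volume : Measure (Fin n → ℝ)).prod
            (volume : Measure (Fin n → ℝ)))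
      ≤ ∫⁻ q, (C ×ˢ C).indicator (fun _ => volume C) q ∂((volume : Measure (Fin n → ℝ)).prod
            (volume : Measure (Fin n → ℝ))) := by
        refine lintegral_mono fun q => ?_
        by_cases hq : q ∈ C ×ˢ C
        · rw [Set.indicator_of_mem hq]
          rw [← (Measure.measurePreserving_sub_left volume (q.1 + q.2)).measure_preimage
            hC.nullMeasurableSet]
          exact measure_mono fun z hz => hz.2.2
        · refine le_trans (le_of_eq ?_) zero_le
          refine measure_mono_null (t := ∅) (fun z hz => ?_) measure_empty
          exact hq ⟨hz.1, hz.2.1⟩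
    _ = volume C ^ 3 := by
        rw [lintegral_indicator_const (hC.prod hC), Measure.prod_prod]
        ring

theorem four_pow_mul_volume_sum_triples_le {A B C : Set (Fin n → ℝ)} (hA : MeasurableSet A)
    (hB : MeasurableSet B) (hC : MeasurableSet C) {l d : ℝ≥0∞} (hl0 : l ≠ 0) (hlt : l ≠ ∞)
    (hAl : volume A = l) (hBl : volume B = l) (hCl : volume C = l)
    (hd : 16 * d * l ^ 2 ≤ (volume.prod volume)
      {p : (Fin n → ℝ) × (Fin n → ℝ) | p.1 ∈ A ∧ p.2 ∈ B ∧ p.1 + p.2 ∈ C}) :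
    4 ^ n * d ^ 12 ≤ 1 := by
  rcases eq_or_ne d 0 with rfl | hd0
  · simp
  have hPA : IsProbabilityMeasure (l⁻¹ • (volume : Measure (Fin n → ℝ)).restrict A) :=
    ⟨by simp [hAl, ENNReal.inv_mul_cancel hl0 hlt]⟩
  have hQB : IsProbabilityMeasure (l⁻¹ • (volume : Measure (Fin n → ℝ)).restrict B) :=
    ⟨by simp [hBl, ENNReal.inv_mul_cancel hl0 hlt]⟩
  have hprod : ∀ s : Set ((Fin n → ℝ) × (Fin n → ℝ)), MeasurableSet s → l ^ 2 *
      ((l⁻¹ • (volume : Measure (Fin n → ℝ)).restrict A).prod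
        (l⁻¹ • (volume : Measure (Fin n → ℝ)).restrict B)) s
      = (volume.prod volume) (s ∩ A ×ˢ B) := by
    intro s hs
    rw [Measure.prod_smul_left, Measure.prod_smul_right, Measure.prod_restrict]
    simp only [Measure.smul_apply, smul_eq_mul, Measure.restrict_apply hs]
    calc l ^ 2 * (l⁻¹ * (l⁻¹ * (volume.prod volume) (s ∩ A ×ˢ B)))
        = (l * l⁻¹) * (l * l⁻¹) * (volume.prod volume) (s ∩ A ×ˢ B) := by ring
      _ = _ := by rw [ENNReal.mul_inv_cancel hl0 hlt]; simp
  have hG : MeasurableSet {p : (Fin n → ℝ) × (Fin n → ℝ) | p.1 + p.2 ∈ C} :=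
    hC.preimage (by fun_prop : Measurable fun p : (Fin n → ℝ) × (Fin n → ℝ) => p.1 + p.2)
  have hl2 : l ^ 2 ≠ 0 := pow_ne_zero 2 hl0
  have hl2t : l ^ 2 ≠ ∞ := ENNReal.pow_ne_top hlt
  obtain ⟨A', B', mA', mB', hA', hB', hpath⟩ := exists_sets_many_paths
    (l⁻¹ • (volume : Measure (Fin n → ℝ)).restrict A)
    (l⁻¹ • (volume : Measure (Fin n → ℝ)).restrict B) hG hd0 (by
      rw [← ENNReal.mul_le_mul_iff_right hl2 hl2t, hprod _ hG, mul_comm]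
      exact hd.trans (measure_mono fun p hp => ⟨hp.2.2, hp.1, hp.2.1⟩))
  have hdt : d ≠ ∞ := by
    rintro rfl
    have := hA'.trans prob_le_one
    norm_num at this
  set R : (Fin n → ℝ) → ℝ≥0∞ := fun z => (volume.prod volume)
      {q : (Fin n → ℝ) × (Fin n → ℝ) | q.1 ∈ C ∧ q.2 ∈ C ∧ q.1 + q.2 - z ∈ C} with hR
  have mR : Measurable R := by
    refine measurable_measure_prodMk_left
      (s := {r : (Fin n → ℝ) × ((Fin n → ℝ) × (Fin n → ℝ)) |
      r.2.1 ∈ C ∧ r.2.2 ∈ C ∧ r.2.1 + r.2.2 - r.1 ∈ C}) ?_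
    exact (hC.preimage (by fun_prop : Measurable fun r :
        (Fin n → ℝ) × ((Fin n → ℝ) × (Fin n → ℝ)) => r.2.1)).inter
      ((hC.preimage (by fun_prop : Measurable fun r :
        (Fin n → ℝ) × ((Fin n → ℝ) × (Fin n → ℝ)) => r.2.2)).inter
      (hC.preimage (by fun_prop : Measurable fun r :
        (Fin n → ℝ) × ((Fin n → ℝ) × (Fin n → ℝ)) => r.2.1 + r.2.2 - r.1)))
  have hRab : ∀ a ∈ A', ∀ b ∈ B', l ^ 2 * (256 * d ^ 5) ≤ R (a + b) := by
    intro a ha b hb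
    have mpath : MeasurableSet {p : (Fin n → ℝ) × (Fin n → ℝ) |
        (a, p.2) ∈ {p : (Fin n → ℝ) × (Fin n → ℝ) | p.1 + p.2 ∈ C} ∧
        p ∈ {p : (Fin n → ℝ) × (Fin n → ℝ) | p.1 + p.2 ∈ C} ∧
        (p.1, b) ∈ {p : (Fin n → ℝ) × (Fin n → ℝ) | p.1 + p.2 ∈ C}} :=
      (hG.preimage (by fun_prop : Measurable fun p : (Fin n → ℝ) × (Fin n → ℝ) =>
        (a, p.2))).inter (hG.inter (hG.preimage
          (by fun_prop : Measurable fun p : (Fin n → ℝ) × (Fin n → ℝ) => (p.1, b))))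
    refine (mul_le_mul_right (hpath a ha b hb) (l ^ 2)).trans ?_
    rw [hprod _ mpath]
    have hmp : MeasurePreserving (fun p : (Fin n → ℝ) × (Fin n → ℝ) => (a + p.2, p.1 + b))
        (volume.prod volume) (volume.prod volume) :=
      ((measurePreserving_add_left volume a).prod (measurePreserving_add_right volume b)).comp
        Measure.measurePreserving_swap
    have mS : MeasurableSet {q : (Fin n → ℝ) × (Fin n → ℝ) |
        q.1 ∈ C ∧ q.2 ∈ C ∧ q.1 + q.2 - (a + b) ∈ C} :=
      (hC.preimage measurable_fst).inter ((hC.preimage measurable_snd).inter (hC.preimage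
        (by fun_prop : Measurable fun q : (Fin n → ℝ) × (Fin n → ℝ) => q.1 + q.2 - (a + b))))
    rw [hR]
    dsimp only
    rw [← hmp.measure_preimage mS.nullMeasurableSet]
    refine measure_mono fun p hp => ⟨hp.1.1, hp.1.2.2, ?_⟩
    have h1 : p.1 + p.2 ∈ C := hp.1.2.1
    convert h1 using 1
    simp only
    abel
  have hmarkov : l ^ 2 * (256 * d ^ 5) * volume {z | l ^ 2 * (256 * d ^ 5) ≤ R z} ≤ l ^ 3 := by
    refine (mul_meas_ge_le_lintegral mR _).trans ?_
    rw [← hCl]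
    exact lintegral_volume_pairs_le hC
  have hBM := brunn_minkowski n (mA'.inter hA) (mB'.inter hB)
    (measurableSet_le measurable_const mR) fun a ha b hb => hRab a ha.1 b hb.1
  have hvol : ∀ (D D' : Set (Fin n → ℝ)) (c : ℝ≥0∞), MeasurableSet D' →
      c ≤ (l⁻¹ • (volume : Measure (Fin n → ℝ)).restrict D) D' → l * c ≤ volume (D' ∩ D) := by
    intro D D' c hD' hc
    rw [Measure.smul_apply, Measure.restrict_apply hD', smul_eq_mul] at hc
    calc l * c ≤ l * (l⁻¹ * volume (D' ∩ D)) := by gcongr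
      _ = _ := by rw [← mul_assoc, ENNReal.mul_inv_cancel hl0 hlt, one_mul]
  have h1 := hvol A A' _ mA' hA'
  have h2 := hvol B B' _ mB' hB'
  have h3 : l ^ 6 * (4 ^ n * d ^ 12) ≤ l ^ 6 * 1 := by
    calc l ^ 6 * (4 ^ n * d ^ 12) ≤ (65536 * 8) * (l ^ 6 * (4 ^ n * d ^ 12)) :=
          le_mul_of_one_le_left zero_le (by norm_num)
      _ = (l ^ 2 * (256 * d ^ 5)) ^ 2 * (4 ^ n * (l * (2 * d)) * (l * (4 * d))) := by ring
      _ ≤ (l ^ 2 * (256 * d ^ 5)) ^ 2 * volume {z | l ^ 2 * (256 * d ^ 5) ≤ R z} ^ 2 := by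
          refine mul_le_mul_right (le_trans ?_ hBM) _
          gcongr
      _ = (l ^ 2 * (256 * d ^ 5) * volume {z | l ^ 2 * (256 * d ^ 5) ≤ R z}) ^ 2 := by ring
      _ ≤ (l ^ 3) ^ 2 := by gcongr
      _ = l ^ 6 * 1 := by ring
  exact (ENNReal.mul_le_mul_iff_right (pow_ne_zero 6 hl0) (ENNReal.pow_ne_top hlt)).1 h3

/-- Sets of equal volume in high dimension contain exponentially few additive triples. -/
theorem volume_sum_triples_le {A B C : Set (Fin n → ℝ)} (hA : MeasurableSet A)
    (hB : MeasurableSet B) (hC : MeasurableSet C) {l : ℝ≥0∞} (hl0 : l ≠ 0) (hlt : l ≠ ∞)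
    (hAl : volume A = l) (hBl : volume B = l) (hCl : volume C = l) :
    (volume.prod volume)
      {p : (Fin n → ℝ) × (Fin n → ℝ) | p.1 ∈ A ∧ p.2 ∈ B ∧ p.1 + p.2 ∈ C}
      ≤ 16 * ENNReal.ofReal (Real.exp (-(0.1155 * n))) * l ^ 2 := by
  by_contra! hcon
  obtain ⟨e, he, hcon'⟩ : ∃ e, ENNReal.ofReal (Real.exp (-(0.1155 * n))) < e ∧
      16 * e * l ^ 2 ≤ (volume.prod volume)
      {p : (Fin n → ℝ) × (Fin n → ℝ) | p.1 ∈ A ∧ p.2 ∈ B ∧ p.1 + p.2 ∈ C} := by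
    set T := (volume.prod volume)
      {p : (Fin n → ℝ) × (Fin n → ℝ) | p.1 ∈ A ∧ p.2 ∈ B ∧ p.1 + p.2 ∈ C}
    have hc0 : 16 * l ^ 2 ≠ 0 := by positivity
    have hct : 16 * l ^ 2 ≠ ∞ := by finiteness
    refine ⟨T / (16 * l ^ 2), ?_, ?_⟩
    · rw [ENNReal.lt_div_iff_mul_lt (Or.inl hc0) (Or.inl hct)]
      refine lt_of_eq_of_lt ?_ hcon
      ring
    · calc 16 * (T / (16 * l ^ 2)) * l ^ 2 = T / (16 * l ^ 2) * (16 * l ^ 2) := by ring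
        _ ≤ T := (ENNReal.div_mul_cancel hc0 hct).le
  have h1 := four_pow_mul_volume_sum_triples_le hA hB hC hl0 hlt hAl hBl hCl hcon'
  refine absurd h1 (not_le.2 ?_)
  have h2 : (1 : ℝ) ≤ 4 ^ n * Real.exp (-(0.1155 * n)) ^ 12 := by
    have h4 : (4 : ℝ) = Real.exp (2 * Real.log 2) := by
      rw [two_mul, Real.exp_add, Real.exp_log (by norm_num)]
      norm_num
    rw [h4, ← Real.exp_nat_mul, ← Real.exp_nat_mul, ← Real.exp_add]
    refine Real.one_le_exp ?_
    push_cast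
    nlinarith [Real.log_two_gt_d9, (Nat.cast_nonneg n : (0 : ℝ) ≤ n)]
  have h3 : (1 : ℝ≥0∞) ≤ 4 ^ n * ENNReal.ofReal (Real.exp (-(0.1155 * n))) ^ 12 := by
    have := ENNReal.ofReal_le_ofReal h2
    rw [ENNReal.ofReal_mul (by positivity), ENNReal.ofReal_pow (by norm_num),
      ENNReal.ofReal_pow (by positivity)] at this
    simpa using this
  refine h3.trans_lt ?_
  refine (ENNReal.mul_lt_mul_iff_right (by positivity) (by finiteness)).2 ?_
  exact ENNReal.pow_lt_pow_left (by norm_num) he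

end SumTriples

section Bonferroni

variable {α : Type*}

open Classical in
theorem neg_card_le_sum_neg_one_pow (N X : Finset α) (Ind : Finset α → Prop)
    (hmono : ∀ Z Z', Z ⊆ Z' → Ind Z' → Ind Z) {t : ℕ} (ht : Even t) {e : α} (heN : e ∈ N)
    (heX : e ∉ X) :
    -(({Y ∈ N.powerset | Disjoint X Y ∧ Y.card ≤ t ∧ Ind (X ∪ Y) ∧
        ¬ Ind (insert e (X ∪ Y)) ∧ e ∉ Y}.card : ℕ) : ℤ) ≤
      ∑ Y ∈ N.powerset with Disjoint X Y ∧ Y.card ≤ t ∧ Ind (X ∪ Y), (-1 : ℤ) ^ Y.card := by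
  set F : Finset (Finset α) :=
    {Y ∈ N.powerset | Disjoint X Y ∧ Y.card ≤ t ∧ Ind (X ∪ Y)} with hF
  have memF : ∀ Y, Y ∈ F ↔ Y ⊆ N ∧ Disjoint X Y ∧ Y.card ≤ t ∧ Ind (X ∪ Y) := by
    simp [hF]
  have hsplit : ∑ Y ∈ F, (-1 : ℤ) ^ Y.card = ∑ Y ∈ F with e ∈ Y, (-1 : ℤ) ^ Y.card +
      (∑ Y ∈ F with (e ∉ Y ∧ insert e Y ∈ F), (-1 : ℤ) ^ Y.card +
        ∑ Y ∈ F with (e ∉ Y ∧ insert e Y ∉ F), (-1 : ℤ) ^ Y.card) := by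
    rw [← Finset.sum_filter_add_sum_filter_not F (fun Y => e ∈ Y)]
    congr 1
    rw [← Finset.sum_filter_add_sum_filter_not (F.filter fun Y => e ∉ Y)
      (fun Y => insert e Y ∈ F), Finset.filter_filter (fun Y => e ∉ Y) _ F,
      Finset.filter_filter (fun Y => e ∉ Y) _ F]
  have hcancel : ∑ Y ∈ F with e ∈ Y, (-1 : ℤ) ^ Y.card =
      -∑ Y ∈ F with (e ∉ Y ∧ insert e Y ∈ F), (-1 : ℤ) ^ Y.card := by
    rw [← Finset.sum_neg_distrib]
    refine Finset.sum_bij' (fun Y _ => Y.erase e) (fun Y _ => insert e Y) ?_ ?_ ?_ ?_ ?_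
    · intro Y hY
      rw [Finset.mem_filter, memF] at hY
      rw [Finset.mem_filter, memF, Finset.insert_erase hY.2, memF]
      refine ⟨⟨(Finset.erase_subset _ _).trans hY.1.1,
        hY.1.2.1.mono_right (Finset.erase_subset _ _),
        (Finset.card_erase_le).trans hY.1.2.2.1,
        hmono _ _ (Finset.union_subset_union_right (Finset.erase_subset _ _)) hY.1.2.2.2⟩,
        Finset.notMem_erase _ _, hY.1⟩
    · intro Y hY
      rw [Finset.mem_filter] at hY ⊢
      exact ⟨hY.2.2, Finset.mem_insert_self _ _⟩
    · intro Y hY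
      exact Finset.insert_erase (Finset.mem_filter.1 hY).2
    · intro Y hY
      exact Finset.erase_insert (Finset.mem_filter.1 hY).2.1
    · intro Y hY
      rw [← Finset.card_erase_add_one (Finset.mem_filter.1 hY).2, pow_succ]
      ring
  have hrest : -(({Y ∈ N.powerset | Disjoint X Y ∧ Y.card ≤ t ∧ Ind (X ∪ Y) ∧
        ¬ Ind (insert e (X ∪ Y)) ∧ e ∉ Y}.card : ℕ) : ℤ) ≤
        ∑ Y ∈ F with (e ∉ Y ∧ insert e Y ∉ F), (-1 : ℤ) ^ Y.card := by
    have h1 : ∑ Y ∈ F with (e ∉ Y ∧ insert e Y ∉ F), (if Ind (insert e (X ∪ Y)) then (0 : ℤ)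
        else -1) ≤ ∑ Y ∈ F with (e ∉ Y ∧ insert e Y ∉ F), (-1 : ℤ) ^ Y.card := by
      refine Finset.sum_le_sum fun Y hY => ?_
      rw [Finset.mem_filter, memF, memF] at hY
      split_ifs with h
      · have h2 : Y.card = t := by
          by_contra hne
          refine hY.2.2 ⟨Finset.insert_subset heN hY.1.1,
            Finset.disjoint_insert_right.2 ⟨heX, hY.1.2.1⟩, ?_, ?_⟩
          · rw [Finset.card_insert_of_notMem hY.2.1]
            have := hY.1.2.2.1
            omega
          · rwa [Finset.union_insert]
        rw [h2, ht.neg_one_pow]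
        norm_num
      · rcases neg_one_pow_eq_or ℤ Y.card with h | h <;> simp [h]
    refine le_trans ?_ h1
    rw [Finset.sum_ite, Finset.sum_const_zero, zero_add, Finset.sum_const, nsmul_eq_mul, mul_neg,
      mul_one, neg_le_neg_iff, Nat.cast_le]
    refine Finset.card_le_card fun Y hY => ?_
    simp only [Finset.mem_filter, memF, Finset.mem_powerset] at hY ⊢
    tauto
  rw [hsplit, hcancel]
  linarith

open Classical in
/-- A Bonferroni inequality for the number of faces of a simplicial complex `Ind` on the ground set
`N`: faces to which some element of `N` cannot be added enter as an error term. -/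
theorem bonferroni_of_hereditary (N : Finset α) (Ind : Finset α → Prop)
    (hmono : ∀ Z Z', Z ⊆ Z' → Ind Z' → Ind Z) (h0 : Ind ∅) (A : Finset α → Prop) {k t : ℕ}
    (hA : ∀ X, A X → X.card = k) (ht : Even t) :
    (if A N then (1 : ℤ) else 0) ≤
      ∑ p ∈ N.powerset ×ˢ N.powerset with
        (A p.1 ∧ Disjoint p.1 p.2 ∧ p.2.card ≤ t ∧ Ind (p.1 ∪ p.2)), (-1 : ℤ) ^ p.2.card +
      ∑ Z ∈ N.powerset with (Z.card ≤ k + t ∧ Ind Z ∧ ∃ u ∈ N, u ∉ Z ∧ ¬ Ind (insert u Z)),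
        (2 : ℤ) ^ Z.card := by
  set Bad : Finset (Finset α) :=
    {Z ∈ N.powerset | Z.card ≤ k + t ∧ Ind Z ∧ ∃ u ∈ N, u ∉ Z ∧ ¬ Ind (insert u Z)} with hBad
  have hpairs : ∑ p ∈ N.powerset ×ˢ N.powerset with
        (A p.1 ∧ Disjoint p.1 p.2 ∧ p.2.card ≤ t ∧ Ind (p.1 ∪ p.2)), (-1 : ℤ) ^ p.2.card =
      ∑ X ∈ N.powerset with A X, ∑ Y ∈ N.powerset with
        (Disjoint X Y ∧ Y.card ≤ t ∧ Ind (X ∪ Y)), (-1 : ℤ) ^ Y.card := by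
    rw [Finset.sum_filter, Finset.sum_product, Finset.sum_filter]
    refine Finset.sum_congr rfl fun X _ => ?_
    by_cases hX : A X
    · rw [if_pos hX, Finset.sum_filter]
      exact Finset.sum_congr rfl fun Y _ => by simp [hX]
    · rw [if_neg hX]
      exact Finset.sum_eq_zero fun Y _ => by simp [hX]
  rw [hpairs]
  have hbad0 : (0 : ℤ) ≤ ∑ Z ∈ Bad, (2 : ℤ) ^ Z.card := Finset.sum_nonneg fun Z _ => by positivity
  by_cases hN : A N
  · have hX : ({X ∈ N.powerset | A X} : Finset (Finset α)) = {N} := by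
      ext X
      rw [Finset.mem_filter, Finset.mem_powerset, Finset.mem_singleton]
      constructor
      · rintro ⟨h1, h2⟩
        exact Finset.eq_of_subset_of_card_le h1 (by rw [hA X h2, hA N hN])
      · rintro rfl
        exact ⟨subset_rfl, hN⟩
    rw [if_pos hN, hX, Finset.sum_singleton]
    by_cases hI : Ind N
    · have hY : ({Y ∈ N.powerset | Disjoint N Y ∧ Y.card ≤ t ∧ Ind (N ∪ Y)} :
          Finset (Finset α)) = {∅} := by
        ext Y
        rw [Finset.mem_filter, Finset.mem_powerset, Finset.mem_singleton]
        constructor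
        · rintro ⟨h1, h2, -⟩
          exact Finset.disjoint_self_iff_empty _ |>.1 (h2.mono_left h1)
        · rintro rfl
          simpa using hI
      rw [hY, Finset.sum_singleton]
      simpa using hbad0
    · have h1 : ∑ Y ∈ N.powerset with (Disjoint N Y ∧ Y.card ≤ t ∧ Ind (N ∪ Y)),
          (-1 : ℤ) ^ Y.card = 0 := by
        refine Finset.sum_eq_zero fun Y hY => ?_
        exact absurd (hmono _ _ Finset.subset_union_left (Finset.mem_filter.1 hY).2.2.2) hI
      obtain ⟨Z, hZ⟩ := Finset.exists_maximal
        (s := {Z ∈ N.powerset | Ind Z}) ⟨∅, by simpa using h0⟩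
      have hZm := hZ.prop
      rw [Finset.mem_filter, Finset.mem_powerset] at hZm
      have hZN : Z ≠ N := by
        rintro rfl
        exact hI hZm.2
      obtain ⟨u, huN, huZ⟩ := Finset.exists_of_ssubset (hZm.1.ssubset_of_ne hZN)
      have hZB : Z ∈ Bad := by
        rw [hBad, Finset.mem_filter, Finset.mem_powerset]
        refine ⟨hZm.1, ?_, hZm.2, u, huN, huZ, fun hIu => huZ ?_⟩
        · rw [← hA N hN]
          exact (Finset.card_le_card hZm.1).trans (Nat.le_add_right _ _)
        · refine hZ.le_of_ge (y := insert u Z) ?_ (Finset.subset_insert u Z)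
            (Finset.mem_insert_self u Z)
          rw [Finset.mem_filter, Finset.mem_powerset]
          exact ⟨Finset.insert_subset huN hZm.1, hIu⟩
      rw [h1, zero_add]
      refine le_trans ?_ (Finset.single_le_sum (f := fun Z : Finset α => (2 : ℤ) ^ Z.card)
        (fun Z _ => by positivity) hZB)
      exact one_le_pow₀ (by norm_num)
  · rw [if_neg hN]
    have hex : ∀ X ∈ ({X ∈ N.powerset | A X} : Finset (Finset α)), ∃ e ∈ N, e ∉ X := by
      intro X hX
      rw [Finset.mem_filter, Finset.mem_powerset] at hX
      refine Finset.exists_of_ssubset (hX.1.ssubset_of_ne ?_)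
      rintro rfl
      exact hN hX.2
    rcases ({X ∈ N.powerset | A X} : Finset (Finset α)).eq_empty_or_nonempty with hemp | ⟨X₀, hX₀⟩
    · rw [hemp, Finset.sum_empty, zero_add]
      exact hbad0
    have hne : Nonempty α := ⟨(hex X₀ hX₀).choose⟩
    choose! e heN heX using hex
    have h1 := Finset.sum_le_sum fun X (hX : X ∈ ({X ∈ N.powerset | A X} : Finset (Finset α))) =>
      neg_card_le_sum_neg_one_pow N X Ind hmono ht (heN X hX) (heX X hX)
    rw [Finset.sum_neg_distrib] at h1
    have h2 : ∑ X ∈ N.powerset with A X, (({Y ∈ N.powerset | Disjoint X Y ∧ Y.card ≤ t ∧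
        Ind (X ∪ Y) ∧ ¬ Ind (insert (e X) (X ∪ Y)) ∧ e X ∉ Y}.card : ℕ) : ℤ) ≤
        ∑ Z ∈ Bad, (2 : ℤ) ^ Z.card := by
      have h3 : ∀ Z : Finset α, (2 : ℤ) ^ Z.card = ((Z.powerset.card : ℕ) : ℤ) := by
        intro Z
        rw [Finset.card_powerset]
        push_cast
        rfl
      simp_rw [h3]
      rw [← Nat.cast_sum, ← Nat.cast_sum, ← Finset.card_sigma, ← Finset.card_sigma, Nat.cast_le]
      refine Finset.card_le_card_of_injOn (fun p => ⟨p.1 ∪ p.2, p.1⟩) ?_ ?_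
      · rintro ⟨X, Y⟩ hp
        simp only [Finset.coe_sigma, Finset.coe_filter, Set.mem_sigma_iff, Set.mem_ofPred_eq,
          Finset.mem_powerset] at hp
        obtain ⟨⟨hXN, hXA⟩, hYN, hXY, hYt, hI, hnI, heY⟩ := hp
        have hXm : X ∈ ({X ∈ N.powerset | A X} : Finset (Finset α)) := by
          rw [Finset.mem_filter, Finset.mem_powerset]
          exact ⟨hXN, hXA⟩
        simp only [Finset.coe_sigma, Set.mem_sigma_iff, Finset.mem_coe, Finset.mem_powerset, hBad,
          Finset.mem_filter]
        refine ⟨⟨Finset.union_subset hXN hYN, ?_, hI, e X, heN X hXm, ?_, hnI⟩,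
          Finset.subset_union_left⟩
        · rw [Finset.card_union_of_disjoint hXY, hA X hXA]
          omega
        · rw [Finset.mem_union]
          exact fun h => h.elim (heX X hXm) heY
      · rintro ⟨X, Y⟩ hp ⟨X', Y'⟩ hp' heq
        simp only [Finset.coe_sigma, Finset.coe_filter, Set.mem_sigma_iff, Set.mem_ofPred_eq,
          Finset.mem_powerset] at hp hp'
        simp only [Sigma.mk.injEq, heq_eq_eq] at heq
        obtain ⟨h4, rfl⟩ := heq
        have h5 : Y = Y' := by
          rw [← Finset.union_sdiff_cancel_left hp.2.2.1, h4,
            Finset.union_sdiff_cancel_left hp'.2.2.1]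
        rw [h5]
    linarith

end Bonferroni

section CountTuples

variable {α : Type*} {k j : ℕ}

theorem bijective_of_image_eq [DecidableEq α] {X : Finset α} (hX : X.card = k) {x : Fin k → α}
    (h : Finset.univ.image x = X) :
    Function.Bijective fun i => (⟨x i, h ▸ Finset.mem_image_of_mem x (Finset.mem_univ i)⟩ : X) := by
  refine (Fintype.bijective_iff_surjective_and_card _).2 ⟨fun y => ?_, by simp [hX]⟩
  obtain ⟨y, hy⟩ := y
  obtain ⟨i, -, hi⟩ := Finset.mem_image.1 (h ▸ hy)
  exact ⟨i, Subtype.ext hi⟩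

theorem card_filter_image_eq [DecidableEq α] (N : Finset α) {X Y : Finset α} (hXN : X ⊆ N)
    (hYN : Y ⊆ N) (hX : X.card = k) (hY : Y.card = j) :
    ({x ∈ Fintype.piFinset fun _ : Fin (k + j) => N |
      Finset.univ.image (fun i => x (Fin.castAdd j i)) = X ∧
      Finset.univ.image (fun i => x (Fin.natAdd k i)) = Y}).card
      = k.factorial * j.factorial := by
  have h1 : (Finset.univ : Finset ((Fin k ≃ X) × (Fin j ≃ Y))).card
      = k.factorial * j.factorial := by
    have hk : Fintype.card (Fin k ≃ X) = k.factorial := by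
      rw [Fintype.card_equiv (Fintype.equivFinOfCardEq (by simpa using hX)).symm, Fintype.card_fin]
    have hj : Fintype.card (Fin j ≃ Y) = j.factorial := by
      rw [Fintype.card_equiv (Fintype.equivFinOfCardEq (by simpa using hY)).symm, Fintype.card_fin]
    rw [Finset.card_univ, Fintype.card_prod, hk, hj]
  rw [← h1]
  symm
  have himg : ∀ {m : ℕ} {Z : Finset α} (e : Fin m ≃ Z),
      Finset.univ.image (fun i => ((e i : Z) : α)) = Z := by
    intro m Z e
    ext y
    simp only [Finset.mem_image, Finset.mem_univ, true_and]
    constructor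
    · rintro ⟨i, rfl⟩
      exact (e i).2
    · exact fun hy => ⟨e.symm ⟨y, hy⟩, by simp⟩
  refine Finset.card_bij (fun p _ => Fin.append (fun i => ((p.1 i : X) : α))
    (fun i => ((p.2 i : Y) : α))) ?_ ?_ ?_
  · rintro ⟨e, f⟩ -
    simp only [Finset.mem_filter, Fintype.mem_piFinset, Fin.append_left, Fin.append_right, himg,
      and_self, and_true]
    intro i
    refine Fin.addCases (fun i => ?_) (fun i => ?_) i
    · rw [Fin.append_left]
      exact hXN (e i).2
    · rw [Fin.append_right]
      exact hYN (f i).2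
  · rintro ⟨e, f⟩ - ⟨e', f'⟩ - h
    have he : e = e' := by
      ext i
      simpa using congrFun h (Fin.castAdd j i)
    have hf : f = f' := by
      ext i
      simpa using congrFun h (Fin.natAdd k i)
    rw [he, hf]
  · intro x hx
    rw [Finset.mem_filter] at hx
    refine ⟨(Equiv.ofBijective _ (bijective_of_image_eq hX hx.2.1),
      Equiv.ofBijective _ (bijective_of_image_eq hY hx.2.2)), Finset.mem_univ _, ?_⟩
    exact Fin.append_castAdd_natAdd

/-- Injective tuples from `N`, cut after the `k`-th entry, correspond to pairs of disjoint subsets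
of `N` with orderings. -/
theorem card_filter_injective [DecidableEq α] (N : Finset α) (Q : Finset α → Finset α → Prop)
    [∀ X Y, Decidable (Q X Y)] [DecidablePred fun x : Fin (k + j) → α => Function.Injective x] :
    ({x ∈ Fintype.piFinset fun _ : Fin (k + j) => N | Function.Injective x ∧
      Q (Finset.univ.image fun i => x (Fin.castAdd j i))
        (Finset.univ.image fun i => x (Fin.natAdd k i))}).card
      = k.factorial * j.factorial * ({p ∈ N.powerset ×ˢ N.powerset |
        p.1.card = k ∧ p.2.card = j ∧ Disjoint p.1 p.2 ∧ Q p.1 p.2}).card := by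
  rw [Finset.card_eq_sum_card_fiberwise (f := fun x : Fin (k + j) → α =>
    (Finset.univ.image (fun i => x (Fin.castAdd j i)),
      Finset.univ.image (fun i => x (Fin.natAdd k i))))
    (t := {p ∈ N.powerset ×ˢ N.powerset |
        p.1.card = k ∧ p.2.card = j ∧ Disjoint p.1 p.2 ∧ Q p.1 p.2}), mul_comm, ← smul_eq_mul]
  · refine Finset.sum_const_nat fun p hp => ?_
    obtain ⟨X, Y⟩ := p
    simp only [Finset.mem_filter, Finset.mem_product, Finset.mem_powerset] at hp
    obtain ⟨⟨hXN, hYN⟩, hX, hY, hXY, hQ⟩ := hp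
    rw [← card_filter_image_eq N hXN hYN hX hY, Finset.filter_filter]
    congr 1
    refine Finset.filter_congr fun x _ => ?_
    simp only [Prod.mk.injEq]
    refine ⟨fun h => h.2, fun h => ⟨⟨?_, by rwa [h.1, h.2]⟩, h⟩⟩
    have hi1 := (bijective_of_image_eq hX h.1).1
    have hi2 := (bijective_of_image_eq hY h.2).1
    have hX' : ∀ i, x (Fin.castAdd j i) ∈ X := fun i =>
      h.1 ▸ Finset.mem_image_of_mem _ (Finset.mem_univ i)
    have hY' : ∀ i, x (Fin.natAdd k i) ∈ Y := fun i =>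
      h.2 ▸ Finset.mem_image_of_mem (fun i => x (Fin.natAdd k i)) (Finset.mem_univ i)
    intro a b
    refine Fin.addCases (fun a => ?_) (fun a => ?_) a <;>
      refine Fin.addCases (fun b => ?_) (fun b => ?_) b <;> intro hab
    · rw [hi1 (Subtype.ext hab)]
    · exact absurd (hab ▸ hX' a) (Finset.disjoint_right.1 hXY (hY' b))
    · exact absurd (hab ▸ hX' b) (Finset.disjoint_right.1 hXY (hY' a))
    · rw [hi2 (Subtype.ext hab)]
  · intro x hx
    simp only [Finset.coe_filter, Set.mem_ofPred_eq, Fintype.mem_piFinset] at hx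
    obtain ⟨hxN, hinj, hQ⟩ := hx
    simp only [Finset.coe_filter, Set.mem_ofPred_eq, Finset.mem_product, Finset.mem_powerset]
    refine ⟨⟨?_, ?_⟩, ?_, ?_, ?_, hQ⟩
    · exact Finset.image_subset_iff.2 fun i _ => hxN _
    · exact Finset.image_subset_iff.2 fun i _ => hxN _
    · exact (Finset.card_image_of_injective _ (hinj.comp (Fin.castAdd_injective k j))).trans
        (by simp)
    · exact (Finset.card_image_of_injective _ (hinj.comp (Fin.natAdd_injective j k))).trans
        (by simp)
    · rw [Finset.disjoint_left]
      intro y hy hy'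
      obtain ⟨a, -, rfl⟩ := Finset.mem_image.1 hy
      obtain ⟨b, -, hb⟩ := Finset.mem_image.1 hy'
      have h1 := congrArg Fin.val (hinj hb)
      simp only [Fin.val_natAdd, Fin.val_castAdd] at h1
      omega

end CountTuples

section OrderedBonferroni

variable {V : Type*} [AddCommGroup V] [Module ℝ V] {k j D : ℕ}

theorem linearIndependent_iff_injective_and_linearIndepOn [DecidableEq V]
    (x : Fin (k + j) → V) :
    LinearIndependent ℝ x ↔ Function.Injective x ∧
      LinearIndepOn ℝ id (((Finset.univ.image fun i => x (Fin.castAdd j i)) ∪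
        (Finset.univ.image fun i => x (Fin.natAdd k i)) : Finset V) : Set V) := by
  have hr : (((Finset.univ.image fun i => x (Fin.castAdd j i)) ∪
      (Finset.univ.image fun i => x (Fin.natAdd k i)) : Finset V) : Set V) = Set.range x := by
    ext y
    simp only [Finset.coe_union, Finset.coe_image, Finset.coe_univ, Set.image_univ,
      Set.mem_union, Set.mem_range]
    constructor
    · rintro (⟨i, rfl⟩ | ⟨i, rfl⟩) <;> exact ⟨_, rfl⟩
    · rintro ⟨i, rfl⟩
      refine Fin.addCases (fun i => ?_) (fun i => ?_) i
      · exact Or.inl ⟨i, rfl⟩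
      · exact Or.inr ⟨i, rfl⟩
  rw [hr]
  constructor
  · exact fun h => ⟨h.injective, (linearIndepOn_id_range_iff h.injective).2 h⟩
  · exact fun h => (linearIndepOn_id_range_iff h.1).1 h.2

theorem linearIndependent_snoc_iff {x : Fin D → V} (hx : Function.Injective x) {u : V}
    (hu : u ∉ Set.range x) :
    LinearIndependent ℝ (Fin.snoc x u : Fin (D + 1) → V) ↔
      LinearIndepOn ℝ id (insert u (Set.range x)) := by
  have hinj : Function.Injective (Fin.snoc x u : Fin (D + 1) → V) :=
    Fin.snoc_injective_iff.2 ⟨hx, hu⟩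
  rw [← linearIndepOn_id_range_iff hinj, Fin.range_snoc]

/-- Count of independent tuples with entries in `N` whose first `k` entries form a member
of `𝒜`. -/
def leadCount (N : Finset V) (𝒜 : Set (Set V)) (k j : ℕ) : ℕ := by
  classical
  exact ({x ∈ Fintype.piFinset fun _ : Fin (k + j) => N | LinearIndependent ℝ x ∧
    Set.range (fun i => x (Fin.castAdd j i)) ∈ 𝒜}).card

/-- Count of independent tuples with entries in `N` which can be extended by an entry of `N`
to a dependent tuple without repetition. -/
def stuckCount (N : Finset V) (D : ℕ) : ℕ := by
  classical
  exact ({x ∈ Fintype.piFinset fun _ : Fin D => N | LinearIndependent ℝ x ∧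
    ∃ u ∈ N, u ∉ Set.range x ∧ ¬ LinearIndependent ℝ (Fin.snoc x u : Fin (D + 1) → V)}).card

open Classical in
theorem leadCount_eq (N : Finset V) {𝒜 : Set (Set V)} (h𝒜 : ∀ X ∈ 𝒜, X.Finite ∧ X.ncard = k) :
    leadCount N 𝒜 k j = k.factorial * j.factorial * ({p ∈ N.powerset ×ˢ N.powerset |
      (p.1 : Set V) ∈ 𝒜 ∧ Disjoint p.1 p.2 ∧ p.2.card = j ∧
        LinearIndepOn ℝ id ((p.1 ∪ p.2 : Finset V) : Set V)}).card := by
  have h1 := card_filter_injective (k := k) (j := j) N (fun X Y : Finset V => (X : Set V) ∈ 𝒜 ∧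
    LinearIndepOn ℝ id ((X ∪ Y : Finset V) : Set V))
  have h2 : ({p ∈ N.powerset ×ˢ N.powerset | (p.1 : Set V) ∈ 𝒜 ∧ Disjoint p.1 p.2 ∧
      p.2.card = j ∧ LinearIndepOn ℝ id ((p.1 ∪ p.2 : Finset V) : Set V)}) =
      {p ∈ N.powerset ×ˢ N.powerset | p.1.card = k ∧ p.2.card = j ∧ Disjoint p.1 p.2 ∧
        ((p.1 : Set V) ∈ 𝒜 ∧ LinearIndepOn ℝ id ((p.1 ∪ p.2 : Finset V) : Set V))} := by
    refine Finset.filter_congr fun p _ => ?_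
    have h3 : (p.1 : Set V) ∈ 𝒜 → p.1.card = k := fun h => by
      rw [← Set.ncard_coe_finset]
      exact (h𝒜 _ h).2
    tauto
  rw [h2, ← h1, leadCount]
  congr 1
  refine Finset.filter_congr fun x _ => ?_
  rw [linearIndependent_iff_injective_and_linearIndepOn, and_assoc, and_comm (a :=
    LinearIndepOn ℝ id _)]
  simp only [Finset.coe_image, Finset.coe_univ, Set.image_univ]

open Classical in
theorem stuckCount_eq (N : Finset V) (D : ℕ) :
    stuckCount N D = D.factorial * (N.powerset.filter fun Z : Finset V => Z.card = D ∧
      LinearIndepOn ℝ id (Z : Set V) ∧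
        ∃ u ∈ N, u ∉ Z ∧ ¬ LinearIndepOn ℝ id ((insert u Z : Finset V) : Set V)).card := by
  have h1 := card_filter_injective (k := D) (j := 0) N (fun Z _ : Finset V =>
    LinearIndepOn ℝ id (Z : Set V) ∧
      ∃ u ∈ N, u ∉ Z ∧ ¬ LinearIndepOn ℝ id ((insert u Z : Finset V) : Set V))
  rw [Nat.factorial_zero, mul_one] at h1
  have h2 : (N.powerset.filter fun Z : Finset V => Z.card = D ∧ LinearIndepOn ℝ id (Z : Set V) ∧
        ∃ u ∈ N, u ∉ Z ∧ ¬ LinearIndepOn ℝ id ((insert u Z : Finset V) : Set V)).card =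
      ({p ∈ N.powerset ×ˢ N.powerset | p.1.card = D ∧ p.2.card = 0 ∧ Disjoint p.1 p.2 ∧
        (LinearIndepOn ℝ id (p.1 : Set V) ∧ ∃ u ∈ N, u ∉ p.1 ∧
          ¬ LinearIndepOn ℝ id ((insert u p.1 : Finset V) : Set V))}).card := by
    refine Finset.card_bij' (fun Z _ => (Z, ∅)) (fun p _ => p.1) ?_ ?_ ?_ ?_
    · intro Z hZ
      simp only [Finset.mem_filter, Finset.mem_product, Finset.mem_powerset] at hZ ⊢
      exact ⟨⟨hZ.1, Finset.empty_subset _⟩, hZ.2.1, rfl, Finset.disjoint_empty_right _, hZ.2.2⟩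
    · intro p hp
      simp only [Finset.mem_filter, Finset.mem_product, Finset.mem_powerset] at hp ⊢
      exact ⟨hp.1.1, hp.2.1, hp.2.2.2.2⟩
    · intro Z _
      rfl
    · intro p hp
      simp only [Finset.mem_filter, Finset.card_eq_zero] at hp
      exact Prod.ext rfl hp.2.2.1.symm
  rw [h2, ← h1, stuckCount]
  congr 1
  refine Finset.filter_congr fun x _ => ?_
  have himg : ((Finset.univ.image fun i => x (Fin.castAdd 0 i) : Finset V) : Set V) =
      Set.range x := by
    simp
  have hmem : ∀ u, u ∈ (Finset.univ.image fun i => x (Fin.castAdd 0 i)) ↔ u ∈ Set.range x := by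
    intro u
    rw [← himg, Finset.mem_coe]
  have hli : LinearIndependent ℝ x ↔ Function.Injective x ∧
      LinearIndepOn ℝ id (Set.range x) :=
    ⟨fun h => ⟨h.injective, (linearIndepOn_id_range_iff h.injective).2 h⟩,
      fun h => (linearIndepOn_id_range_iff h.1).1 h.2⟩
  simp only [Finset.coe_insert, hmem, himg]
  rw [hli, and_assoc]
  refine and_congr_right fun hinj => and_congr_right fun _ => exists_congr fun u =>
    and_congr_right fun _ => and_congr_right fun hu => not_congr ?_
  exact linearIndependent_snoc_iff hinj hu

/-- Bonferroni's inequality in terms of independent tuples. -/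
theorem bonferroni_leadCount (N : Finset V) {𝒜 : Set (Set V)}
    (h𝒜 : ∀ X ∈ 𝒜, X.Finite ∧ X.ncard = k) {t : ℕ} (ht : Even t) :
    𝒜.indicator (1 : Set V → ℝ≥0∞) N +
      (∑ j ∈ Finset.range (t + 1) with Odd j,
        ((k.factorial * j.factorial : ℕ) : ℝ≥0∞)⁻¹ * leadCount N 𝒜 k j) ≤
      (∑ j ∈ Finset.range (t + 1) with Even j,
        ((k.factorial * j.factorial : ℕ) : ℝ≥0∞)⁻¹ * leadCount N 𝒜 k j) +
      ∑ D ∈ Finset.range (k + t + 1), 2 ^ D * ((D.factorial : ℕ) : ℝ≥0∞)⁻¹ * stuckCount N D := by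
  classical
  have h1 := bonferroni_of_hereditary N (fun Z : Finset V => LinearIndepOn ℝ id (Z : Set V))
    (fun Z Z' h h' => h'.mono (by exact_mod_cast h)) (by simp) (fun X => (X : Set V) ∈ 𝒜)
    (k := k) (t := t) (fun X hX => by
      rw [← Set.ncard_coe_finset]
      exact (h𝒜 _ hX).2) ht
  set p : ℕ → ℕ := fun j => ({p ∈ N.powerset ×ˢ N.powerset | (p.1 : Set V) ∈ 𝒜 ∧
      Disjoint p.1 p.2 ∧ p.2.card = j ∧
        LinearIndepOn ℝ id ((p.1 ∪ p.2 : Finset V) : Set V)}).card with hp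
  set b : ℕ → ℕ := fun D => (N.powerset.filter fun Z : Finset V => Z.card = D ∧
      LinearIndepOn ℝ id (Z : Set V) ∧ ∃ u ∈ N, u ∉ Z ∧
        ¬ LinearIndepOn ℝ id ((insert u Z : Finset V) : Set V)).card with hb
  have hlead : ∀ j, ((k.factorial * j.factorial : ℕ) : ℝ≥0∞)⁻¹ * leadCount N 𝒜 k j = p j := by
    intro j
    rw [leadCount_eq N h𝒜, Nat.cast_mul (k.factorial * j.factorial), ← mul_assoc,
      ENNReal.inv_mul_cancel (by positivity) (ENNReal.natCast_ne_top _), one_mul]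
  have hstuck : ∀ D, 2 ^ D * ((D.factorial : ℕ) : ℝ≥0∞)⁻¹ * stuckCount N D
      = ((2 ^ D * b D : ℕ) : ℝ≥0∞) := by
    intro D
    rw [stuckCount_eq, Nat.cast_mul, mul_assoc, ← mul_assoc (_⁻¹),
      ENNReal.inv_mul_cancel (by positivity) (ENNReal.natCast_ne_top _), one_mul,
      Nat.cast_mul, Nat.cast_pow, Nat.cast_ofNat]
  have hsumP : ∑ q ∈ N.powerset ×ˢ N.powerset with
        ((q.1 : Set V) ∈ 𝒜 ∧ Disjoint q.1 q.2 ∧ q.2.card ≤ t ∧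
          LinearIndepOn ℝ id ((q.1 ∪ q.2 : Finset V) : Set V)), (-1 : ℤ) ^ q.2.card =
      ∑ j ∈ Finset.range (t + 1), (-1 : ℤ) ^ j * p j := by
    rw [← Finset.sum_fiberwise_of_maps_to (g := fun q : Finset V × Finset V => q.2.card)
      (t := Finset.range (t + 1)) (fun q hq => by
        rw [Finset.mem_range]
        have := (Finset.mem_filter.1 hq).2.2.2.1
        omega)]
    refine Finset.sum_congr rfl fun j hj => ?_
    rw [Finset.filter_filter, mul_comm, ← nsmul_eq_mul, hp, ← Finset.sum_const]
    refine Finset.sum_congr ?_ fun q hq => ?_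
    · refine Finset.filter_congr fun q _ => ?_
      rw [Finset.mem_range] at hj
      constructor
      · tauto
      · rintro ⟨h2, h3, h4, h5⟩
        exact ⟨⟨h2, h3, by omega, h5⟩, h4⟩
    · rw [(Finset.mem_filter.1 hq).2.2.2.1]
  have hsumB : ∑ Z ∈ N.powerset.filter (fun Z : Finset V => Z.card ≤ k + t ∧
      LinearIndepOn ℝ id (Z : Set V) ∧
        ∃ u ∈ N, u ∉ Z ∧ ¬ LinearIndepOn ℝ id ((insert u Z : Finset V) : Set V)),
        (2 : ℤ) ^ Z.card = ∑ D ∈ Finset.range (k + t + 1), (2 : ℤ) ^ D * b D := by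
    rw [← Finset.sum_fiberwise_of_maps_to (g := fun Z : Finset V => Z.card)
      (t := Finset.range (k + t + 1)) (fun q hq => by
        rw [Finset.mem_range]
        have := (Finset.mem_filter.1 hq).2.1
        omega)]
    refine Finset.sum_congr rfl fun D hD => ?_
    rw [Finset.filter_filter, mul_comm, ← nsmul_eq_mul, hb, ← Finset.sum_const]
    refine Finset.sum_congr ?_ fun q hq => ?_
    · refine Finset.filter_congr fun q _ => ?_
      rw [Finset.mem_range] at hD
      constructor
      · tauto
      · rintro ⟨h2, h3⟩
        exact ⟨⟨by omega, h3⟩, h2⟩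
    · rw [(Finset.mem_filter.1 hq).2.1]
  rw [hsumP, hsumB, ← Finset.sum_filter_add_sum_filter_not _ (fun j => Even j)] at h1
  have heven : ∑ j ∈ Finset.range (t + 1) with Even j, (-1 : ℤ) ^ j * p j =
      ((∑ j ∈ Finset.range (t + 1) with Even j, p j : ℕ) : ℤ) := by
    push_cast
    refine Finset.sum_congr rfl fun j hj => ?_
    rw [(Finset.mem_filter.1 hj).2.neg_one_pow, one_mul]
  have hodd : ∑ j ∈ Finset.range (t + 1) with ¬ Even j, (-1 : ℤ) ^ j * p j =
      -((∑ j ∈ Finset.range (t + 1) with Odd j, p j : ℕ) : ℤ) := by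
    push_cast
    rw [← Finset.sum_neg_distrib]
    simp only [Nat.not_even_iff_odd]
    refine Finset.sum_congr rfl fun j hj => ?_
    rw [(Finset.mem_filter.1 hj).2.neg_one_pow, neg_one_mul]
  rw [heven, hodd] at h1
  have h2 : (if (N : Set V) ∈ 𝒜 then 1 else 0) + ∑ j ∈ Finset.range (t + 1) with Odd j, p j ≤
      ∑ j ∈ Finset.range (t + 1) with Even j, p j +
        ∑ D ∈ Finset.range (k + t + 1), 2 ^ D * b D := by
    zify
    push_cast at h1
    linarith
  have h3 : (((if (N : Set V) ∈ 𝒜 then 1 else 0) +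
      ∑ j ∈ Finset.range (t + 1) with Odd j, p j : ℕ) : ℝ≥0∞) ≤
      ((∑ j ∈ Finset.range (t + 1) with Even j, p j +
        ∑ D ∈ Finset.range (k + t + 1), 2 ^ D * b D : ℕ) : ℝ≥0∞) := by
    exact_mod_cast h2
  simp only [hlead, hstuck, Set.indicator_apply, Pi.one_apply]
  rw [Nat.cast_add, Nat.cast_add, Nat.cast_sum, Nat.cast_sum, Nat.cast_sum, Nat.cast_ite,
    Nat.cast_one, Nat.cast_zero] at h3
  convert h3 using 1

end OrderedBonferroni

section PrimitiveTuples

variable {n D : ℕ}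

theorem exists_pos_mul_eq_int_combination (v : Fin D → Fin n → ℤ) {y : Fin n → ℤ}
    (hy : ivec y ∈ Submodule.span ℝ (Set.range (icast v))) :
    ∃ q : ℕ, 0 < q ∧ ∃ b : Fin D → ℤ, ∀ k, (q : ℤ) * y k = ∑ i, b i * v i k := by
  obtain ⟨c, hc⟩ := (Submodule.mem_span_range_iff_exists_fun ℝ).1 hy
  have hck : ∀ k, (y k : ℝ) = ∑ i, c i * v i k := by
    intro k
    have := congrFun hc k
    simp only [Finset.sum_apply, Pi.smul_apply, smul_eq_mul, icast, ivec] at this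
    exact this.symm
  set f : ℕ → Fin n → ℤ := fun q k => q * y k - ∑ i, ⌊q * c i⌋ * v i k with hf
  set B : Fin n → ℤ := fun k => ∑ i, |v i k| with hB
  have hfB : ∀ q, f q ∈ Set.Icc (-B) B := by
    intro q
    have h1 : ∀ k, |f q k| ≤ B k := by
      intro k
      have h2 : ((f q k : ℤ) : ℝ) = ∑ i, Int.fract (q * c i) * v i k := by
        simp only [hf]
        push_cast
        rw [hck k, Finset.mul_sum, ← Finset.sum_sub_distrib]
        refine Finset.sum_congr rfl fun i _ => ?_
        rw [Int.fract]
        ring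
      have h3 : |((f q k : ℤ) : ℝ)| ≤ ((B k : ℤ) : ℝ) := by
        rw [h2, hB]
        push_cast
        refine (Finset.abs_sum_le_sum_abs _ _).trans (Finset.sum_le_sum fun i _ => ?_)
        rw [abs_mul, abs_of_nonneg (Int.fract_nonneg _)]
        exact mul_le_of_le_one_left (abs_nonneg _) (Int.fract_lt_one _).le
      exact_mod_cast h3
    exact ⟨fun k => (abs_le.1 (h1 k)).1, fun k => (abs_le.1 (h1 k)).2⟩
  obtain ⟨q, q', hne, heq⟩ := Finite.exists_ne_map_eq_of_infinite
    (fun q : ℕ => (⟨f q, hfB q⟩ : Set.Icc (-B) B))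
  have heq' : f q = f q' := congrArg Subtype.val heq
  have key : ∀ q q' : ℕ, q' < q → f q = f q' →
      ∃ q : ℕ, 0 < q ∧ ∃ b : Fin D → ℤ, ∀ k, (q : ℤ) * y k = ∑ i, b i * v i k := by
    intro q q' hlt h
    refine ⟨q - q', Nat.sub_pos_of_lt hlt, fun i => ⌊q * c i⌋ - ⌊q' * c i⌋, fun k => ?_⟩
    have h1 := congrFun h k
    simp only [hf] at h1
    simp only [sub_mul, Finset.sum_sub_distrib]
    rw [Nat.cast_sub hlt.le]
    linarith
  rcases lt_or_gt_of_ne hne with h | h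
  · exact key q' q h heq'.symm
  · exact key q q' h heq'

/-- Integer vectors in the real span of a primitive tuple are integer combinations of it. -/
theorem exists_int_combination {v : Fin D → Fin n → ℤ} (hv : v ∈ primTuples D n) {y : Fin n → ℤ}
    (hy : ivec y ∈ Submodule.span ℝ (Set.range (icast v))) :
    ∃ b : Fin D → ℤ, ∀ k, y k = ∑ i, b i * v i k := by
  classical
  have hex := exists_pos_mul_eq_int_combination v hy
  obtain ⟨hpos, b, hb⟩ := Nat.find_spec hex
  set q := Nat.find hex with hq
  rcases Nat.lt_or_ge 1 q with h1 | h1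
  · have hp := Nat.minFac_prime h1.ne'
    obtain ⟨r, hr⟩ := Nat.minFac_dvd q
    set p := q.minFac
    by_cases hdiv : ∀ i, (p : ℤ) ∣ b i
    · choose b' hb' using hdiv
      have hp0 : (p : ℤ) ≠ 0 := by exact_mod_cast hp.ne_zero
      have hrq : r < q := by
        have hr0 : 0 < r := Nat.pos_of_ne_zero fun h => by simp [h] at hr; omega
        have := hp.two_le
        nlinarith
      refine absurd ⟨Nat.pos_of_ne_zero fun h => ?_, b', fun k => ?_⟩ (Nat.find_min hex hrq)
      · simp [h] at hr
        omega
      · have h2 := hb k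
        rw [hr] at h2
        refine mul_left_cancel₀ hp0 ?_
        rw [Finset.mul_sum, ← mul_assoc]
        push_cast at h2
        rw [h2]
        exact Finset.sum_congr rfl fun i _ => by rw [hb' i, mul_assoc]
    · push Not at hdiv
      have hpb : ∀ k, (p : ℤ) ∣ ∑ i, b i * v i k := fun k => by
        rw [← hb k, hr]
        push_cast
        exact Dvd.intro _ (mul_assoc _ _ _).symm
      obtain ⟨s, w, hsw⟩ := exists_refineTuple hp v b hpb hdiv
      exact absurd hsw (hv.2 s w)
  · refine ⟨b, fun k => ?_⟩
    have h2 : q = 1 := by omega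
    rw [← hb k, h2]
    simp

end PrimitiveTuples

section StuckTuples

variable {n D : ℕ}

theorem natCast_card_eq_tsum_indepTuples {M : Matrix (Fin n) (Fin n) ℝ} (hM : M.det = 1)
    {S : Set (Fin n → ℝ)} {N : Finset (Fin n → ℝ)}
    (hN : (N : Set (Fin n → ℝ)) = {y | ∃ v : Fin n → ℤ, y = M.mulVec (ivec v)} ∩ S)
    (P : (Fin D → Fin n → ℝ) → Prop) [DecidablePred fun x => LinearIndependent ℝ x ∧ P x] :
    (({x ∈ Fintype.piFinset fun _ : Fin D => N | LinearIndependent ℝ x ∧ P x}.card : ℕ) : ℝ≥0∞) =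
      ∑' v : indepTuples D n, {x : Fin D → Fin n → ℝ | (∀ i, x i ∈ S) ∧ P x}.indicator
        (1 : (Fin D → Fin n → ℝ) → ℝ≥0∞) (act M (icast v.1)) := by
  have hinj : Function.Injective M.mulVec := by
    refine Matrix.mulVec_injective_of_isUnit ?_
    rw [Matrix.isUnit_iff_isUnit_det, hM]
    exact isUnit_one
  set F := {x ∈ Fintype.piFinset fun _ : Fin D => N | LinearIndependent ℝ x ∧ P x} with hF
  set T : Set (indepTuples D n) :=
    {v | act M (icast v.1) ∈ {x : Fin D → Fin n → ℝ | (∀ i, x i ∈ S) ∧ P x}} with hT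
  have h1 : ∑' v : indepTuples D n, {x : Fin D → Fin n → ℝ | (∀ i, x i ∈ S) ∧ P x}.indicator
      (1 : (Fin D → Fin n → ℝ) → ℝ≥0∞) (act M (icast v.1)) = ∑' _ : T, (1 : ℝ≥0∞) := by
    rw [tsum_subtype T (fun _ => (1 : ℝ≥0∞))]
    rfl
  have hmemN : ∀ y, y ∈ N ↔ (∃ v : Fin n → ℤ, y = M.mulVec (ivec v)) ∧ y ∈ S := fun y => by
    rw [← Finset.mem_coe, hN]
    rfl
  have hmap : ∀ v : T, act M (icast v.1.1) ∈ F := by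
    rintro ⟨⟨v, hv⟩, hvT⟩
    rw [hF, Finset.mem_filter, Fintype.mem_piFinset]
    exact ⟨fun i => (hmemN _).2 ⟨⟨v i, rfl⟩, hvT.1 i⟩, act_linearIndependent hM hv, hvT.2⟩
  have hbij : Function.Bijective fun v : T => (⟨act M (icast v.1.1), hmap v⟩ : F) := by
    constructor
    · rintro ⟨⟨v, hv⟩, hvT⟩ ⟨⟨w, hw⟩, hwT⟩ h
      have h2 : act M (icast v) = act M (icast w) := congrArg Subtype.val h
      have h3 : v = w := by
        funext i
        exact ivec_injective (hinj (congrFun h2 i))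
      subst h3
      rfl
    · rintro ⟨x, hx⟩
      rw [hF, Finset.mem_filter, Fintype.mem_piFinset] at hx
      choose v hv using fun i => ((hmemN _).1 (hx.1 i)).1
      have hxv : x = act M (icast v) := funext hv
      have hv' : v ∈ indepTuples D n := by
        refine LinearIndependent.of_comp M.mulVecLin ?_
        have h2 := hx.2.1
        rw [hxv] at h2
        exact h2
      refine ⟨⟨⟨v, hv'⟩, ?_⟩, Subtype.ext hxv.symm⟩
      show act M (icast v) ∈ {x : Fin D → Fin n → ℝ | (∀ i, x i ∈ S) ∧ P x}
      rw [← hxv]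
      exact ⟨fun i => ((hmemN _).1 (hx.1 i)).2, hx.2.2⟩
  rw [h1, (Equiv.ofBijective _ hbij).tsum_eq (fun _ : F => (1 : ℝ≥0∞)), tsum_fintype]
  simp

/-- Tuples in `S` whose combination with integer coefficients `a` lies in `S` as well. -/
def combSet (S : Set (Fin n → ℝ)) (a : Fin D → ℤ) : Set (Fin D → Fin n → ℝ) :=
  {x | (∀ i, x i ∈ S) ∧ ∑ i, (a i : ℝ) • x i ∈ S}

theorem measurableSet_combSet {S : Set (Fin n → ℝ)} (hS : MeasurableSet S) (a : Fin D → ℤ) :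
    MeasurableSet (combSet S a) := by
  have h1 : combSet S a = (Set.univ.pi fun _ => S) ∩
      (fun x : Fin D → Fin n → ℝ => ∑ i, (a i : ℝ) • x i) ⁻¹' S := by
    ext x
    simp [combSet]
  rw [h1]
  exact (MeasurableSet.univ_pi fun _ => hS).inter (hS.preimage (by fun_prop))

theorem stuckCount_le {M : Matrix (Fin n) (Fin n) ℝ} (hM : M.det = 1)
    {S : Set (Fin n → ℝ)} {N : Finset (Fin n → ℝ)}
    (hN : (N : Set (Fin n → ℝ)) = {y | ∃ v : Fin n → ℤ, y = M.mulVec (ivec v)} ∩ S) :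
    (stuckCount N D : ℝ≥0∞) ≤
      (∑' s : RefineIndex D, ∑' w : indepTuples D n,
        (Set.univ.pi fun _ => S).indicator (1 : (Fin D → Fin n → ℝ) → ℝ≥0∞)
          (refineTuple s (act M (icast w.1)))) +
      ∑' a : {a : Fin D → ℤ // ∀ i, a ≠ Pi.single i 1}, ∑' v : indepTuples D n,
        (combSet S a.1).indicator (1 : (Fin D → Fin n → ℝ) → ℝ≥0∞) (act M (icast v.1)) := by
  classical
  rw [stuckCount, natCast_card_eq_tsum_indepTuples hM hN]
  set h := (Set.univ.pi fun _ => S).indicator (1 : (Fin D → Fin n → ℝ) → ℝ≥0∞) with hh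
  have hrefine : ∀ (s : RefineIndex D) (w : indepTuples D n), h (refineTuple s (act M (icast w.1)))
      = ∑' v : indepTuples D n, if refineTuple s w.1 = v.1 then h (act M (icast v.1)) else 0 := by
    intro s w
    have hv : refineTuple s w.1 ∈ indepTuples D n := by
      show LinearIndependent ℝ (icast (refineTuple s w.1))
      rw [icast_refineTuple, linearIndependent_refineTuple]
      exact w.2
    rw [tsum_eq_single (⟨refineTuple s w.1, hv⟩ : indepTuples D n), if_pos rfl, icast_refineTuple,
      act_refineTuple]
    intro v hne
    exact if_neg fun heq => hne (Subtype.ext heq.symm)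
  simp only [hrefine]
  have hswap : ∀ s : RefineIndex D, (∑' w : indepTuples D n, ∑' v : indepTuples D n,
      if refineTuple s w.1 = v.1 then h (act M (icast v.1)) else 0) =
      ∑' v : indepTuples D n, ∑' w : indepTuples D n,
        if refineTuple s w.1 = v.1 then h (act M (icast v.1)) else 0 := fun s =>
    ENNReal.tsum_comm
  simp only [hswap]
  rw [ENNReal.tsum_comm, ENNReal.tsum_comm (α := {a : Fin D → ℤ // ∀ i, a ≠ Pi.single i 1}),
    ← ENNReal.tsum_add]
  refine ENNReal.tsum_le_tsum fun v => ?_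
  obtain ⟨v, hv⟩ := v
  rw [Set.indicator_apply]
  split_ifs with hmem
  swap
  · exact zero_le
  obtain ⟨hvS, u, huN, hur, hdep⟩ := hmem
  have hhv : h (act M (icast v)) = 1 := by
    rw [hh, Set.indicator_of_mem (by simpa using hvS)]
    rfl
  by_cases hprim : v ∈ primTuples D n
  · refine le_trans ?_ le_add_self
    rw [← Finset.mem_coe, hN] at huN
    obtain ⟨⟨y, rfl⟩, huS⟩ := huN
    have hspan : ivec y ∈ Submodule.span ℝ (Set.range (icast v)) := by
      by_contra hns
      refine hdep ?_
      have h1 : LinearIndependent ℝ (Fin.snoc (icast v) (ivec y) : Fin (D + 1) → Fin n → ℝ) :=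
        linearIndependent_finSnoc.2 ⟨hv, hns⟩
      have h2 := act_linearIndependent hM h1
      have h3 : act M (Fin.snoc (icast v) (ivec y) : Fin (D + 1) → Fin n → ℝ) =
          Fin.snoc (act M (icast v)) (M.mulVec (ivec y)) := by
        funext i
        refine Fin.lastCases ?_ (fun i => ?_) i
        · simp [act]
        · simp [act]
      rw [h3] at h2
      exact h2
    obtain ⟨b, hb⟩ := exists_int_combination hprim hspan
    have hyb : M.mulVec (ivec y) = ∑ i, (b i : ℝ) • act M (icast v) i := by
      have h1 : ivec y = ∑ i, (b i : ℝ) • icast v i := by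
        funext k
        simp only [ivec, icast, hb k, Finset.sum_apply, Pi.smul_apply, smul_eq_mul]
        push_cast
        rfl
      rw [h1, ← Matrix.mulVecLin_apply, map_sum]
      simp [act]
    have hb1 : ∀ i, b ≠ Pi.single i 1 := by
      rintro i rfl
      refine hur ⟨i, ?_⟩
      rw [hyb]
      rw [Finset.sum_eq_single i]
      · simp
      · intro j _ hj
        simp [hj]
      · simp
    refine le_trans (le_of_eq ?_) (ENNReal.le_tsum (⟨b, hb1⟩ :
      {a : Fin D → ℤ // ∀ i, a ≠ Pi.single i 1}))
    have hmem : act M (icast v) ∈ combSet S b := ⟨hvS, hyb ▸ huS⟩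
    rw [Set.indicator_of_mem hmem, Pi.one_apply]
  · refine le_trans ?_ le_self_add
    have h1 : ∃ s w, v = refineTuple s w := by
      by_contra! hcon
      exact hprim ⟨hv, hcon⟩
    obtain ⟨s, w, rfl⟩ := h1
    have hw : w ∈ indepTuples D n := by
      have h2 : LinearIndependent ℝ (icast (refineTuple s w)) := hv
      rw [icast_refineTuple, linearIndependent_refineTuple] at h2
      exact h2
    refine le_trans ?_ (ENNReal.le_tsum s)
    refine le_trans ?_ (ENNReal.le_tsum (⟨w, hw⟩ : indepTuples D n))
    rw [if_pos rfl, hhv]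
    rfl

end StuckTuples

section IntegerSums

/-- Sums of products over integer vectors factor. -/
theorem tsum_prod_int_eq_pow (g : ℤ → ℝ≥0∞) (D : ℕ) :
    ∑' a : Fin D → ℤ, ∏ i, g (a i) = (∑' a, g a) ^ D := by
  induction D with
  | zero => simp
  | succ D ih =>
    rw [← (Fin.consEquiv fun _ : Fin (D + 1) => ℤ).tsum_eq, ENNReal.tsum_prod', pow_succ', ← ih,
      ← ENNReal.tsum_mul_right]
    refine tsum_congr fun a => ?_
    rw [← ENNReal.tsum_mul_left]
    refine tsum_congr fun b => ?_
    rw [Fin.prod_univ_succ]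
    rfl

theorem tsum_inv_succ_sq_le : ∑' m : ℕ, (((m + 1 : ℕ) : ℝ≥0∞) ^ 2)⁻¹ ≤ 2 := by
  have h1 := (hasSum_nat_add_iff' 1).2 hasSum_zeta_two
  simp only [Finset.range_one, Finset.sum_singleton, Nat.cast_zero, ne_eq, OfNat.ofNat_ne_zero,
    not_false_eq_true, zero_pow, div_zero, sub_zero] at h1
  have h2 : ∀ m : ℕ, (((m + 1 : ℕ) : ℝ≥0∞) ^ 2)⁻¹ =
      ENNReal.ofReal (1 / ((m + 1 : ℕ) : ℝ) ^ 2) := by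
    intro m
    rw [one_div, ENNReal.ofReal_inv_of_pos (by positivity), ENNReal.ofReal_pow (by positivity),
      ENNReal.ofReal_natCast]
  simp only [h2]
  rw [← ENNReal.ofReal_tsum_of_nonneg (fun m => by positivity) h1.summable, h1.tsum_eq,
    ← ENNReal.ofReal_ofNat]
  refine ENNReal.ofReal_le_ofReal ?_
  nlinarith [Real.pi_lt_d2, Real.pi_pos]

theorem tsum_int_inv_sq_le :
    ∑' a : ℤ, (((max 1 a.natAbs : ℕ) : ℝ≥0∞) ^ 2)⁻¹ ≤ 5 := by
  have h1 : ∑' m : ℕ, (((max 1 (m : ℤ).natAbs : ℕ) : ℝ≥0∞) ^ 2)⁻¹ ≤ 1 + 2 := by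
    rw [tsum_eq_zero_add' ENNReal.summable]
    refine add_le_add (by simp) (le_trans (le_of_eq (tsum_congr fun m => ?_)) tsum_inv_succ_sq_le)
    have : max 1 ((m + 1 : ℕ) : ℤ).natAbs = m + 1 := by omega
    rw [this]
  have h2 : ∑' m : ℕ, (((max 1 (-((m : ℤ) + 1)).natAbs : ℕ) : ℝ≥0∞) ^ 2)⁻¹ ≤ 2 := by
    refine le_trans (le_of_eq (tsum_congr fun m => ?_)) tsum_inv_succ_sq_le
    have : max 1 (-((m : ℤ) + 1)).natAbs = m + 1 := by omega
    rw [this]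
  rw [(HasSum.of_nat_of_neg_add_one (f := fun a : ℤ => (((max 1 a.natAbs : ℕ) : ℝ≥0∞) ^ 2)⁻¹)
    ENNReal.summable.hasSum ENNReal.summable.hasSum).tsum_eq]
  refine (add_le_add h1 h2).trans (by norm_num)

theorem tsum_int_natAbs_le_one : ∑' a : ℤ, (if a.natAbs ≤ 1 then 1 else 0 : ℝ≥0∞) = 3 := by
  rw [tsum_eq_sum (s := {-1, 0, 1})]
  · have h1 : ({a ∈ ({-1, 0, 1} : Finset ℤ) | a.natAbs ≤ 1}).card = 3 := by decide
    simp [h1]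
  · intro a ha
    refine if_neg fun h => ha ?_
    simp only [Finset.mem_insert, Finset.mem_singleton]
    omega

end IntegerSums

section PairMarginals

variable {n D : ℕ}

theorem lintegral_le_of_pair_marginal_le {i j : Fin D} (hij : i ≠ j)
    {f h : (Fin D → Fin n → ℝ) → ℝ≥0∞} (hf : Measurable f) (hh : Measurable h) {c : ℝ≥0∞}
    (hle : ∀ x, ∫⁻ y, ∫⁻ z, f (Function.update (Function.update x i y) j z) ≤
      c * ∫⁻ y, ∫⁻ z, h (Function.update (Function.update x i y) j z)) :
    ∫⁻ x, f x ≤ c * ∫⁻ x, h x := by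
  classical
  have key : ∀ {f : (Fin D → Fin n → ℝ) → ℝ≥0∞}, Measurable f → ∫⁻ x, f x =
      (∫⋯∫⁻_(Finset.univ \ {i, j}), (fun x =>
        ∫⁻ y, ∫⁻ z, f (Function.update (Function.update x i y) j z)) ∂fun _ => volume) 0 := by
    intro f hf
    rw [volume_pi, lintegral_eq_lmarginal_univ 0]
    have h1 : (Finset.univ : Finset (Fin D)) = (Finset.univ \ {i, j}) ∪ {i, j} :=
      (Finset.sdiff_union_of_subset (Finset.subset_univ _)).symm
    conv_lhs => rw [h1]
    rw [lmarginal_union _ _ hf Finset.sdiff_disjoint]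
    congr 1
    funext x
    rw [lmarginal_insert _ hf (by simpa using hij)]
    simp only [lmarginal_singleton]
  rw [key hf, key hh]
  calc _ ≤ (∫⋯∫⁻_(Finset.univ \ {i, j}), (fun x =>
        c * ∫⁻ y, ∫⁻ z, h (Function.update (Function.update x i y) j z)) ∂fun _ => volume) 0 :=
        lmarginal_mono hle 0
    _ = _ := by
        simp only [lmarginal]
        refine lintegral_const_mul _ ?_
        fun_prop

end PairMarginals

section CombinationVolumes

variable {n D : ℕ}

theorem lintegral_univ_pi_indicator {S : Set (Fin n → ℝ)} (hS : MeasurableSet S) :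
    ∫⁻ x : Fin D → Fin n → ℝ, (Set.univ.pi fun _ => S).indicator 1 x = volume S ^ D := by
  rw [lintegral_indicator_one (MeasurableSet.univ_pi fun _ => hS), volume_pi_pi]
  simp

theorem volume_combSet_le_of_max {S : Set (Fin n → ℝ)} (hS : MeasurableSet S) (hD : 2 * D ≤ n)
    {a : Fin D → ℤ} {i : Fin D} (hi : 2 ≤ (a i).natAbs)
    (hmax : ∀ j, (a j).natAbs ≤ (a i).natAbs) :
    volume (combSet S a) ≤ volume S ^ D * (((2 : ℝ≥0∞) ^ (n - 2 * D))⁻¹ *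
      ∏ j, (((max 1 (a j).natAbs : ℕ) : ℝ≥0∞) ^ 2)⁻¹) := by
  classical
  have hai : (a i : ℝ) ≠ 0 := by
    have : a i ≠ 0 := by omega
    exact_mod_cast this
  have hmeas : Measurable ((Set.univ.pi fun _ => S).indicator
      (1 : (Fin D → Fin n → ℝ) → ℝ≥0∞)) :=
    measurable_one.indicator (MeasurableSet.univ_pi fun _ => hS)
  have h1 := lintegral_update_smul_add (D := D) (n := n) i hai
    (b := fun x => ∑ j ∈ Finset.univ.erase i, (a j : ℝ) • x j) (by fun_prop)
    (fun x y => Finset.sum_congr rfl fun j hj => by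
      rw [Function.update_of_ne (Finset.ne_of_mem_erase hj)]) hmeas
  rw [lintegral_univ_pi_indicator hS] at h1
  have h2 : volume (combSet S a) ≤ ENNReal.ofReal (|(a i : ℝ) ^ n|⁻¹) * volume S ^ D := by
    rw [← h1, ← lintegral_indicator_one (measurableSet_combSet hS a)]
    refine lintegral_mono fun x => ?_
    rw [Set.indicator_apply]
    split_ifs with hx
    swap
    · exact zero_le
    suffices hm : Function.update x i ((a i : ℝ) • x i +
        ∑ j ∈ Finset.univ.erase i, (a j : ℝ) • x j) ∈
        Set.univ.pi fun _ => S by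
      rw [Set.indicator_of_mem hm]
      exact le_rfl
    intro l _
    by_cases hl : l = i
    · subst hl
      rw [Function.update_self, Finset.add_sum_erase _ (fun j => (a j : ℝ) • x j)
        (Finset.mem_univ l)]
      exact hx.2
    · rw [Function.update_of_ne hl]
      exact hx.1 l
  refine h2.trans ?_
  rw [mul_comm]
  refine mul_le_mul_right ?_ _
  set m := (a i).natAbs with hm
  have h3 : |(a i : ℝ) ^ n|⁻¹ = ((m : ℝ) ^ n)⁻¹ := by
    rw [abs_pow, hm, Nat.cast_natAbs, Int.cast_abs]
  have hm0 : 0 < m := by omega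
  rw [h3, ENNReal.ofReal_inv_of_pos (by positivity), ENNReal.ofReal_pow (by positivity),
    ENNReal.ofReal_natCast]
  have h4 : ∏ j, (((max 1 (a j).natAbs : ℕ) : ℝ≥0∞) ^ 2)⁻¹ =
      (∏ j, ((max 1 (a j).natAbs : ℕ) : ℝ≥0∞) ^ 2)⁻¹ :=
    (ENNReal.prod_inv_distrib fun _ _ _ _ _ => Or.inr (by finiteness)).symm
  rw [h4, ← ENNReal.mul_inv (Or.inl (by positivity)) (Or.inl (by finiteness)),
    ENNReal.inv_le_inv]
  have h5 : 2 ^ (n - 2 * D) * ∏ j, (max 1 (a j).natAbs) ^ 2 ≤ m ^ n := by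
    calc 2 ^ (n - 2 * D) * ∏ j, (max 1 (a j).natAbs) ^ 2
        ≤ m ^ (n - 2 * D) * ∏ _j : Fin D, m ^ 2 := by
          refine Nat.mul_le_mul (Nat.pow_le_pow_left hi _) (Finset.prod_le_prod' fun j _ => ?_)
          exact Nat.pow_le_pow_left (max_le hm0 (hmax j)) _
      _ = m ^ n := by
          rw [Finset.prod_const, Finset.card_univ, Fintype.card_fin, ← pow_mul, ← pow_add]
          congr 1
          omega
  exact_mod_cast h5

theorem volume_signed_combination_le {S : Set (Fin n → ℝ)} (hS : MeasurableSet S)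
    (hS0 : volume S ≠ 0) (hSt : volume S ≠ ∞) {r s : ℝ} (hr : |r| = 1) (hs : |s| = 1)
    (b : Fin n → ℝ) :
    ∫⁻ y, ∫⁻ z, {p : (Fin n → ℝ) × (Fin n → ℝ) | p.1 ∈ S ∧ p.2 ∈ S ∧
      r • p.1 + s • p.2 + b ∈ S}.indicator (1 : (Fin n → ℝ) × (Fin n → ℝ) → ℝ≥0∞) (y, z) ≤
      16 * ENNReal.ofReal (Real.exp (-(0.1155 * n))) * volume S ^ 2 := by
  have hsign : ∀ {r : ℝ}, |r| = 1 → ∀ g : (Fin n → ℝ) → ℝ≥0∞, ∫⁻ y, g (r • y) = ∫⁻ y, g y := by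
    intro r hr g
    rcases eq_or_eq_neg_of_abs_eq hr with rfl | rfl
    · simp
    · simpa using lintegral_neg_eq_self g (μ := volume)
  have hrr : ∀ {r : ℝ}, |r| = 1 → ∀ y : Fin n → ℝ, r • r • y = y := by
    intro r hr y
    rcases eq_or_eq_neg_of_abs_eq hr with rfl | rfl <;> simp
  have hvol : ∀ {r : ℝ}, |r| = 1 → volume {y : Fin n → ℝ | r • y ∈ S} = volume S := by
    intro r hr
    have hm : MeasurableSet {y : Fin n → ℝ | r • y ∈ S} :=
      hS.preimage (measurable_const_smul r)
    rw [← lintegral_indicator_one hm, ← lintegral_indicator_one hS,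
      ← hsign hr (S.indicator 1)]
    rfl
  have hA : MeasurableSet {y : Fin n → ℝ | r • y ∈ S} := hS.preimage (measurable_const_smul r)
  have hB : MeasurableSet {y : Fin n → ℝ | s • y ∈ S} := hS.preimage (measurable_const_smul s)
  have hC : MeasurableSet {y : Fin n → ℝ | y + b ∈ S} := hS.preimage (measurable_add_const b)
  have h1 := volume_sum_triples_le hA hB hC hS0 hSt (hvol hr) (hvol hs)
    (measure_preimage_add_right volume b S)
  refine le_trans (le_of_eq ?_) h1
  have hT : MeasurableSet {p : (Fin n → ℝ) × (Fin n → ℝ) | r • p.1 ∈ S ∧ s • p.2 ∈ S ∧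
      p.1 + p.2 + b ∈ S} :=
    (hA.preimage measurable_fst).inter ((hB.preimage measurable_snd).inter
      (hC.preimage (measurable_fst.add measurable_snd)))
  have h2 := lintegral_indicator_one (μ := (volume : Measure (Fin n → ℝ)).prod volume) hT
  rw [lintegral_prod _ (measurable_one.indicator hT).aemeasurable] at h2
  refine Eq.trans ?_ h2
  rw [← hsign hr]
  refine lintegral_congr fun y => ?_
  rw [← hsign hs]
  refine lintegral_congr fun z => ?_
  have h3 : (r • y, s • z) ∈ {p : (Fin n → ℝ) × (Fin n → ℝ) | p.1 ∈ S ∧ p.2 ∈ S ∧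
      r • p.1 + s • p.2 + b ∈ S} ↔ (y, z) ∈ {p : (Fin n → ℝ) × (Fin n → ℝ) | r • p.1 ∈ S ∧
      s • p.2 ∈ S ∧ p.1 + p.2 + b ∈ S} := by
    simp only [Set.mem_ofPred_eq, hrr hr, hrr hs]
  classical
  rw [Set.indicator_apply, Set.indicator_apply]
  exact if_congr h3 rfl rfl

theorem volume_combSet_le_of_two {S : Set (Fin n → ℝ)} (hS : MeasurableSet S)
    (hS0 : volume S ≠ 0) (hSt : volume S ≠ ∞) {a : Fin D → ℤ} {i j : Fin D} (hij : i ≠ j)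
    (hi : (a i).natAbs = 1) (hj : (a j).natAbs = 1) :
    volume (combSet S a) ≤ volume S ^ D * (16 * ENNReal.ofReal (Real.exp (-(0.1155 * n)))) := by
  classical
  have habs : ∀ {m : ℤ}, m.natAbs = 1 → |(m : ℝ)| = 1 := fun {m} h => by
    rw [← Int.cast_abs, ← Nat.cast_natAbs, h, Nat.cast_one]
  rw [← lintegral_univ_pi_indicator hS, ← lintegral_indicator_one (measurableSet_combSet hS a),
    mul_comm]
  refine lintegral_le_of_pair_marginal_le hij
    (measurable_one.indicator (measurableSet_combSet hS a))
    (measurable_one.indicator (MeasurableSet.univ_pi fun _ => hS)) fun x => ?_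
  have hui : ∀ y z : Fin n → ℝ, Function.update (Function.update x i y) j z i = y := fun y z => by
    rw [Function.update_of_ne hij, Function.update_self]
  have huj : ∀ y z : Fin n → ℝ, Function.update (Function.update x i y) j z j = z := fun y z =>
    Function.update_self ..
  have hul : ∀ y z : Fin n → ℝ, ∀ l, l ≠ i → l ≠ j →
      Function.update (Function.update x i y) j z l = x l := fun y z l hli hlj => by
    rw [Function.update_of_ne hlj, Function.update_of_ne hli]
  by_cases hx : ∀ l, l ≠ i → l ≠ j → x l ∈ S
  swap
  · push Not at hx
    obtain ⟨l, hli, hlj, hl⟩ := hx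
    have h0 : ∀ y z, (combSet S a).indicator (1 : (Fin D → Fin n → ℝ) → ℝ≥0∞)
        (Function.update (Function.update x i y) j z) = 0 := fun y z =>
      Set.indicator_of_notMem (fun hm => hl (hul y z l hli hlj ▸ hm.1 l)) _
    simp only [h0, lintegral_zero]
    exact zero_le
  have h1 : ∀ y z, (Set.univ.pi fun _ => S).indicator (1 : (Fin D → Fin n → ℝ) → ℝ≥0∞)
      (Function.update (Function.update x i y) j z) =
      S.indicator (1 : (Fin n → ℝ) → ℝ≥0∞) y * S.indicator (1 : (Fin n → ℝ) → ℝ≥0∞) z := by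
    intro y z
    have hiff : Function.update (Function.update x i y) j z ∈ (Set.univ.pi fun _ => S) ↔
        y ∈ S ∧ z ∈ S := by
      refine ⟨fun h => ⟨hui y z ▸ h i trivial, huj y z ▸ h j trivial⟩, fun h l _ => ?_⟩
      by_cases hlj : l = j
      · subst hlj
        rw [huj]
        exact h.2
      by_cases hli : l = i
      · subst hli
        rw [hui]
        exact h.1
      rw [hul y z l hli hlj]
      exact hx l hli hlj
    simp only [Set.indicator_apply, hiff, Pi.one_apply]
    by_cases hy : y ∈ S <;> by_cases hz : z ∈ S <;> simp [hy, hz]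
  have h2 : ∀ y z, (combSet S a).indicator (1 : (Fin D → Fin n → ℝ) → ℝ≥0∞)
      (Function.update (Function.update x i y) j z) ≤
      {p : (Fin n → ℝ) × (Fin n → ℝ) | p.1 ∈ S ∧ p.2 ∈ S ∧
        (a i : ℝ) • p.1 + (a j : ℝ) • p.2 + ∑ l ∈ (Finset.univ.erase i).erase j, (a l : ℝ) • x l
          ∈ S}.indicator (1 : (Fin n → ℝ) × (Fin n → ℝ) → ℝ≥0∞) (y, z) := by
    intro y z
    rw [Set.indicator_apply]
    split_ifs with hm
    swap
    · exact zero_le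
    suffices hmem : (a i : ℝ) • y + (a j : ℝ) • z +
        ∑ l ∈ (Finset.univ.erase i).erase j, (a l : ℝ) • x l ∈ S by
      rw [Set.indicator_of_mem]
      · exact le_rfl
      · exact ⟨hui y z ▸ hm.1 i, huj y z ▸ hm.1 j, hmem⟩
    have h3 := hm.2
    rw [← Finset.add_sum_erase _ _ (Finset.mem_univ i), ← Finset.add_sum_erase _ _
      (Finset.mem_erase.2 ⟨hij.symm, Finset.mem_univ j⟩), ← add_assoc, hui, huj] at h3
    refine (congrArg (· ∈ S) (congrArg _ (Finset.sum_congr rfl fun l hl => ?_))).mp h3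
    rw [Finset.mem_erase, Finset.mem_erase] at hl
    rw [hul y z l hl.2.1 hl.1]
  refine (lintegral_mono fun y => lintegral_mono fun z => h2 y z).trans ?_
  refine (volume_signed_combination_le hS hS0 hSt (habs hi) (habs hj) _).trans (le_of_eq ?_)
  have hSm : Measurable (S.indicator (1 : (Fin n → ℝ) → ℝ≥0∞)) := measurable_one.indicator hS
  simp only [h1]
  simp only [lintegral_const_mul _ hSm, lintegral_mul_const _ hSm, lintegral_indicator_one hS]
  rw [sq]

theorem volume_combSet_le {S : Set (Fin n → ℝ)} (hS : MeasurableSet S) (hSS : S ∩ (-S) = ∅)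
    (hS0 : volume S ≠ 0) (hSt : volume S ≠ ∞) (hD : 2 * D ≤ n) {a : Fin D → ℤ}
    (ha : ∀ i, a ≠ Pi.single i 1) :
    volume (combSet S a) ≤ volume S ^ D * (((2 : ℝ≥0∞) ^ (n - 2 * D))⁻¹ *
        (∏ j, (((max 1 (a j).natAbs : ℕ) : ℝ≥0∞) ^ 2)⁻¹) +
      16 * ENNReal.ofReal (Real.exp (-(0.1155 * n))) *
        ∏ j, (if (a j).natAbs ≤ 1 then 1 else 0)) := by
  have hneg : ∀ y, y ∈ S → -y ∉ S := fun y hy hny => by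
    have h1 : y ∈ S ∩ (-S) := ⟨hy, hny⟩
    rw [hSS] at h1
    exact h1
  have hzero : (0 : Fin n → ℝ) ∉ S := fun h => hneg 0 h (by simpa using h)
  by_cases hsmall : ∀ j, (a j).natAbs ≤ 1
  · have hprod : ∏ j, (if (a j).natAbs ≤ 1 then 1 else 0 : ℝ≥0∞) = 1 :=
      Finset.prod_eq_one fun j _ => if_pos (hsmall j)
    rw [hprod, mul_one]
    by_cases h2 : ∃ i j, i ≠ j ∧ a i ≠ 0 ∧ a j ≠ 0
    · obtain ⟨i, j, hij, hi, hj⟩ := h2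
      have hi1 := hsmall i
      have hj1 := hsmall j
      refine (volume_combSet_le_of_two hS hS0 hSt hij (by omega) (by omega)).trans ?_
      gcongr
      exact le_add_self
    · have hempty : combSet S a = ∅ := by
        rw [Set.eq_empty_iff_forall_notMem]
        rintro x ⟨hx, hxa⟩
        by_cases h0 : ∃ i, a i ≠ 0
        · obtain ⟨i, hi⟩ := h0
          have hoff : ∀ j, j ≠ i → a j = 0 := fun j hj => by
            by_contra hne
            exact h2 ⟨i, j, hj.symm, hi, hne⟩
          rw [Finset.sum_eq_single i (fun j _ hj => by rw [hoff j hj]; simp) (by simp)] at hxa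
          have hi1 : a i = 1 ∨ a i = -1 := by
            have := hsmall i
            omega
          rcases hi1 with h1 | h1
          · refine ha i (funext fun j => ?_)
            by_cases hj : j = i
            · subst hj
              simpa using h1
            · simpa [hj] using hoff j hj
          · rw [h1] at hxa
            refine hneg _ (hx i) (by simpa using hxa)
        · push Not at h0
          simp only [h0, Int.cast_zero, zero_smul, Finset.sum_const_zero] at hxa
          exact hzero hxa
      rw [hempty, measure_empty]
      exact zero_le
  · push Not at hsmall
    obtain ⟨j0, hj0⟩ := hsmall
    obtain ⟨i, -, hi⟩ := Finset.exists_max_image Finset.univ (fun j => (a j).natAbs)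
      ⟨j0, Finset.mem_univ _⟩
    refine (volume_combSet_le_of_max hS hD (i := i) ?_ fun j => hi j (Finset.mem_univ _)).trans ?_
    · exact le_trans hj0 (hi j0 (Finset.mem_univ _))
    · gcongr
      exact le_self_add

theorem tsum_volume_combSet_le {S : Set (Fin n → ℝ)} (hS : MeasurableSet S) (hSS : S ∩ (-S) = ∅)
    (hS0 : volume S ≠ 0) (hSt : volume S ≠ ∞) (hD : 2 * D ≤ n) :
    ∑' a : {a : Fin D → ℤ // ∀ i, a ≠ Pi.single i 1}, volume (combSet S a.1) ≤
      volume S ^ D * (((2 : ℝ≥0∞) ^ (n - 2 * D))⁻¹ * 5 ^ D +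
        16 * ENNReal.ofReal (Real.exp (-(0.1155 * n))) * 3 ^ D) := by
  calc _ ≤ ∑' a : {a : Fin D → ℤ // ∀ i, a ≠ Pi.single i 1}, volume S ^ D *
        (((2 : ℝ≥0∞) ^ (n - 2 * D))⁻¹ *
          (∏ j, (((max 1 (a.1 j).natAbs : ℕ) : ℝ≥0∞) ^ 2)⁻¹) +
        16 * ENNReal.ofReal (Real.exp (-(0.1155 * n))) *
          ∏ j, (if (a.1 j).natAbs ≤ 1 then 1 else 0)) :=
        ENNReal.tsum_le_tsum fun a => volume_combSet_le hS hSS hS0 hSt hD a.2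
    _ ≤ ∑' a : Fin D → ℤ, volume S ^ D *
        (((2 : ℝ≥0∞) ^ (n - 2 * D))⁻¹ *
          (∏ j, (((max 1 (a j).natAbs : ℕ) : ℝ≥0∞) ^ 2)⁻¹) +
        16 * ENNReal.ofReal (Real.exp (-(0.1155 * n))) *
          ∏ j, (if (a j).natAbs ≤ 1 then 1 else 0)) :=
        ENNReal.tsum_comp_le_tsum_of_injective Subtype.val_injective _
    _ ≤ _ := by
        rw [ENNReal.tsum_mul_left, ENNReal.tsum_add, ENNReal.tsum_mul_left, ENNReal.tsum_mul_left,
          tsum_prod_int_eq_pow (fun a => (((max 1 a.natAbs : ℕ) : ℝ≥0∞) ^ 2)⁻¹),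
          tsum_prod_int_eq_pow (fun a => if a.natAbs ≤ 1 then 1 else 0), tsum_int_natAbs_le_one]
        gcongr
        exact tsum_int_inv_sq_le

end CombinationVolumes

theorem tsum_refineIndex_le {n D : ℕ} (hDn : D < n) :
    ∑' s : RefineIndex D, (((s.1 + 2 : ℕ) : ℝ≥0∞) ^ n)⁻¹ ≤ ((2 : ℝ≥0∞) ^ (n - D - 1))⁻¹ := by
  calc ∑' s : RefineIndex D, (((s.1 + 2 : ℕ) : ℝ≥0∞) ^ n)⁻¹
      ≤ ∑' s : RefineIndex D, ((2 : ℝ≥0∞) ^ (n - D - 1))⁻¹ *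
          (((s.1 + 2 : ℕ) : ℝ≥0∞) ^ (D + 1))⁻¹ := by
        refine ENNReal.tsum_le_tsum fun s => ?_
        rw [← ENNReal.mul_inv (Or.inl (by positivity)) (Or.inl (by finiteness)),
          ENNReal.inv_le_inv]
        have h1 : 2 ^ (n - D - 1) * (s.1 + 2) ^ (D + 1) ≤ (s.1 + 2) ^ n := by
          calc 2 ^ (n - D - 1) * (s.1 + 2) ^ (D + 1)
              ≤ (s.1 + 2) ^ (n - D - 1) * (s.1 + 2) ^ (D + 1) :=
                Nat.mul_le_mul_right _ (Nat.pow_le_pow_left (by omega) _)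
            _ = (s.1 + 2) ^ n := by
                rw [← pow_add]
                congr 1
                omega
        exact_mod_cast h1
    _ = ((2 : ℝ≥0∞) ^ (n - D - 1))⁻¹ *
          ∑' s : RefineIndex D, (((s.1 + 2 : ℕ) : ℝ≥0∞) ^ (D + 1))⁻¹ := ENNReal.tsum_mul_left
    _ ≤ _ := mul_le_of_le_one_right' (tsum_refineIndex_lt_one D).le

section ExpectedCounts

variable {X : Type*} [MeasurableSpace X] {μ : Measure X} {n : ℕ}
  {g : X → Matrix (Fin n) (Fin n) ℝ} {D k j : ℕ}

/-- An upper bound for `stuckCount` in terms of sums over integer tuples. -/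
def stuckSum (S : Set (Fin n → ℝ)) (M : Matrix (Fin n) (Fin n) ℝ) (D : ℕ) : ℝ≥0∞ :=
  (∑' s : RefineIndex D, ∑' w : indepTuples D n,
    (Set.univ.pi fun _ => S).indicator (1 : (Fin D → Fin n → ℝ) → ℝ≥0∞)
      (refineTuple s (act M (icast w.1)))) +
  ∑' a : {a : Fin D → ℤ // ∀ i, a ≠ Pi.single i 1}, ∑' v : indepTuples D n,
    (combSet S a.1).indicator (1 : (Fin D → Fin n → ℝ) → ℝ≥0∞) (act M (icast v.1))

theorem measurable_tsum_indepTuples (hg : IsInvariantFrame μ g)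
    {f : (Fin D → Fin n → ℝ) → ℝ≥0∞} (hf : Measurable f) :
    Measurable fun L => ∑' v : indepTuples D n, f (act (g L) (icast v.1)) :=
  Measurable.tsum fun v => hf.comp (measurable_act_icast hg.measurable v.1)

theorem measurable_stuckSum (hg : IsInvariantFrame μ g) {S : Set (Fin n → ℝ)}
    (hS : MeasurableSet S) : Measurable fun L => stuckSum S (g L) D := by
  have h1 : Measurable ((Set.univ.pi fun _ => S).indicator
      (1 : (Fin D → Fin n → ℝ) → ℝ≥0∞)) :=
    measurable_one.indicator (MeasurableSet.univ_pi fun _ => hS)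
  refine (Measurable.tsum fun s => ?_).add (Measurable.tsum fun a => ?_)
  · exact measurable_tsum_indepTuples hg (h1.comp (measurable_refineTuple s))
  · exact measurable_tsum_indepTuples hg (measurable_one.indicator (measurableSet_combSet hS a.1))

theorem lintegral_stuckSum_le [IsProbabilityMeasure μ] (hg : IsInvariantFrame μ g)
    {S : Set (Fin n → ℝ)} (hS : MeasurableSet S) (hSS : S ∩ (-S) = ∅)
    (hS0 : volume S ≠ 0) (hSt : volume S ≠ ∞) (hDn : D < n) (hD : 2 * D ≤ n) :
    ∫⁻ L, stuckSum S (g L) D ∂μ ≤ volume S ^ D * (((2 : ℝ≥0∞) ^ (n - D - 1))⁻¹ +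
      (((2 : ℝ≥0∞) ^ (n - 2 * D))⁻¹ * 5 ^ D +
        16 * ENNReal.ofReal (Real.exp (-(0.1155 * n))) * 3 ^ D)) := by
  have h1 : Measurable ((Set.univ.pi fun _ => S).indicator
      (1 : (Fin D → Fin n → ℝ) → ℝ≥0∞)) :=
    measurable_one.indicator (MeasurableSet.univ_pi fun _ => hS)
  have h2 : ∀ s : RefineIndex D, Measurable fun L => ∑' w : indepTuples D n,
      (Set.univ.pi fun _ => S).indicator (1 : (Fin D → Fin n → ℝ) → ℝ≥0∞)
        (refineTuple s (act (g L) (icast w.1))) := fun s =>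
    measurable_tsum_indepTuples hg (h1.comp (measurable_refineTuple s))
  have h3 : ∀ a : {a : Fin D → ℤ // ∀ i, a ≠ Pi.single i 1}, Measurable fun L =>
      ∑' v : indepTuples D n, (combSet S a.1).indicator (1 : (Fin D → Fin n → ℝ) → ℝ≥0∞)
        (act (g L) (icast v.1)) := fun a =>
    measurable_tsum_indepTuples hg (measurable_one.indicator (measurableSet_combSet hS a.1))
  unfold stuckSum
  rw [lintegral_add_left (Measurable.tsum h2), lintegral_tsum fun s => (h2 s).aemeasurable,
    lintegral_tsum fun a => (h3 a).aemeasurable, mul_add]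
  refine add_le_add ?_ ?_
  · refine le_trans (le_of_eq ?_) (mul_le_mul_right (tsum_refineIndex_le hDn) _)
    rw [← ENNReal.tsum_mul_left]
    refine tsum_congr fun s => ?_
    refine (lintegral_tsum_indepTuples hg hDn (h1.comp (measurable_refineTuple s))).trans ?_
    simp only [Function.comp_apply]
    rw [lintegral_refineTuple s h1, lintegral_univ_pi_indicator hS, mul_comm]
  · refine le_trans (le_of_eq (tsum_congr fun a => ?_)) (tsum_volume_combSet_le hS hSS hS0 hSt hD)
    rw [lintegral_tsum_indepTuples hg hDn (measurable_one.indicator (measurableSet_combSet hS a.1)),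
      lintegral_indicator_one (measurableSet_combSet hS a.1)]

/-- Tuples in `S` whose first `k` entries enumerate a member of `𝒜`. -/
def leadSet (S : Set (Fin n → ℝ)) (𝒜 : Set (Set (Fin n → ℝ))) (k j : ℕ) :
    Set (Fin (k + j) → Fin n → ℝ) :=
  {x | (∀ i, x i ∈ S) ∧ Set.range (fun i => x (Fin.castAdd j i)) ∈ 𝒜}

theorem measurableSet_leadSet {S : Set (Fin n → ℝ)} (hS : MeasurableSet S)
    {𝒜 : Set (Set (Fin n → ℝ))}
    (h𝒜 : MeasurableSet {x : Fin k → Fin n → ℝ | Set.range x ∈ 𝒜}) :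
    MeasurableSet (leadSet S 𝒜 k j) := by
  have h1 : leadSet S 𝒜 k j = (Set.univ.pi fun _ => S) ∩
      (fun (x : Fin (k + j) → Fin n → ℝ) i => x (Fin.castAdd j i)) ⁻¹'
        {x : Fin k → Fin n → ℝ | Set.range x ∈ 𝒜} := by
    ext x
    simp [leadSet]
  rw [h1]
  exact (MeasurableSet.univ_pi fun _ => hS).inter (h𝒜.preimage (by fun_prop))

theorem volume_leadSet {S : Set (Fin n → ℝ)} (hS : MeasurableSet S)
    {𝒜 : Set (Set (Fin n → ℝ))}
    (h𝒜 : MeasurableSet {x : Fin k → Fin n → ℝ | Set.range x ∈ 𝒜}) :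
    volume (leadSet S 𝒜 k j) = volume (leadSet S 𝒜 k 0) * volume S ^ j := by
  induction j with
  | zero => simp
  | succ j ih =>
    rw [pow_succ, ← mul_assoc, ← ih, ← lintegral_indicator_one (measurableSet_leadSet hS h𝒜),
      ← lintegral_indicator_one (measurableSet_leadSet hS h𝒜), ← lintegral_indicator_one hS,
      ← lintegral_init_mul_last (measurable_one.indicator (measurableSet_leadSet hS h𝒜))
        (measurable_one.indicator hS)]
    refine lintegral_congr fun x => ?_
    have hiff : x ∈ leadSet S 𝒜 k (j + 1) ↔
        (Fin.init x : Fin (k + j) → Fin n → ℝ) ∈ leadSet S 𝒜 k j ∧ x (Fin.last (k + j)) ∈ S := by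
      refine ⟨fun h => ⟨⟨fun i => h.1 i.castSucc, h.2⟩, h.1 _⟩, fun h => ⟨fun i => ?_, h.1.2⟩⟩
      refine Fin.lastCases h.2 (fun i => h.1.1 i) (i : Fin ((k + j) + 1))
    classical
    simp only [Set.indicator_apply, hiff, Pi.one_apply]
    by_cases h1 : (Fin.init x : Fin (k + j) → Fin n → ℝ) ∈ leadSet S 𝒜 k j <;>
      by_cases h2 : x (Fin.last (k + j)) ∈ S <;> simp [h1, h2]

theorem leadCount_eq_tsum {M : Matrix (Fin n) (Fin n) ℝ} (hM : M.det = 1)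
    {S : Set (Fin n → ℝ)} {N : Finset (Fin n → ℝ)}
    (hN : (N : Set (Fin n → ℝ)) = {y | ∃ v : Fin n → ℤ, y = M.mulVec (ivec v)} ∩ S)
    (𝒜 : Set (Set (Fin n → ℝ))) :
    (leadCount N 𝒜 k j : ℝ≥0∞) = ∑' v : indepTuples (k + j) n, (leadSet S 𝒜 k j).indicator
      (1 : (Fin (k + j) → Fin n → ℝ) → ℝ≥0∞) (act M (icast v.1)) := by
  classical
  rw [leadCount, natCast_card_eq_tsum_indepTuples hM hN]
  rfl

theorem lintegral_tsum_leadSet [IsProbabilityMeasure μ] (hg : IsInvariantFrame μ g)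
    {S : Set (Fin n → ℝ)} (hS : MeasurableSet S) {𝒜 : Set (Set (Fin n → ℝ))}
    (h𝒜 : MeasurableSet {x : Fin k → Fin n → ℝ | Set.range x ∈ 𝒜}) (hkj : k + j < n) :
    ∫⁻ L, ∑' v : indepTuples (k + j) n, (leadSet S 𝒜 k j).indicator
      (1 : (Fin (k + j) → Fin n → ℝ) → ℝ≥0∞) (act (g L) (icast v.1)) ∂μ =
      volume (leadSet S 𝒜 k 0) * volume S ^ j := by
  rw [lintegral_tsum_indepTuples hg hkj (measurable_one.indicator (measurableSet_leadSet hS h𝒜)),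
    lintegral_indicator_one (measurableSet_leadSet hS h𝒜), volume_leadSet hS h𝒜]

theorem ae_finite_lattice_inter [IsProbabilityMeasure μ] (hg : IsInvariantFrame μ g) (hn : 1 < n)
    {S : Set (Fin n → ℝ)} (hS : MeasurableSet S) (hS0 : (0 : Fin n → ℝ) ∉ S)
    (hSt : volume S ≠ ∞) :
    ∀ᵐ L ∂μ, ({y | ∃ v : Fin n → ℤ, y = (g L).mulVec (ivec v)} ∩ S).Finite := by
  have hmeas : Measurable ((Set.univ.pi fun _ => S).indicator
      (1 : (Fin 1 → Fin n → ℝ) → ℝ≥0∞)) :=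
    measurable_one.indicator (MeasurableSet.univ_pi fun _ => hS)
  have h1 := lintegral_tsum_indepTuples hg hn hmeas
  rw [lintegral_univ_pi_indicator hS] at h1
  have h2 := ae_lt_top (μ := μ) (measurable_tsum_indepTuples hg hmeas)
    (by rw [h1]; exact ENNReal.pow_ne_top hSt)
  filter_upwards [h2] with L hL
  have h3 := ENNReal.finite_const_le_of_tsum_ne_top hL.ne one_ne_zero
  refine (h3.image fun v => (g L).mulVec (ivec (v.1 0))).subset ?_
  rintro y ⟨⟨v, rfl⟩, hyS⟩
  have hv : (fun _ => v : Fin 1 → Fin n → ℤ) ∈ indepTuples 1 n := by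
    show LinearIndependent ℝ (icast fun _ : Fin 1 => v)
    rw [linearIndependent_unique_iff]
    intro h0
    have h0' : ivec v = 0 := h0
    refine hS0 ?_
    rw [h0', Matrix.mulVec_zero] at hyS
    exact hyS
  refine ⟨⟨_, hv⟩, ?_, rfl⟩
  rw [Set.mem_ofPred_eq, Set.indicator_of_mem]
  · exact le_rfl
  · exact fun _ _ => hyS

/-- The Bonferroni inequality for a random lattice of dimension `n`, in expectation. -/
theorem measure_add_sum_odd_le [IsProbabilityMeasure μ] (hg : IsInvariantFrame μ g)
    {S : Set (Fin n → ℝ)} (hS : MeasurableSet S) (hSS : S ∩ (-S) = ∅)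
    (hS0 : volume S ≠ 0) (hSt : volume S ≠ ∞) {𝒜 : Set (Set (Fin n → ℝ))}
    (h𝒜 : MeasurableSet {x : Fin k → Fin n → ℝ | Set.range x ∈ 𝒜})
    (hcard : ∀ Y ∈ 𝒜, Y.Finite ∧ Y.ncard = k) {t : ℕ} (ht : Even t) (hn : 1 < n)
    (hkt : 2 * (k + t) ≤ n) {E : Set X} (hE : MeasurableSet E)
    (hEA : ∀ L ∈ E, {y | ∃ v : Fin n → ℤ, y = (g L).mulVec (ivec v)} ∩ S ∈ 𝒜) :
    μ E + (∑ j ∈ Finset.range (t + 1) with Odd j, ((k.factorial * j.factorial : ℕ) : ℝ≥0∞)⁻¹ *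
        (volume (leadSet S 𝒜 k 0) * volume S ^ j)) ≤
      (∑ j ∈ Finset.range (t + 1) with Even j, ((k.factorial * j.factorial : ℕ) : ℝ≥0∞)⁻¹ *
        (volume (leadSet S 𝒜 k 0) * volume S ^ j)) +
      ∑ D ∈ Finset.range (k + t + 1), 2 ^ D * ((D.factorial : ℕ) : ℝ≥0∞)⁻¹ *
        (volume S ^ D * (((2 : ℝ≥0∞) ^ (n - D - 1))⁻¹ + (((2 : ℝ≥0∞) ^ (n - 2 * D))⁻¹ * 5 ^ D +
        16 * ENNReal.ofReal (Real.exp (-(0.1155 * n))) * 3 ^ D))) := by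
  have hzero : (0 : Fin n → ℝ) ∉ S := fun h => by
    have h1 : (0 : Fin n → ℝ) ∈ S ∩ (-S) := ⟨h, by simpa using h⟩
    rw [hSS] at h1
    exact h1
  set lead : X → ℕ → ℝ≥0∞ := fun L j => ∑' v : indepTuples (k + j) n, (leadSet S 𝒜 k j).indicator
      (1 : (Fin (k + j) → Fin n → ℝ) → ℝ≥0∞) (act (g L) (icast v.1)) with hlead
  have hleadm : ∀ j, Measurable fun L => lead L j := fun j =>
    measurable_tsum_indepTuples hg (measurable_one.indicator (measurableSet_leadSet hS h𝒜))
  have hleadi : ∀ j ∈ Finset.range (t + 1), ∫⁻ L, lead L j ∂μ =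
      volume (leadSet S 𝒜 k 0) * volume S ^ j := fun j hj => by
    rw [Finset.mem_range] at hj
    exact lintegral_tsum_leadSet hg hS h𝒜 (by omega)
  have hpt : ∀ᵐ L ∂μ, E.indicator (1 : X → ℝ≥0∞) L +
      (∑ j ∈ Finset.range (t + 1) with Odd j,
        ((k.factorial * j.factorial : ℕ) : ℝ≥0∞)⁻¹ * lead L j) ≤
      (∑ j ∈ Finset.range (t + 1) with Even j,
        ((k.factorial * j.factorial : ℕ) : ℝ≥0∞)⁻¹ * lead L j) +
      ∑ D ∈ Finset.range (k + t + 1), 2 ^ D * ((D.factorial : ℕ) : ℝ≥0∞)⁻¹ *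
        stuckSum S (g L) D := by
    filter_upwards [ae_finite_lattice_inter hg hn hS hzero hSt] with L hfin
    have hN : (hfin.toFinset : Set (Fin n → ℝ)) =
        {y | ∃ v : Fin n → ℤ, y = (g L).mulVec (ivec v)} ∩ S := hfin.coe_toFinset
    have hB := bonferroni_leadCount hfin.toFinset hcard ht
    simp only [leadCount_eq_tsum (hg.det_eq_one L) hN] at hB
    refine le_trans (add_le_add ?_ le_rfl) (hB.trans (add_le_add le_rfl
      (Finset.sum_le_sum fun D _ => mul_le_mul_right (stuckCount_le (hg.det_eq_one L) hN) _)))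
    classical
    rw [Set.indicator_apply]
    split_ifs with hLE
    · have h1 := hEA L hLE
      rw [← hN] at h1
      rw [Set.indicator_of_mem h1]
      exact le_rfl
    · exact zero_le
  have hintegral := lintegral_mono_ae hpt
  rw [lintegral_add_left (measurable_one.indicator hE), lintegral_indicator_one hE,
    lintegral_add_left (Finset.measurable_sum _ fun j _ => (hleadm j).const_mul _),
    lintegral_finsetSum _ fun j _ => (hleadm j).const_mul _,
    lintegral_finsetSum _ fun j _ => (hleadm j).const_mul _,
    lintegral_finsetSum _ fun D _ => (measurable_stuckSum hg hS).const_mul _] at hintegral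
  have hterm : ∀ j ∈ Finset.range (t + 1),
      ∫⁻ L, ((k.factorial * j.factorial : ℕ) : ℝ≥0∞)⁻¹ * lead L j ∂μ =
      ((k.factorial * j.factorial : ℕ) : ℝ≥0∞)⁻¹ *
        (volume (leadSet S 𝒜 k 0) * volume S ^ j) := fun j hj => by
    rw [lintegral_const_mul _ (hleadm j), hleadi j hj]
  rw [Finset.sum_congr rfl fun j hj => hterm j (Finset.mem_filter.1 hj).1,
    Finset.sum_congr rfl fun j hj => hterm j (Finset.mem_filter.1 hj).1] at hintegral
  refine hintegral.trans (add_le_add le_rfl (Finset.sum_le_sum fun D hD => ?_))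
  rw [Finset.mem_range] at hD
  rw [lintegral_const_mul _ (measurable_stuckSum hg hS)]
  exact mul_le_mul_right (lintegral_stuckSum_le hg hS hSS hS0 hSt (by omega) (by omega)) _

end ExpectedCounts

section ExponentialSeries

theorem exp_sub_sum_le {l : ℝ} (hl : 0 ≤ l) {s : ℝ} (hs : 0 ≤ s) (N : ℕ) :
    Real.exp l - ∑ j ∈ Finset.range N, l ^ j / j.factorial ≤
      Real.exp (l * Real.exp s - s * N) := by
  have h1 : ∀ x : ℝ, HasSum (fun j : ℕ => x ^ j / j.factorial) (Real.exp x) := fun x => by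
    rw [Real.exp_eq_exp_ℝ]
    exact NormedSpace.expSeries_div_hasSum_exp x
  have h2 : HasSum (fun j : ℕ => if j ∈ Finset.range N then l ^ j / j.factorial else 0)
      (∑ j ∈ Finset.range N, l ^ j / j.factorial) := by
    have h := hasSum_sum_of_ne_finset_zero
      (f := fun j : ℕ => if j ∈ Finset.range N then l ^ j / (j.factorial : ℝ) else 0)
      (s := Finset.range N) (L := .unconditional ℕ) fun j hj => if_neg hj
    rwa [Finset.sum_congr rfl fun j hj => if_pos hj] at h
  have h3 := hasSum_le (fun j => ?_) (h1 l)
    (h2.add ((h1 (l * Real.exp s)).mul_left (Real.exp (-(s * N)))))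
  · rw [← Real.exp_add] at h3
    have h4 : -(s * N) + l * Real.exp s = l * Real.exp s - s * N := by ring
    rw [h4] at h3
    linarith
  · have hpos : 0 ≤ l ^ j / (j.factorial : ℝ) := by positivity
    split_ifs with hj
    · have : 0 ≤ Real.exp (-(s * N)) * ((l * Real.exp s) ^ j / j.factorial) := by positivity
      linarith
    · rw [Finset.mem_range, not_lt] at hj
      have h5 : Real.exp (-(s * N)) * ((l * Real.exp s) ^ j / j.factorial) =
          Real.exp (s * (j - N)) * (l ^ j / j.factorial) := by
        have h6 : Real.exp (s * (j - N)) = Real.exp (-(s * N)) * Real.exp s ^ j := by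
          rw [← Real.exp_nat_mul, ← Real.exp_add]
          congr 1
          ring
        rw [h6, mul_pow]
        ring
      rw [h5, zero_add]
      refine le_mul_of_one_le_left hpos (Real.one_le_exp (mul_nonneg hs ?_))
      rw [sub_nonneg]
      exact_mod_cast hj

theorem sum_neg_pow_le {l : ℝ} (hl : 0 ≤ l) {s : ℝ} (hs : 0 ≤ s) (N : ℕ) :
    ∑ j ∈ Finset.range N, (-l) ^ j / j.factorial ≤
      Real.exp (-l) + Real.exp (l * Real.exp s - s * N) := by
  have h1 := Complex.norm_exp_sub_sum_le_exp_norm_sub_sum ((-l : ℝ) : ℂ) N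
  have h2 : Complex.exp ((-l : ℝ) : ℂ) -
      ∑ m ∈ Finset.range N, ((-l : ℝ) : ℂ) ^ m / (m.factorial : ℂ) =
      ((Real.exp (-l) - ∑ m ∈ Finset.range N, (-l) ^ m / (m.factorial : ℝ) : ℝ) : ℂ) := by
    push_cast
    rfl
  rw [h2, Complex.norm_real, Complex.norm_real, Real.norm_eq_abs, Real.norm_eq_abs, abs_neg,
    abs_of_nonneg hl] at h1
  have h3 := exp_sub_sum_le hl hs N
  linarith [neg_abs_le (Real.exp (-l) - ∑ m ∈ Finset.range N, (-l) ^ m / (m.factorial : ℝ))]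

theorem sum_even_sub_sum_odd (c : ℕ → ℝ) (t : ℕ) :
    (∑ j ∈ Finset.range t with Even j, c j) - ∑ j ∈ Finset.range t with Odd j, c j =
      ∑ j ∈ Finset.range t, (-1) ^ j * c j := by
  rw [Finset.sum_filter, Finset.sum_filter, ← Finset.sum_sub_distrib]
  refine Finset.sum_congr rfl fun j _ => ?_
  rcases Nat.even_or_odd j with h | h
  · have h' : ¬ Odd j := Nat.not_odd_iff_even.2 h
    simp [h, h']
  · have h' : ¬ Even j := Nat.not_even_iff_odd.2 h
    simp [h, h']

theorem sum_error_le {n d : ℕ} {l : ℝ} (hl : 0 ≤ l) (hln : l ≤ n / 200)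
    (hd : 20 * d ≤ 3 * n) :
    ∑ D ∈ Finset.range (d + 1), 2 ^ D * (D.factorial : ℝ)⁻¹ *
        (l ^ D * (((2 : ℝ) ^ (n - D - 1))⁻¹ + (((2 : ℝ) ^ (n - 2 * D))⁻¹ * 5 ^ D +
        16 * Real.exp (-(0.1155 * n)) * 3 ^ D))) ≤ 19 * Real.exp (-(0.05 * n)) := by
  have hsum : ∀ x : ℝ, 0 ≤ x → ∑ D ∈ Finset.range (d + 1), x ^ D / D.factorial ≤ Real.exp x :=
    fun x hx => Real.sum_le_exp_of_nonneg hx _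
  have hexp1 : (2.715 : ℝ) < Real.exp 1 := lt_trans (by norm_num) Real.exp_one_gt_d9
  have h20 : (20 : ℝ) ≤ Real.exp 3 := by
    have h1 : Real.exp 3 = Real.exp 1 ^ 3 := by
      rw [← Real.exp_nat_mul]
      norm_num
    rw [h1]
    calc (20 : ℝ) ≤ 2.715 ^ 3 := by norm_num
      _ ≤ Real.exp 1 ^ 3 := pow_le_pow_left₀ (by norm_num) hexp1.le 3
  have h2 : ((2 : ℝ) ^ n)⁻¹ ≤ Real.exp (-(0.69 * n)) := by
    have h3 : (2 : ℝ) ^ n = Real.exp (n * Real.log 2) := by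
      rw [Real.exp_nat_mul, Real.exp_log (by norm_num)]
    rw [h3, ← Real.exp_neg]
    refine Real.exp_le_exp.2 ?_
    nlinarith [Real.log_two_gt_d9, (Nat.cast_nonneg n : (0 : ℝ) ≤ n)]
  have hdn : (d : ℝ) ≤ 0.15 * n := by
    have : ((20 * d : ℕ) : ℝ) ≤ ((3 * n : ℕ) : ℝ) := by exact_mod_cast hd
    push_cast at this
    linarith
  have hA : (20 : ℝ) ^ d * ((2 : ℝ) ^ n)⁻¹ ≤ Real.exp (-(0.24 * n)) := by
    calc (20 : ℝ) ^ d * ((2 : ℝ) ^ n)⁻¹ ≤ Real.exp 3 ^ d * Real.exp (-(0.69 * n)) := by gcongr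
      _ = Real.exp (d * 3 - 0.69 * n) := by
          rw [← Real.exp_nat_mul, ← Real.exp_add, sub_eq_add_neg]
      _ ≤ _ := Real.exp_le_exp.2 (by linarith)
  have hterm : ∀ D ∈ Finset.range (d + 1), 2 ^ D * (D.factorial : ℝ)⁻¹ *
        (l ^ D * (((2 : ℝ) ^ (n - D - 1))⁻¹ + (((2 : ℝ) ^ (n - 2 * D))⁻¹ * 5 ^ D +
        16 * Real.exp (-(0.1155 * n)) * 3 ^ D))) ≤
      3 * Real.exp (-(0.24 * n)) * ((2 * l) ^ D / D.factorial) +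
        16 * Real.exp (-(0.1155 * n)) * ((6 * l) ^ D / D.factorial) := by
    intro D hD
    rw [Finset.mem_range] at hD
    have h5 : ((2 : ℝ) ^ (n - D - 1))⁻¹ ≤ 2 * Real.exp (-(0.24 * n)) ∨ n = 0 := by
      rcases Nat.eq_zero_or_pos n with h0 | hpos
      · exact Or.inr h0
      refine Or.inl (le_trans ?_ (mul_le_mul_of_nonneg_left hA (by norm_num)))
      have h6 : (2 : ℝ) ^ n = 2 ^ (n - D - 1) * (2 * 2 ^ D) := by
        rw [← pow_succ', ← pow_add]
        congr 1
        omega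
      rw [h6, mul_inv, mul_inv]
      have h7 : (2 : ℝ) ^ D ≤ 20 ^ d := (pow_le_pow_left₀ (by norm_num) (by norm_num) D).trans
        (pow_le_pow_right₀ (by norm_num) (by omega : D ≤ d))
      calc ((2 : ℝ) ^ (n - D - 1))⁻¹ = 2 * (2 ^ D * ((2 ^ (n - D - 1))⁻¹ * (2⁻¹ * (2 ^ D)⁻¹))) := by
            field_simp
        _ ≤ _ := by gcongr
    have h8 : ((2 : ℝ) ^ (n - 2 * D))⁻¹ * 5 ^ D ≤ Real.exp (-(0.24 * n)) := by
      refine le_trans ?_ hA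
      have h6 : (2 : ℝ) ^ n = 2 ^ (n - 2 * D) * 4 ^ D := by
        rw [show (4 : ℝ) = 2 ^ 2 by norm_num, ← pow_mul, ← pow_add]
        congr 1
        omega
      have h7 : (20 : ℝ) ^ D ≤ 20 ^ d := pow_le_pow_right₀ (by norm_num) (by omega : D ≤ d)
      have h9 : (20 : ℝ) ^ D = 4 ^ D * 5 ^ D := by
        rw [← mul_pow]
        norm_num
      calc ((2 : ℝ) ^ (n - 2 * D))⁻¹ * 5 ^ D = 20 ^ D * (2 ^ n)⁻¹ := by
            rw [h6, h9]
            field_simp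
        _ ≤ _ := by gcongr
    have h5' : ((2 : ℝ) ^ (n - D - 1))⁻¹ ≤ 2 * Real.exp (-(0.24 * n)) := by
      rcases h5 with h5 | h5
      · exact h5
      · simp [h5]
    calc 2 ^ D * (D.factorial : ℝ)⁻¹ *
        (l ^ D * (((2 : ℝ) ^ (n - D - 1))⁻¹ + (((2 : ℝ) ^ (n - 2 * D))⁻¹ * 5 ^ D +
        16 * Real.exp (-(0.1155 * n)) * 3 ^ D)))
        ≤ 2 ^ D * (D.factorial : ℝ)⁻¹ *
        (l ^ D * (2 * Real.exp (-(0.24 * n)) + (Real.exp (-(0.24 * n)) +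
        16 * Real.exp (-(0.1155 * n)) * 3 ^ D))) := by gcongr
      _ = _ := by
        rw [show (6 : ℝ) * l = 2 * 3 * l by norm_num, mul_pow, mul_pow, mul_pow]
        ring
  refine (Finset.sum_le_sum hterm).trans ?_
  rw [Finset.sum_add_distrib, ← Finset.mul_sum, ← Finset.mul_sum]
  have e1 : Real.exp (-(0.24 * n)) * Real.exp (2 * l) ≤ Real.exp (-(0.05 * n)) := by
    rw [← Real.exp_add]
    exact Real.exp_le_exp.2 (by linarith [(Nat.cast_nonneg n : (0 : ℝ) ≤ n)])
  have e2 : Real.exp (-(0.1155 * n)) * Real.exp (6 * l) ≤ Real.exp (-(0.05 * n)) := by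
    rw [← Real.exp_add]
    exact Real.exp_le_exp.2 (by linarith [(Nat.cast_nonneg n : (0 : ℝ) ≤ n)])
  calc _ ≤ 3 * Real.exp (-(0.24 * n)) * Real.exp (2 * l) +
        16 * Real.exp (-(0.1155 * n)) * Real.exp (6 * l) := by
        gcongr
        · exact hsum _ (by positivity)
        · exact hsum _ (by positivity)
    _ ≤ _ := by linarith

end ExponentialSeries

section PoissonLaw

variable {n : ℕ}

theorem volume_not_injective (hn : n ≠ 0) (m : ℕ) :
    volume {x : Fin m → Fin n → ℝ | ¬ Function.Injective x} = 0 := by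
  have h1 : {x : Fin m → Fin n → ℝ | ¬ Function.Injective x} ⊆
      ⋃ p : {p : Fin m × Fin m // p.1 ≠ p.2}, {x | x p.1.1 = x p.1.2} := by
    intro x hx
    rw [Set.mem_ofPred_eq, Function.not_injective_iff] at hx
    obtain ⟨i, j, hij, hne⟩ := hx
    exact Set.mem_iUnion.2 ⟨⟨(i, j), hne⟩, hij⟩
  refine measure_mono_null h1 (measure_iUnion_null ?_)
  rintro ⟨⟨i, j⟩, hne⟩
  set K : Submodule ℝ (Fin m → Fin n → ℝ) :=
    LinearMap.ker (LinearMap.proj (R := ℝ) (φ := fun _ : Fin m => Fin n → ℝ) i - LinearMap.proj j)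
    with hK
  have hset : {x : Fin m → Fin n → ℝ | x i = x j} = K := by
    ext x
    simp [hK, sub_eq_zero]
  have hKtop : K ≠ ⊤ := by
    intro htop
    have h2 : (Pi.single i 1 : Fin m → Fin n → ℝ) ∈ K := htop ▸ Submodule.mem_top
    rw [← SetLike.mem_coe, ← hset, Set.mem_ofPred_eq, Pi.single_eq_same,
      Pi.single_eq_of_ne hne.symm] at h2
    exact one_ne_zero (congrFun h2 ⟨0, Nat.pos_of_ne_zero hn⟩)
  rw [hset]
  exact Measure.addHaar_submodule volume K hKtop

theorem poissonLaw_eq (hn : n ≠ 0) {S : Set (Fin n → ℝ)}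
    (hS0 : volume S ≠ 0) (hSt : volume S ≠ ∞) {𝒜 : Set (Set (Fin n → ℝ))} {k : ℕ}
    (hcard : ∀ Y ∈ 𝒜, Y.Finite ∧ Y.ncard = k)
    (h𝒜 : ∀ m : ℕ, MeasurableSet {x : Fin m → (Fin n → ℝ) | Set.range x ∈ 𝒜}) :
    poissonLaw n S 𝒜 = Real.exp (-(volume S).toReal) / k.factorial *
      (volume (leadSet S 𝒜 k 0)).toReal := by
  have hintegral : ∀ m : ℕ, ∫ x in Set.univ.pi (fun _ : Fin m => S),
      Set.indicator 𝒜 (fun _ => (1 : ℝ)) (Set.range x) =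
      (volume ({x : Fin m → Fin n → ℝ | Set.range x ∈ 𝒜} ∩ Set.univ.pi fun _ => S)).toReal := by
    intro m
    have h1 : (fun x : Fin m → Fin n → ℝ => Set.indicator 𝒜 (fun _ => (1 : ℝ)) (Set.range x)) =
        {x : Fin m → Fin n → ℝ | Set.range x ∈ 𝒜}.indicator 1 := rfl
    rw [h1, integral_indicator_one (h𝒜 m), measureReal_restrict_apply (h𝒜 m)]
    rfl
  have hl : (volume S).toReal ≠ 0 := ENNReal.toReal_ne_zero.2 ⟨hS0, hSt⟩
  unfold poissonLaw
  rw [tsum_eq_single k]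
  · rw [hintegral]
    have hset : ({x : Fin k → Fin n → ℝ | Set.range x ∈ 𝒜} ∩ Set.univ.pi fun _ => S) =
        leadSet S 𝒜 k 0 := by
      ext x
      refine ⟨fun h => ⟨fun i => h.2 i trivial, h.1⟩, fun h => ⟨h.2, fun i _ => h.1 i⟩⟩
    rw [hset]
    field_simp
  · intro m hm
    have hnull : volume ({x : Fin m → Fin n → ℝ | Set.range x ∈ 𝒜} ∩
        Set.univ.pi fun _ => S) = 0 := by
      refine measure_mono_null ?_ (volume_not_injective hn m)
      rintro x ⟨hx, -⟩ hinj
      refine hm ?_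
      rw [← (hcard _ hx).2, ← Set.image_univ, Set.ncard_image_of_injective _ hinj, Set.ncard_univ,
        Nat.card_eq_fintype_card, Fintype.card_fin]
    rw [hintegral, hnull]
    simp

end PoissonLaw

section RealBonferroni

variable {X : Type*} [MeasurableSpace X] {μ : Measure X} {n : ℕ}
  {g : X → Matrix (Fin n) (Fin n) ℝ} {k : ℕ}

theorem volume_leadSet_le (S : Set (Fin n → ℝ)) (𝒜 : Set (Set (Fin n → ℝ))) :
    volume (leadSet S 𝒜 k 0) ≤ volume S ^ k := by
  have h1 : leadSet S 𝒜 k 0 ⊆ Set.univ.pi fun _ => S := fun x hx i _ => hx.1 i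
  refine (measure_mono h1).trans (le_of_eq ?_)
  rw [volume_pi_pi]
  simp

theorem measureReal_le_sum_add [IsProbabilityMeasure μ] (hg : IsInvariantFrame μ g)
    {S : Set (Fin n → ℝ)} (hS : MeasurableSet S) (hSS : S ∩ (-S) = ∅)
    (hS0 : volume S ≠ 0) (hSt : volume S ≠ ∞) {𝒜 : Set (Set (Fin n → ℝ))}
    (h𝒜 : MeasurableSet {x : Fin k → Fin n → ℝ | Set.range x ∈ 𝒜})
    (hcard : ∀ Y ∈ 𝒜, Y.Finite ∧ Y.ncard = k) {t : ℕ} (ht : Even t) (hn : 1 < n)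
    (hkt : 2 * (k + t) ≤ n) {E : Set X} (hE : MeasurableSet E)
    (hEA : ∀ L ∈ E, {y | ∃ v : Fin n → ℤ, y = (g L).mulVec (ivec v)} ∩ S ∈ 𝒜) :
    (μ E).toReal ≤ (volume (leadSet S 𝒜 k 0)).toReal / k.factorial *
        (∑ j ∈ Finset.range (t + 1), (-(volume S).toReal) ^ j / j.factorial) +
      ∑ D ∈ Finset.range (k + t + 1), 2 ^ D * (D.factorial : ℝ)⁻¹ *
        ((volume S).toReal ^ D * (((2 : ℝ) ^ (n - D - 1))⁻¹ + (((2 : ℝ) ^ (n - 2 * D))⁻¹ * 5 ^ D +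
        16 * Real.exp (-(0.1155 * n)) * 3 ^ D))) := by
  have hat : volume (leadSet S 𝒜 k 0) ≠ ∞ :=
    ne_top_of_le_ne_top (ENNReal.pow_ne_top hSt) (volume_leadSet_le S 𝒜)
  have h := measure_add_sum_odd_le hg hS hSS hS0 hSt h𝒜 hcard ht hn hkt hE hEA
  have hc : ∀ j : ℕ, ((k.factorial * j.factorial : ℕ) : ℝ≥0∞)⁻¹ *
      (volume (leadSet S 𝒜 k 0) * volume S ^ j) ≠ ∞ := fun j =>
    ENNReal.mul_ne_top (ENNReal.inv_ne_top.2 (by positivity))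
      (ENNReal.mul_ne_top hat (ENNReal.pow_ne_top hSt))
  have hi : ∀ m : ℕ, ((2 : ℝ≥0∞) ^ m)⁻¹ ≠ ∞ := fun m => ENNReal.inv_ne_top.2 (by positivity)
  have hb1 : ∀ D : ℕ, ((2 : ℝ≥0∞) ^ (n - 2 * D))⁻¹ * 5 ^ D ≠ ∞ := fun D =>
    ENNReal.mul_ne_top (hi _) (by finiteness)
  have hb2 : ∀ D : ℕ, 16 * ENNReal.ofReal (Real.exp (-(0.1155 * n))) * 3 ^ D ≠ ∞ := fun D => by
    finiteness
  have hb : ∀ D : ℕ, 2 ^ D * ((D.factorial : ℕ) : ℝ≥0∞)⁻¹ *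
      (volume S ^ D * (((2 : ℝ≥0∞) ^ (n - D - 1))⁻¹ + (((2 : ℝ≥0∞) ^ (n - 2 * D))⁻¹ * 5 ^ D +
      16 * ENNReal.ofReal (Real.exp (-(0.1155 * n))) * 3 ^ D))) ≠ ∞ := fun D =>
    ENNReal.mul_ne_top (ENNReal.mul_ne_top (by finiteness) (ENNReal.inv_ne_top.2 (by positivity)))
      (ENNReal.mul_ne_top (ENNReal.pow_ne_top hSt)
        (ENNReal.add_ne_top.2 ⟨hi _, ENNReal.add_ne_top.2 ⟨hb1 D, hb2 D⟩⟩))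
  have h2 := ENNReal.toReal_mono (ENNReal.add_ne_top.2
    ⟨ENNReal.sum_ne_top.2 fun j _ => hc j, ENNReal.sum_ne_top.2 fun D _ => hb D⟩) h
  rw [ENNReal.toReal_add (measure_ne_top μ E) (ENNReal.sum_ne_top.2 fun j _ => hc j),
    ENNReal.toReal_add (ENNReal.sum_ne_top.2 fun j _ => hc j)
      (ENNReal.sum_ne_top.2 fun D _ => hb D),
    ENNReal.toReal_sum fun j _ => hc j, ENNReal.toReal_sum fun j _ => hc j,
    ENNReal.toReal_sum fun D _ => hb D] at h2
  have hterm : ∀ D : ℕ, (2 ^ D * ((D.factorial : ℕ) : ℝ≥0∞)⁻¹ *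
      (volume S ^ D * (((2 : ℝ≥0∞) ^ (n - D - 1))⁻¹ + (((2 : ℝ≥0∞) ^ (n - 2 * D))⁻¹ * 5 ^ D +
      16 * ENNReal.ofReal (Real.exp (-(0.1155 * n))) * 3 ^ D)))).toReal =
      2 ^ D * (D.factorial : ℝ)⁻¹ *
        ((volume S).toReal ^ D * (((2 : ℝ) ^ (n - D - 1))⁻¹ + (((2 : ℝ) ^ (n - 2 * D))⁻¹ * 5 ^ D +
        16 * Real.exp (-(0.1155 * n)) * 3 ^ D))) := fun D => by
    rw [ENNReal.toReal_mul, ENNReal.toReal_mul, ENNReal.toReal_mul,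
      ENNReal.toReal_add (hi _) (ENNReal.add_ne_top.2 ⟨hb1 D, hb2 D⟩),
      ENNReal.toReal_add (hb1 D) (hb2 D)]
    simp only [ENNReal.toReal_mul, ENNReal.toReal_pow, ENNReal.toReal_inv, ENNReal.toReal_natCast,
      ENNReal.toReal_ofNat, ENNReal.toReal_ofReal (Real.exp_nonneg _)]
  simp only [hterm] at h2
  have hsum := sum_even_sub_sum_odd (fun j => (((k.factorial * j.factorial : ℕ) : ℝ≥0∞)⁻¹ *
      (volume (leadSet S 𝒜 k 0) * volume S ^ j)).toReal) (t + 1)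
  have hlead : ∑ j ∈ Finset.range (t + 1), (-1) ^ j *
      (((k.factorial * j.factorial : ℕ) : ℝ≥0∞)⁻¹ *
        (volume (leadSet S 𝒜 k 0) * volume S ^ j)).toReal =
      (volume (leadSet S 𝒜 k 0)).toReal / k.factorial *
        (∑ j ∈ Finset.range (t + 1), (-(volume S).toReal) ^ j / j.factorial) := by
    rw [Finset.mul_sum]
    refine Finset.sum_congr rfl fun j _ => ?_
    simp only [ENNReal.toReal_mul, ENNReal.toReal_pow, ENNReal.toReal_inv, ENNReal.toReal_natCast]
    rw [neg_pow (volume S).toReal]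
    push_cast
    field_simp
  rw [hlead] at hsum
  linarith

end RealBonferroni

/-- **Lemma 4.1.** There are universal constants `c, C > 0` such that whenever `n ≥ 20`,
`S ⊆ ℝⁿ` is a Borel set with `S ∩ (-S) = ∅` and `0 < Vol(S) ≤ n/200`, `μ` is an
`SL(n,ℝ)`-invariant Borel probability measure on the space of covolume-one lattices,
`0 ≤ k ≤ n/10`, and `𝒜ₖ` is a Borel collection of finite subsets of `S` all of
cardinality exactly `k`, then `μ(L ∩ S ∈ 𝒜ₖ) - P_λ(𝒜ₖ) ≤ C e^{-cn}`. -/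
theorem lattice_probability_le_poisson_probability :
    ∃ c C : ℝ, 0 < c ∧ 0 < C ∧
      ∀ n : ℕ, 20 ≤ n →
      ∀ S : Set (Fin n → ℝ), MeasurableSet S → S ∩ (-S) = ∅ →
        0 < volume S → volume S ≤ ENNReal.ofReal ((n : ℝ) / 200) →
      ∀ μ : Measure (LatticeSpace n), IsProbabilityMeasure μ →
        (∀ g : SLR n, Measure.map (fun x => g • x) μ = μ) →
      ∀ k : ℕ, (k : ℝ) ≤ (n : ℝ) / 10 →
      ∀ 𝒜 : Set (Set (Fin n → ℝ)),
        (∀ X ∈ 𝒜, X ⊆ S ∧ X.Finite ∧ X.ncard = k) →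
        MeasurableSet {L : LatticeSpace n |
          (latticeOf L ∩ S).Finite ∧ latticeOf L ∩ S ∈ 𝒜} →
        (∀ m : ℕ, MeasurableSet {x : Fin m → (Fin n → ℝ) | Set.range x ∈ 𝒜}) →
        (μ {L : LatticeSpace n |
            (latticeOf L ∩ S).Finite ∧ latticeOf L ∩ S ∈ 𝒜}).toReal
          - poissonLaw n S 𝒜 ≤ C * Real.exp (-(c * n)) := by
  refine ⟨0.05, 30, by norm_num, by norm_num, ?_⟩
  intro n hn S hS hSS hSpos hSle μ hμ hinv k hk 𝒜 hcard hE h𝒜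
  have hS0 : volume S ≠ 0 := hSpos.ne'
  have hSt : volume S ≠ ∞ := ne_top_of_le_ne_top ENNReal.ofReal_ne_top hSle
  obtain ⟨g, hg, hgL⟩ := exists_isInvariantFrame n μ hinv
  have hcard' : ∀ Y ∈ 𝒜, Y.Finite ∧ Y.ncard = k := fun Y hY => (hcard Y hY).2
  set l := (volume S).toReal with hl
  have hl0 : 0 ≤ l := ENNReal.toReal_nonneg
  have hln : l ≤ n / 200 := ENNReal.toReal_le_of_le_ofReal (by positivity) hSle
  set t := 2 * (n / 40) with ht
  have hkn : 10 * k ≤ n := by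
    have h1 : (10 : ℝ) * k ≤ n := by linarith
    exact_mod_cast h1
  have h1 := measureReal_le_sum_add hg hS hSS hS0 hSt (h𝒜 k) hcard' (even_two_mul (n / 40))
    (by omega) (by omega : 2 * (k + t) ≤ n) hE (fun L hL => hgL L ▸ hL.2)
  rw [← hl, ← ht] at h1
  have h2 := sum_error_le hl0 hln (by omega : 20 * (k + t) ≤ 3 * n)
  rw [poissonLaw_eq (by omega) hS0 hSt hcard' h𝒜, ← hl]
  set a := (volume (leadSet S 𝒜 k 0)).toReal with ha
  have ha0 : 0 ≤ a / k.factorial := div_nonneg ENNReal.toReal_nonneg (by positivity)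
  have hal : a / k.factorial ≤ Real.exp l := by
    have h3 : a ≤ l ^ k := by
      rw [ha, hl, ← ENNReal.toReal_pow]
      exact ENNReal.toReal_mono (ENNReal.pow_ne_top hSt) (volume_leadSet_le S 𝒜)
    refine le_trans ?_ (Real.pow_div_factorial_le_exp l hl0 k)
    gcongr
  have h4 := mul_le_mul_of_nonneg_left (sum_neg_pow_le hl0 (zero_le_two) (t + 1)) ha0
  have h5 : a / k.factorial * Real.exp (l * Real.exp 2 - 2 * (t + 1 : ℕ)) ≤
      11 * Real.exp (-(0.05 * n)) := by
    have he2 : Real.exp 2 ≤ 7.4 := by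
      have h6 : Real.exp 2 = Real.exp 1 ^ 2 := by
        rw [← Real.exp_nat_mul]
        norm_num
      rw [h6]
      calc Real.exp 1 ^ 2 ≤ 2.72 ^ 2 := pow_le_pow_left₀ (Real.exp_nonneg _)
            (Real.exp_one_lt_d9.le.trans (by norm_num)) 2
        _ ≤ 7.4 := by norm_num
    have htn : (n : ℝ) ≤ 20 * (t + 1 : ℕ) + 19 := by
      have : n ≤ 20 * (t + 1) + 19 := by omega
      exact_mod_cast this
    calc a / k.factorial * Real.exp (l * Real.exp 2 - 2 * (t + 1 : ℕ))
        ≤ Real.exp l * Real.exp (l * Real.exp 2 - 2 * (t + 1 : ℕ)) := by gcongr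
      _ = Real.exp (l + (l * Real.exp 2 - 2 * (t + 1 : ℕ))) := (Real.exp_add _ _).symm
      _ ≤ Real.exp (2 + -(0.05 * n)) := by
          refine Real.exp_le_exp.2 ?_
          have h7 : l * Real.exp 2 ≤ n / 200 * 7.4 := by gcongr
          linarith
      _ ≤ 11 * Real.exp (-(0.05 * n)) := by
          rw [Real.exp_add]
          gcongr
          linarith
  have h6 : Real.exp (-l) / k.factorial * a = a / k.factorial * Real.exp (-l) := by ring
  rw [h6]
  rw [mul_add] at h4
  linarith
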